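/- Suppose w=(w₁,w₂) with w₁+w₂ = 1 and w₁ > w₂ > 0. Then for any unimodular lattice Λ in ℝ³ and any nonempty open subset U of ℝ², the Hausdorff dimension of the set {x ∈ U : the trajectory {a_t h(x)Λ : t ≥ 0} is divergent} is at least 2 − 1/(1+w₁). Here divergence of the trajectory is taken in the equivalent (Mahler compactness criterion) form: for every δ > 0 there exists T ≥ 0 such that for all t ≥ T the lattice a_t h(x)Λ contains a nonzero vector of Euclidean norm less than δ. -/

import Mathlib

open MeasureTheory

/-- The diagonal matrix `aₜ = diag(e^{w₁t}, e^{w₂t}, e^{-t})`. -/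
noncomputable def aMat (w₁ w₂ t : ℝ) : Matrix (Fin 3) (Fin 3) ℝ :=
  Matrix.diagonal ![Real.exp (w₁ * t), Real.exp (w₂ * t), Real.exp (-t)]

/-- The unipotent matrix `h(x)` with rows `(1,0,x₁), (0,1,x₂), (0,0,1)`. -/
def hMat (x : EuclideanSpace ℝ (Fin 2)) : Matrix (Fin 3) (Fin 3) ℝ :=
  !![1, 0, x 0; 0, 1, x 1; 0, 0, 1]

open scoped Pointwise

lemma volume_preimage_box {ι : Type*} [Fintype ι] [DecidableEq ι] (M : Matrix ι ι ℝ)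
    (hM : |M.det| = 1) (b : ι → ℝ) :
    volume {x : ι → ℝ | ∀ i, M.mulVec x i ∈ Set.Icc 0 (b i)} = ∏ i, ENNReal.ofReal (b i) := by
  have hdet : LinearMap.det (Matrix.toLin' M) ≠ 0 := by
    rw [LinearMap.det_toLin']
    intro h
    simp [h] at hM
  have h1 := Measure.addHaar_preimage_linearMap (volume : Measure (ι → ℝ)) hdet
    (Set.Icc (0 : ι → ℝ) b)
  have h2 : {x : ι → ℝ | ∀ i, M.mulVec x i ∈ Set.Icc 0 (b i)} =
      Matrix.toLin' M ⁻¹' Set.Icc (0 : ι → ℝ) b := by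
    ext x
    simp [Pi.le_def, forall_and]
  rw [h2, h1, LinearMap.det_toLin', abs_inv, hM, Real.volume_Icc_pi]
  simp

/-- A Blichfeldt-type lower bound for the number of lattice points in a symmetric box. -/
lemma exists_finset_int_mulVec_abs_le {ι : Type*} [Fintype ι] [DecidableEq ι] (M : Matrix ι ι ℝ)
    (hM : |M.det| = 1) (b : ι → ℝ) (hb : ∀ i, 0 ≤ b i) :
    ∃ T : Finset (ι → ℤ), ∏ i, b i ≤ T.card ∧
      ∀ u ∈ T, ∀ i, |M.mulVec (fun j => (u j : ℝ)) i| ≤ b i := by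
  classical
  set A : Set (ι → ℝ) := {x : ι → ℝ | ∀ i, M.mulVec x i ∈ Set.Icc 0 (b i)} with hA
  have hAm : MeasurableSet A := by
    have : A = M.mulVecLin ⁻¹' Set.Icc (0 : ι → ℝ) b := by
      ext x
      simp [hA, Pi.le_def, forall_and]
    rw [this]
    exact (M.mulVecLin.continuous_of_finiteDimensional.measurable) measurableSet_Icc
  set e := Pi.basisFun ℝ ι
  set F := ZSpan.fundamentalDomain e
  have hfd := ZSpan.isAddFundamentalDomain' e (volume : Measure (ι → ℝ))
  have hF : volume F = 1 := by
    rw [ZSpan.volume_fundamentalDomain]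
    have : Matrix.of (e : ι → ι → ℝ) = 1 := by
      ext i j
      simp [e, Pi.single_apply, Matrix.one_apply, eq_comm]
    rw [this]
    simp
  have hvol : volume A = ENNReal.ofReal (∏ i, b i) := by
    rw [volume_preimage_box M hM, ENNReal.ofReal_prod_of_nonneg fun i _ => hb i]
  have h_coords : ∀ g : (Submodule.span ℤ (Set.range e)).toAddSubgroup,
      ∃ u : ι → ℤ, ∀ i, (u i : ℝ) = (g : ι → ℝ) i := by
    intro g
    have := (e.mem_span_iff_repr_mem ℤ (g : ι → ℝ)).1 g.2
    choose u hu using this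
    exact ⟨u, fun i => by simpa [e] using hu i⟩
  choose u hu using h_coords
  have huinj : Function.Injective u := fun g g' h => Subtype.ext <| funext fun i => by
    rw [← hu, ← hu, h]
  have : Countable (Submodule.span ℤ (Set.range e)).toAddSubgroup := huinj.countable
  have hsum := hfd.measure_eq_tsum A
  have hcount : volume A = ∫⁻ x in F, ∑' g : (Submodule.span ℤ (Set.range e)).toAddSubgroup,
      (g +ᵥ A).indicator (fun _ => (1 : ENNReal)) x := by
    rw [lintegral_tsum]
    · rw [hsum]
      congr 1
      ext g
      have hg : MeasurableSet (g +ᵥ A) := hAm.const_vadd g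
      rw [lintegral_indicator_const hg, one_mul, Measure.restrict_apply hg]
    · intro g
      exact (measurable_const.indicator (hAm.const_vadd g)).aemeasurable
  have : IsProbabilityMeasure (volume.restrict F) := ⟨by simpa using hF⟩
  obtain ⟨x, hx⟩ := exists_lintegral_le (μ := volume.restrict F)
    (f := fun x => ∑' g : (Submodule.span ℤ (Set.range e)).toAddSubgroup,
      (g +ᵥ A).indicator (fun _ => (1 : ENNReal)) x) (by rw [← hcount, hvol]; simp)
  rw [← hcount, hvol] at hx
  set S : Set ((Submodule.span ℤ (Set.range e)).toAddSubgroup) := {g | x ∈ g +ᵥ A} with hS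
  have hS' : ENNReal.ofReal (∏ i, b i) ≤ (S.encard : ENNReal) := by
    refine hx.trans (le_of_eq ?_)
    rw [← ENNReal.tsum_set_one, tsum_subtype S (fun _ => (1 : ENNReal))]
    rfl
  have hT : ∃ T : Finset ((Submodule.span ℤ (Set.range e)).toAddSubgroup),
      ↑T ⊆ S ∧ ∏ i, b i ≤ T.card := by
    by_cases hfin : S.Finite
    · refine ⟨hfin.toFinset, by simp, ?_⟩
      rw [hfin.encard_eq_coe_toFinset_card] at hS'
      have := ENNReal.toReal_mono (by simp) hS'
      rw [ENNReal.toReal_ofReal (Finset.prod_nonneg fun i _ => hb i)] at this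
      simpa using this
    · obtain ⟨T, hT, hTc⟩ := Set.Infinite.exists_subset_card_eq hfin ⌈∏ i, b i⌉₊
      exact ⟨T, hT, by rw [hTc]; exact Nat.le_ceil _⟩
  obtain ⟨T, hTS, hTc⟩ := hT
  rcases T.eq_empty_or_nonempty with rfl | ⟨g₀, hg₀⟩
  · exact ⟨∅, by simpa using hTc, by simp⟩
  refine ⟨T.image (fun g => u g₀ - u g), ?_, ?_⟩
  · rw [Finset.card_image_of_injective]
    · exact hTc
    · intro g g' h
      have h' : u g = u g' := by simpa using h
      exact huinj h'
  · intro v hv i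
    obtain ⟨g, hg, rfl⟩ := Finset.mem_image.1 hv
    have key : ∀ g ∈ S, x - (g : ι → ℝ) ∈ A := by
      intro g hg
      obtain ⟨a, ha, hax⟩ := hg
      have : (g : ι → ℝ) + a = x := hax
      rw [← this]
      simpa using ha
    have h1 := key g (hTS hg) i
    have h0 := key g₀ (hTS hg₀) i
    have : (fun j => (((u g₀ - u g) j : ℤ) : ℝ)) = (x - (g : ι → ℝ)) - (x - (g₀ : ι → ℝ)) := by
      funext j
      simp [hu]
    rw [this, Matrix.mulVec_sub, Pi.sub_apply, abs_le]
    constructor <;> linarith [h1.1, h1.2, h0.1, h0.2]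

lemma card_int_le_of_sub_le (s : Finset ℤ) (D : ℝ) (hD : 0 ≤ D)
    (h : ∀ i ∈ s, ∀ j ∈ s, (i : ℝ) - j ≤ D) : (s.card : ℝ) ≤ D + 1 := by
  rcases s.eq_empty_or_nonempty with rfl | hs
  · simp; linarith
  have hsub : s ⊆ Finset.Icc (s.min' hs) (s.max' hs) := fun i hi =>
    Finset.mem_Icc.2 ⟨s.min'_le i hi, s.le_max' i hi⟩
  have h1 := Finset.card_le_card hsub
  rw [Int.card_Icc] at h1
  have h2 := h _ (s.max'_mem hs) _ (s.min'_mem hs)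
  have h3 : s.min' hs ≤ s.max' hs := s.min'_le _ (s.max'_mem hs)
  have h4 : ((s.card : ℤ) : ℝ) ≤ ((s.max' hs + 1 - s.min' hs : ℤ) : ℝ) := by
    exact_mod_cast (by omega : (s.card : ℤ) ≤ s.max' hs + 1 - s.min' hs)
  push_cast at h4
  linarith

lemma card_le_mul_card_image_real {α β : Type*} [DecidableEq β] (s : Finset α) (f : α → β) (c : ℝ)
    (h : ∀ b ∈ s.image f, ((s.filter fun x => f x = b).card : ℝ) ≤ c) :
    (s.card : ℝ) ≤ c * (s.image f).card := by
  rcases s.eq_empty_or_nonempty with rfl | ⟨x, hx⟩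
  · simp
  have hc : 0 ≤ c := (Nat.cast_nonneg _).trans (h _ (Finset.mem_image_of_mem f hx))
  have := Finset.card_le_mul_card_image (f := f) s ⌊c⌋₊ fun b hb => Nat.le_floor (h b hb)
  calc (s.card : ℝ) ≤ (⌊c⌋₊ * (s.image f).card : ℕ) := by exact_mod_cast this
    _ ≤ c * (s.image f).card := by
      push_cast
      gcongr
      exact Nat.floor_le hc

lemma card_nonzero_int_le (s : Finset ℤ) (X : ℝ) (hX : 0 ≤ X)
    (h : ∀ i ∈ s, i ≠ 0 ∧ |(i : ℝ)| ≤ X) : (s.card : ℝ) ≤ 2 * X := by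
  have hsub : s ⊆ (Finset.Icc (-⌊X⌋) ⌊X⌋).erase 0 := by
    intro i hi
    obtain ⟨h0, h1⟩ := h i hi
    rw [abs_le] at h1
    refine Finset.mem_erase.2 ⟨h0, Finset.mem_Icc.2 ⟨?_, Int.le_floor.2 h1.2⟩⟩
    have : -i ≤ ⌊X⌋ := Int.le_floor.2 (by push_cast; linarith)
    omega
  have hf : 0 ≤ ⌊X⌋ := Int.floor_nonneg.2 hX
  have h1 := Finset.card_le_card hsub
  rw [Finset.card_erase_of_mem (by simp [hf]), Int.card_Icc] at h1
  have h2 : (s.card : ℤ) ≤ 2 * ⌊X⌋ := by omega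
  have h3 : ((s.card : ℤ) : ℝ) ≤ ((2 * ⌊X⌋ : ℤ) : ℝ) := by exact_mod_cast h2
  push_cast at h3
  linarith [Int.floor_le X]

section PlanarCount

variable {a₁ c₁ a₂ c₂ r : ℝ}

lemma abs_int_le_of_box (hr : 0 < r) (hdet : |r * (a₁ * c₂ - a₂ * c₁)| = 1) {a b : ℝ} {i n : ℤ}
    (h1 : |i * a₁ + n * c₁| ≤ a) (h2 : |i * a₂ + n * c₂| ≤ b) :
    |(n : ℝ)| ≤ r * (|a₁| * b + |a₂| * a) := by
  have e : (n : ℝ) * (r * (a₁ * c₂ - a₂ * c₁)) =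
      r * (a₁ * (i * a₂ + n * c₂) - a₂ * (i * a₁ + n * c₁)) := by ring
  calc |(n : ℝ)| = |(n : ℝ) * (r * (a₁ * c₂ - a₂ * c₁))| := by rw [abs_mul, hdet, mul_one]
    _ = r * |a₁ * (i * a₂ + n * c₂) - a₂ * (i * a₁ + n * c₁)| := by
      rw [e, abs_mul, abs_of_pos hr]
    _ ≤ r * (|a₁ * (i * a₂ + n * c₂)| + |a₂ * (i * a₁ + n * c₁)|) := by
      gcongr; exact abs_sub _ _
    _ ≤ r * (|a₁| * b + |a₂| * a) := by
      rw [abs_mul, abs_mul]; gcongr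

lemma abs_mul_le_of_box {a b x : ℝ} (ha : 0 ≤ a) (hb : 0 ≤ b)
    (h1 : |x * a₁| ≤ a) (h2 : |x * a₂| ≤ b) :
    |x| * (|a₁| * b + |a₂| * a) ≤ 2 * (a * b) := by
  rw [abs_mul] at h1 h2
  nlinarith [mul_le_mul_of_nonneg_right h1 hb, mul_le_mul_of_nonneg_left h2 ha]

/-- The number of nonzero points of a planar lattice in a box. -/
lemma card_box_le (hr : 0 < r) (hdet : |r * (a₁ * c₂ - a₂ * c₁)| = 1) (ha₂ : a₂ ≠ 0) {a b : ℝ}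
    (ha : 0 < a) (hb : 0 ≤ b) (T : Finset (ℤ × ℤ))
    (hT : ∀ p ∈ T, p ≠ 0 ∧ |p.1 * a₁ + p.2 * c₁| ≤ a ∧ |p.1 * a₂ + p.2 * c₂| ≤ b) :
    (T.card : ℝ) ≤ 4 * b / |a₂| + 2 * (r * (|a₁| * b + |a₂| * a)) + 8 * (r * a * b) := by
  classical
  set σ := |a₁| * b + |a₂| * a with hσ
  have ha₂' : 0 < |a₂| := abs_pos.2 ha₂
  have hσ0 : 0 < σ := by positivity
  have hI : 4 * (a * b) / σ ≤ 4 * b / |a₂| := by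
    rw [div_le_div_iff₀ hσ0 ha₂']
    have : 0 ≤ |a₁| * b := by positivity
    rw [hσ]
    nlinarith
  have hI0 : 0 ≤ 4 * (a * b) / σ := by positivity
  have hdiv : ∀ x C : ℝ, |x| * σ ≤ C → |x| ≤ C / σ := fun x C h => (le_div_iff₀ hσ0).2 h
  have hzero : ((T.filter fun p => p.2 = 0).card : ℝ) ≤ 4 * (a * b) / σ := by
    have hinj : Set.InjOn Prod.fst (T.filter fun p : ℤ × ℤ => p.2 = 0 : Set (ℤ × ℤ)) := by
      rintro ⟨i, n⟩ h ⟨i', n'⟩ h' hii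
      simp only [Finset.coe_filter, Set.mem_ofPred_eq] at h h' hii
      rw [h.2, h'.2, hii]
    rw [← Finset.card_image_of_injOn (by simpa using hinj)]
    have := card_nonzero_int_le ((T.filter fun p => p.2 = 0).image Prod.fst)
      (2 * (a * b) / σ) (by positivity) ?_
    · refine this.trans (le_of_eq ?_)
      ring
    · intro i hi
      obtain ⟨⟨i', n⟩, hp, rfl⟩ := Finset.mem_image.1 hi
      obtain ⟨hp, hn⟩ := Finset.mem_filter.1 hp
      obtain ⟨h0, h1, h2⟩ := hT _ hp
      simp only at hn h1 h2
      subst hn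
      refine ⟨fun h => h0 (by simpa using h), hdiv _ _ (abs_mul_le_of_box ha.le hb ?_ ?_)⟩
      · simpa using h1
      · simpa using h2
  have hnon : ((T.filter fun p => ¬ p.2 = 0).card : ℝ) ≤
      (4 * (a * b) / σ + 1) * (2 * (r * σ)) := by
    refine (card_le_mul_card_image_real _ Prod.snd (4 * (a * b) / σ + 1) ?_).trans ?_
    · intro n _
      have hinj : Set.InjOn Prod.fst (((T.filter fun p => ¬ p.2 = 0).filter
          fun p : ℤ × ℤ => p.2 = n) : Set (ℤ × ℤ)) := by
        rintro ⟨i, n⟩ h ⟨i', n'⟩ h' hii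
        simp only [Finset.coe_filter, Set.mem_ofPred_eq] at h h' hii
        rw [h.2, h'.2, hii]
      rw [← Finset.card_image_of_injOn (by simpa using hinj)]
      refine card_int_le_of_sub_le _ _ hI0 ?_
      intro i hi j hj
      obtain ⟨⟨i', n'⟩, hp, rfl⟩ := Finset.mem_image.1 hi
      obtain ⟨⟨j', n''⟩, hq, rfl⟩ := Finset.mem_image.1 hj
      obtain ⟨hp, hn⟩ := Finset.mem_filter.1 hp
      obtain ⟨hq, hn'⟩ := Finset.mem_filter.1 hq
      obtain ⟨-, h1, h2⟩ := hT _ (Finset.mem_filter.1 hp).1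
      obtain ⟨-, h1', h2'⟩ := hT _ (Finset.mem_filter.1 hq).1
      simp only at hn hn' h1 h2 h1' h2' ⊢
      subst hn hn'
      rw [abs_le] at h1 h2 h1' h2'
      refine (le_abs_self _).trans (hdiv _ _ ?_)
      have := abs_mul_le_of_box (a₁ := a₁) (a₂ := a₂) (a := 2 * a) (b := 2 * b)
        (x := (i' : ℝ) - j') (by linarith) (by linarith)
        (abs_le.2 ⟨by linarith, by linarith⟩) (abs_le.2 ⟨by linarith, by linarith⟩)
      rw [hσ]
      linarith
    · gcongr
      refine card_nonzero_int_le _ _ (by positivity) ?_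
      intro n hn
      obtain ⟨⟨i, n'⟩, hp, rfl⟩ := Finset.mem_image.1 hn
      obtain ⟨hp, hn⟩ := Finset.mem_filter.1 hp
      obtain ⟨-, h1, h2⟩ := hT _ hp
      exact ⟨hn, abs_int_le_of_box hr hdet h1 h2⟩
  have hcard : (T.card : ℝ) = (T.filter fun p => p.2 = 0).card +
      (T.filter fun p => ¬ p.2 = 0).card := by
    exact_mod_cast (Finset.card_filter_add_card_filter_not (s := T) (fun p => p.2 = 0)).symm
  have e : (4 * (a * b) / σ + 1) * (2 * (r * σ)) = 2 * (r * σ) + 8 * (r * a * b) := by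
    field_simp
    ring
  rw [hcard]
  linarith

/-- The number of nonzero points of a planar lattice in a box which are divisible by `g`. -/
lemma card_box_dvd_le (hr : 0 < r) (hdet : |r * (a₁ * c₂ - a₂ * c₁)| = 1) (ha₂ : a₂ ≠ 0) {a b : ℝ}
    (ha : 0 < a) (hb : 0 ≤ b) {g : ℕ} (hg : 0 < g) (T : Finset (ℤ × ℤ))
    (hT : ∀ p ∈ T, p ≠ 0 ∧ |p.1 * a₁ + p.2 * c₁| ≤ a ∧ |p.1 * a₂ + p.2 * c₂| ≤ b)
    (hTg : ∀ p ∈ T, (g : ℤ) ∣ p.1 ∧ (g : ℤ) ∣ p.2) :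
    (T.card : ℝ) ≤ (4 * b / |a₂| + 2 * (r * (|a₁| * b + |a₂| * a))) * (g : ℝ)⁻¹ +
      8 * (r * a * b) * ((g : ℝ) ^ 2)⁻¹ := by
  classical
  have hg' : (0 : ℝ) < g := by exact_mod_cast hg
  have hgZ : (g : ℤ) ≠ 0 := by exact_mod_cast hg.ne'
  have hinj : Set.InjOn (fun p : ℤ × ℤ => (p.1 / g, p.2 / g)) (T : Set (ℤ × ℤ)) := by
    rintro p hp q hq h
    obtain ⟨⟨x, hx⟩, ⟨y, hy⟩⟩ := hTg p hp
    obtain ⟨⟨x', hx'⟩, ⟨y', hy'⟩⟩ := hTg q hq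
    simp only [hx, hy, hx', hy', Int.mul_ediv_cancel_left _ hgZ, Prod.mk.injEq] at h
    ext
    · rw [hx, hx', h.1]
    · rw [hy, hy', h.2]
  rw [← Finset.card_image_of_injOn hinj]
  refine (card_box_le hr hdet ha₂ (a := a / g) (b := b / g) (by positivity) (by positivity)
    _ ?_).trans (le_of_eq ?_)
  · intro p' hp'
    obtain ⟨⟨p1, p2⟩, hp, rfl⟩ := Finset.mem_image.1 hp'
    obtain ⟨⟨x, hx⟩, ⟨y, hy⟩⟩ := hTg _ hp
    obtain ⟨h0, h1, h2⟩ := hT _ hp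
    simp only at hx hy
    subst hx hy
    simp only [Int.mul_ediv_cancel_left _ hgZ]
    refine ⟨?_, ?_, ?_⟩
    · rintro h
      simp only [Prod.mk_eq_zero] at h
      simp [h.1, h.2] at h0
    · rw [le_div_iff₀ hg', ← abs_of_pos hg', ← abs_mul]
      have e : ((x : ℝ) * a₁ + y * c₁) * g =
          ((g * x : ℤ) : ℝ) * a₁ + ((g * y : ℤ) : ℝ) * c₁ := by push_cast; ring
      rwa [e]
    · rw [le_div_iff₀ hg', ← abs_of_pos hg', ← abs_mul]
      have e : ((x : ℝ) * a₂ + y * c₂) * g =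
          ((g * x : ℤ) : ℝ) * a₂ + ((g * y : ℤ) : ℝ) * c₂ := by push_cast; ring
      rwa [e]
  · field_simp

/-- The number of points of a planar lattice in a box whose coordinates have a large common
factor. -/
lemma card_box_gcd_le (hr : 0 < r) (hdet : |r * (a₁ * c₂ - a₂ * c₁)| = 1) (ha₂ : a₂ ≠ 0) {a b z : ℝ}
    (ha : 0 < a) (hb : 0 ≤ b) (hz : 1 ≤ z) {X : ℝ} (hX : 1 ≤ X)
    (hX1 : r * (|a₁| * b + |a₂| * a) ≤ X) (hX2 : b / |a₂| ≤ X) (T : Finset (ℤ × ℤ))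
    (hT : ∀ p ∈ T, p ≠ 0 ∧ |p.1 * a₁ + p.2 * c₁| ≤ a ∧ |p.1 * a₂ + p.2 * c₂| ≤ b)
    (hTg : ∀ p ∈ T, z < Int.gcd p.1 p.2) :
    (T.card : ℝ) ≤ (4 * b / |a₂| + 2 * (r * (|a₁| * b + |a₂| * a))) * (1 + Real.log X) +
      16 * (r * a * b) / z := by
  classical
  have ha₂' : 0 < |a₂| := abs_pos.2 ha₂
  have hmaps : ∀ p ∈ T, Int.gcd p.1 p.2 ∈ Finset.Ioc ⌊z⌋₊ ⌊X⌋₊ := by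
    intro p hp
    obtain ⟨h0, h1, h2⟩ := hT p hp
    rw [Finset.mem_Ioc]
    refine ⟨(Nat.floor_lt (by linarith)).2 (hTg p hp), Nat.le_floor ?_⟩
    by_cases hn : p.2 = 0
    · rw [hn] at h2 ⊢
      have hi : (1 : ℝ) * |(p.1 : ℝ)| * |a₂| ≤ b := by simpa [abs_mul] using h2
      have : ((Int.gcd p.1 0 : ℕ) : ℝ) = |(p.1 : ℝ)| := by
        simp [Nat.cast_natAbs]
      rw [this]
      refine le_trans ?_ hX2
      rw [le_div_iff₀ ha₂']
      linarith
    · have h3 := abs_int_le_of_box hr hdet h1 h2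
      have h4 : Int.gcd p.1 p.2 ≤ p.2.natAbs :=
        Nat.le_of_dvd (Int.natAbs_pos.2 hn) (Nat.gcd_dvd_right _ _)
      have h5 : ((Int.gcd p.1 p.2 : ℕ) : ℝ) ≤ |(p.2 : ℝ)| := by
        rw [← Int.cast_abs, ← Nat.cast_natAbs]
        exact_mod_cast h4
      linarith
  have hcard := Finset.card_eq_sum_card_fiberwise hmaps
  have hS0 : 0 ≤ 4 * b / |a₂| + 2 * (r * (|a₁| * b + |a₂| * a)) := by positivity
  have hr0 : 0 ≤ r * a * b := by positivity
  have hsum : (T.card : ℝ) ≤ ∑ g ∈ Finset.Ioc ⌊z⌋₊ ⌊X⌋₊,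
      ((4 * b / |a₂| + 2 * (r * (|a₁| * b + |a₂| * a))) * (g : ℝ)⁻¹ +
      8 * (r * a * b) * ((g : ℝ) ^ 2)⁻¹) := by
    rw [hcard]
    push_cast
    refine Finset.sum_le_sum fun g hg => ?_
    refine card_box_dvd_le hr hdet ha₂ ha hb (by have := (Finset.mem_Ioc.1 hg).1; omega) _
      (fun p hp => hT p (Finset.mem_filter.1 hp).1) fun p hp => ?_
    have := (Finset.mem_filter.1 hp).2
    rw [← this]
    exact ⟨Int.gcd_dvd_left .., Int.gcd_dvd_right ..⟩
  refine hsum.trans ?_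
  rw [Finset.sum_add_distrib, ← Finset.mul_sum, ← Finset.mul_sum]
  have h1 : ∑ g ∈ Finset.Ioc ⌊z⌋₊ ⌊X⌋₊, (g : ℝ)⁻¹ ≤ 1 + Real.log X := by
    calc ∑ g ∈ Finset.Ioc ⌊z⌋₊ ⌊X⌋₊, (g : ℝ)⁻¹ ≤ ∑ g ∈ Finset.Icc 1 ⌊X⌋₊, (g : ℝ)⁻¹ := by
          refine Finset.sum_le_sum_of_subset_of_nonneg (fun g hg => ?_) fun _ _ _ => by positivity
          rw [Finset.mem_Ioc] at hg
          rw [Finset.mem_Icc]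
          omega
      _ = (harmonic ⌊X⌋₊ : ℝ) := by rw [harmonic_eq_sum_Icc]; push_cast; rfl
      _ ≤ 1 + Real.log X := harmonic_floor_le_one_add_log X hX
  have h2 : ∑ g ∈ Finset.Ioc ⌊z⌋₊ ⌊X⌋₊, ((g : ℝ) ^ 2)⁻¹ ≤ 2 / z := by
    have : Finset.Ioc ⌊z⌋₊ ⌊X⌋₊ = Finset.Ioo ⌊z⌋₊ (⌊X⌋₊ + 1) := by
      ext g
      simp [Finset.mem_Ioc, Finset.mem_Ioo]
    rw [this]
    refine (sum_Ioo_inv_sq_le _ _).trans ?_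
    gcongr
    exact (Nat.lt_floor_add_one z).le
  have := mul_le_mul_of_nonneg_left h1 hS0
  have := mul_le_mul_of_nonneg_left h2 (by positivity : (0 : ℝ) ≤ 8 * (r * a * b))
  have e : 8 * (r * a * b) * (2 / z) = 16 * (r * a * b) / z := by ring
  linarith

end PlanarCount

/-- The linear form `(l, i, n) ↦ i a + n c`. -/
def planarForm (a c : ℝ) (u : Fin 3 → ℤ) : ℝ := u 1 * a + u 2 * c

/-- The linear form `(l, i, n) ↦ l r + i s + n θ`. -/
def spatialForm (r s θ : ℝ) (u : Fin 3 → ℤ) : ℝ := u 0 * r + u 1 * s + u 2 * θ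

section Fibre

variable {a₂ c₂ r s θ τ Y : ℝ}

lemma fibre_spatial_close {y y' p U U' : ℝ} (hτ : 0 < τ) (hy : Y / 2 ≤ y) (hY : 0 < Y)
    (hy' : Y / 2 ≤ y') (hyy : |y - y'| ≤ Y / 4) (h : |p + y * U| ≤ τ) (h' : |p + y' * U'| ≤ τ) :
    |U - U'| ≤ |p| / Y + 4 * τ / Y := by
  have hy0 : 0 < y := by linarith
  have hy0' : 0 < y' := by linarith
  have e : (U - U') * (y * y') = p * (y - y') + (y' * (p + y * U) - y * (p + y' * U')) := by ring
  have h1 : |U - U'| * (y * y') ≤ |p| * |y - y'| + (y' * τ + y * τ) := by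
    rw [← abs_of_pos (mul_pos hy0 hy0'), ← abs_mul, e]
    refine (abs_add_le _ _).trans ?_
    rw [abs_mul]
    gcongr
    refine (abs_sub _ _).trans ?_
    rw [abs_mul, abs_mul, abs_of_pos hy0, abs_of_pos hy0']
    gcongr
  have h2 : |p| * |y - y'| + (y' * τ + y * τ) ≤ (|p| / Y + 4 * τ / Y) * (y * y') := by
    have hq : Y ^ 2 / 4 ≤ y * y' := by nlinarith
    have h3 : |p| * |y - y'| ≤ |p| / Y * (y * y') := by
      calc |p| * |y - y'| ≤ |p| * (Y / 4) := by gcongr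
        _ = |p| / Y * (Y ^ 2 / 4) := by field_simp
        _ ≤ _ := by gcongr
    have h4 : y' * τ ≤ 2 * τ / Y * (y * y') := by
      rw [div_mul_eq_mul_div, le_div_iff₀ hY]
      nlinarith [mul_pos hτ hy0']
    have h5 : y * τ ≤ 2 * τ / Y * (y * y') := by
      rw [div_mul_eq_mul_div, le_div_iff₀ hY]
      nlinarith [mul_pos hτ hy0]
    have : 4 * τ / Y = 2 * τ / Y + 2 * τ / Y := by ring
    rw [this]
    linarith
  exact le_of_mul_le_mul_right (h1.trans h2) (mul_pos hy0 hy0')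

lemma card_fibre_le_of_small (hr : 0 < r) (hτ : 0 < τ) (hY : 0 < Y) (hτY : 8 * τ ≤ Y * r) {M : ℕ}
    (T : Finset (ℕ × (Fin 3 → ℤ))) (i n : ℤ)
    (hT : ∀ q ∈ T, q.1 < M ∧ q.2 1 = i ∧ q.2 2 = n ∧
      |planarForm a₂ c₂ q.2 + (Y / 2 + q.1 * τ) * spatialForm r s θ q.2| ≤ τ) :
    (T.card : ℝ) ≤ M := by
  have hinj : Set.InjOn Prod.fst (T : Set (ℕ × (Fin 3 → ℤ))) := by
    rintro ⟨m, u⟩ hu ⟨m', u'⟩ hu' hmm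
    simp only at hmm
    subst hmm
    obtain ⟨-, h1, h2, h3⟩ := hT _ hu
    obtain ⟨-, h1', h2', h3'⟩ := hT _ hu'
    simp only [planarForm, spatialForm] at h1 h2 h3 h1' h2' h3'
    rw [h1, h2] at h3
    rw [h1', h2'] at h3'
    rw [abs_le] at h3 h3'
    set y := Y / 2 + m * τ
    have hy : Y / 2 ≤ y := by
      have := mul_nonneg (Nat.cast_nonneg (α := ℝ) m) hτ.le
      simp only [y]
      linarith
    have hl : |((u 0 - u' 0 : ℤ) : ℝ)| * (y * r) ≤ 2 * τ := by
      have hpos : 0 < y * r := mul_pos (by linarith) hr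
      rw [← abs_of_pos hpos, ← abs_mul, abs_le]
      push_cast
      constructor <;> nlinarith
    have hl0 : u 0 = u' 0 := by
      by_contra hne
      have : (1 : ℝ) ≤ |((u 0 - u' 0 : ℤ) : ℝ)| := by
        rw [← Int.cast_abs]
        exact_mod_cast Int.one_le_abs (sub_ne_zero.2 hne)
      nlinarith [mul_le_mul_of_nonneg_right hy hr.le]
    have : u = u' := by
      funext k
      fin_cases k
      · exact hl0
      · exact h1.trans h1'.symm
      · exact h2.trans h2'.symm
    rw [this]
  rw [← Finset.card_image_of_injOn hinj]
  have : T.image Prod.fst ⊆ Finset.range M := by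
    intro m hm
    obtain ⟨q, hq, rfl⟩ := Finset.mem_image.1 hm
    exact Finset.mem_range.2 (hT q hq).1
  simpa using Finset.card_le_card this

lemma card_fibre_le_of_large (hr : 0 < r) (hτ : 0 < τ) (hY : 0 < Y) (hτY : 8 * τ ≤ Y * r) {M : ℕ}
    (hM : M * τ ≤ Y / 4)
    (T : Finset (ℕ × (Fin 3 → ℤ))) (i n : ℤ)
    (hT : ∀ q ∈ T, q.1 < M ∧ q.2 1 = i ∧ q.2 2 = n ∧
      |planarForm a₂ c₂ q.2 + (Y / 2 + q.1 * τ) * spatialForm r s θ q.2| ≤ τ)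
    (hlo : Y * r ≤ |i * a₂ + n * c₂|) (hhi : |i * a₂ + n * c₂| ≤ 2 * Y) :
    (T.card : ℝ) ≤ 15 / r := by
  classical
  set p := (i : ℝ) * a₂ + n * c₂ with hp
  have hp0 : 0 < |p| := lt_of_lt_of_le (by positivity) hlo
  have hy : ∀ q ∈ T, Y / 2 ≤ Y / 2 + q.1 * τ ∧ Y / 2 + q.1 * τ ≤ 3 * Y / 4 := by
    intro q hq
    have h1 : (q.1 : ℝ) ≤ M := by exact_mod_cast (hT q hq).1.le
    have h2 := mul_le_mul_of_nonneg_right h1 hτ.le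
    have h3 := mul_nonneg (Nat.cast_nonneg (α := ℝ) q.1) hτ.le
    constructor <;> linarith
  have hform : ∀ q ∈ T, planarForm a₂ c₂ q.2 = p := by
    intro q hq
    obtain ⟨-, h1, h2, -⟩ := hT q hq
    rw [planarForm, h1, h2]
  have hU : ∀ q ∈ T, |p| / Y ≤ |spatialForm r s θ q.2| := by
    intro q hq
    have h3 := (hT q hq).2.2.2
    rw [hform q hq] at h3
    obtain ⟨hy1, hy2⟩ := hy q hq
    set y := Y / 2 + q.1 * τ
    set U := spatialForm r s θ q.2
    have h4 : |p| ≤ τ + y * |U| := by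
      have : |p| ≤ |p + y * U| + |y * U| := by
        have := abs_sub (p + y * U) (y * U)
        simpa using this
      rw [abs_mul, abs_of_pos (by linarith : 0 < y)] at this
      linarith
    rw [div_le_iff₀ hY]
    have := mul_le_mul_of_nonneg_right hy2 (abs_nonneg U)
    nlinarith
  have key := card_le_mul_card_image_real T (fun q => q.2 0) (4 * Y / |p|) ?_
  · have himg : ((T.image fun q => q.2 0).card : ℝ) ≤ 3 * |p| / (Y * r) := by
      refine (card_int_le_of_sub_le _ (2 * |p| / (Y * r)) (by positivity) ?_).trans ?_
      · intro l hl l' hl'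
        obtain ⟨q, hq, rfl⟩ := Finset.mem_image.1 hl
        obtain ⟨q', hq', rfl⟩ := Finset.mem_image.1 hl'
        have h3 := (hT q hq).2.2.2
        have h3' := (hT q' hq').2.2.2
        rw [hform q hq] at h3
        rw [hform q' hq'] at h3'
        have h4 := fibre_spatial_close hτ (hy q hq).1 hY (hy q' hq').1
          (by rw [abs_le]; constructor <;> linarith [hy q hq, hy q' hq']) h3 h3'
        have h5 : spatialForm r s θ q.2 - spatialForm r s θ q'.2 =
            ((q.2 0 : ℝ) - q'.2 0) * r := by
          rw [spatialForm, spatialForm, (hT q hq).2.1, (hT q hq).2.2.1, (hT q' hq').2.1,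
            (hT q' hq').2.2.1]
          ring
        rw [h5] at h4
        have h6 : ((q.2 0 : ℝ) - q'.2 0) * r ≤ |p| / Y + |p| / Y := by
          refine (le_abs_self _).trans (h4.trans ?_)
          gcongr
          linarith
        rw [le_div_iff₀ (by positivity)]
        have h7 : (|p| / Y + |p| / Y) * Y = 2 * |p| := by field_simp; ring
        nlinarith
      · have h1 : 1 ≤ |p| / (Y * r) := by rwa [le_div_iff₀ (by positivity), one_mul]
        have h2 : 3 * |p| / (Y * r) = 2 * |p| / (Y * r) + |p| / (Y * r) := by ring
        linarith
    calc (T.card : ℝ) ≤ 4 * Y / |p| * (T.image fun q => q.2 0).card := key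
      _ ≤ 4 * Y / |p| * (3 * |p| / (Y * r)) := by gcongr
      _ = 12 / r := by field_simp; ring
      _ ≤ 15 / r := by gcongr; norm_num
  · intro l hl
    obtain ⟨q₀, hq₀, hl₀⟩ := Finset.mem_image.1 hl
    have hsame : ∀ q ∈ T, q.2 0 = l → q.2 = q₀.2 := by
      intro q hq h
      funext k
      fin_cases k
      · exact h.trans hl₀.symm
      · exact (hT q hq).2.1.trans (hT q₀ hq₀).2.1.symm
      · exact (hT q hq).2.2.1.trans (hT q₀ hq₀).2.2.1.symm
    have hinj : Set.InjOn (fun q : ℕ × (Fin 3 → ℤ) => (q.1 : ℤ))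
        (T.filter fun q => q.2 0 = l : Set (ℕ × (Fin 3 → ℤ))) := by
      rintro ⟨m, u⟩ h ⟨m', u'⟩ h' hmm
      rw [Finset.coe_filter] at h h'
      have e1 := hsame _ h.1 h.2
      have e2 := hsame _ h'.1 h'.2
      simp only [Nat.cast_inj] at hmm e1 e2
      rw [hmm, e1, e2]
    rw [← Finset.card_image_of_injOn hinj]
    set U := spatialForm r s θ q₀.2 with hUdef
    have hU0 := hU q₀ hq₀
    have hU1 : 0 < |U| := lt_of_lt_of_le (by positivity) hU0
    refine (card_int_le_of_sub_le _ (2 / |U|) (by positivity) ?_).trans ?_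
    · intro m hm m' hm'
      obtain ⟨q, hq, rfl⟩ := Finset.mem_image.1 hm
      obtain ⟨q', hq', rfl⟩ := Finset.mem_image.1 hm'
      obtain ⟨hq, hql⟩ := Finset.mem_filter.1 hq
      obtain ⟨hq', hql'⟩ := Finset.mem_filter.1 hq'
      have h3 := (hT q hq).2.2.2
      have h3' := (hT q' hq').2.2.2
      rw [hform q hq, hsame q hq hql] at h3
      rw [hform q' hq', hsame q' hq' hql'] at h3'
      rw [le_div_iff₀ hU1]
      push_cast
      have h4 : |((q.1 : ℝ) - q'.1) * τ * U| ≤ 2 * τ := by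
        rw [abs_le] at h3 h3' ⊢
        constructor <;> nlinarith
      rw [abs_mul, abs_mul, abs_of_pos hτ] at h4
      have h5 : |(q.1 : ℝ) - q'.1| * |U| ≤ 2 := by
        by_contra h
        push Not at h
        nlinarith
      nlinarith [le_abs_self ((q.1 : ℝ) - q'.1)]
    · have h1 : 2 / |U| ≤ 2 * Y / |p| := by
        rw [div_le_div_iff₀ hU1 hp0]
        rw [div_le_iff₀ hY] at hU0
        linarith
      have h2 : 1 ≤ 2 * Y / |p| := by rwa [le_div_iff₀ hp0, one_mul]
      have h3 : 4 * Y / |p| = 2 * Y / |p| + 2 * Y / |p| := by ring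
      linarith

end Fibre

/-- The normalised shape of a lattice at the end of a step of the construction. -/
structure StepForm (R W₁ W₂ z a₁ c₁ a₂ c₂ r : ℝ) : Prop where
  hR : R = W₁ * W₂
  hz : 10 ^ 6 ≤ z
  hlog : 1 + Real.log R ≤ z
  hW₂ : z ^ 40 ≤ W₂
  hW₁ : z ^ 40 * W₂ ≤ W₁
  det : |r * (a₁ * c₂ - a₂ * c₁)| = 1
  r_lo : 1 / (z ^ 2 * R) ≤ r
  r_hi : r ≤ 1 / R
  a₁_hi : |a₁| ≤ z * W₁
  a₂_lo : W₂ / z ^ 5 ≤ |a₂|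
  a₂_hi : |a₂| ≤ z * W₂

namespace StepForm

variable {R W₁ W₂ z a₁ c₁ a₂ c₂ r s θ : ℝ}

lemma z_pos (h : StepForm R W₁ W₂ z a₁ c₁ a₂ c₂ r) : 0 < z := by linarith [h.hz]

lemma W₂_pos (h : StepForm R W₁ W₂ z a₁ c₁ a₂ c₂ r) : 0 < W₂ :=
  lt_of_lt_of_le (pow_pos h.z_pos 40) h.hW₂

lemma W₁_pos (h : StepForm R W₁ W₂ z a₁ c₁ a₂ c₂ r) : 0 < W₁ :=
  lt_of_lt_of_le (mul_pos (pow_pos h.z_pos 40) h.W₂_pos) h.hW₁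

lemma R_pos (h : StepForm R W₁ W₂ z a₁ c₁ a₂ c₂ r) : 0 < R := by
  rw [h.hR]; exact mul_pos h.W₁_pos h.W₂_pos

lemma r_pos (h : StepForm R W₁ W₂ z a₁ c₁ a₂ c₂ r) : 0 < r :=
  lt_of_lt_of_le (by have := h.R_pos; have := h.z_pos; positivity) h.r_lo

lemma a₂_ne (h : StepForm R W₁ W₂ z a₁ c₁ a₂ c₂ r) : a₂ ≠ 0 := by
  have := h.W₂_pos
  have := h.z_pos
  exact abs_pos.1 (lt_of_lt_of_le (by positivity) h.a₂_lo)

lemma pow_le_W₂ (h : StepForm R W₁ W₂ z a₁ c₁ a₂ c₂ r) {n : ℕ} (hn : n ≤ 39) :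
    10 ^ 6 * z ^ n ≤ W₂ := by
  have h1 : 1 ≤ z := by linarith [h.hz]
  calc 10 ^ 6 * z ^ n ≤ z * z ^ 39 :=
        mul_le_mul h.hz (pow_le_pow_right₀ h1 hn) (by have := h.z_pos; positivity) h.z_pos.le
    _ = z ^ 40 := by ring
    _ ≤ W₂ := h.hW₂

lemma pow_mul_le_W₁ (h : StepForm R W₁ W₂ z a₁ c₁ a₂ c₂ r) {n : ℕ} (hn : n ≤ 39) :
    10 ^ 6 * z ^ n * W₂ ≤ W₁ := by
  have h1 : 1 ≤ z := by linarith [h.hz]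
  refine le_trans ?_ h.hW₁
  have := h.W₂_pos
  gcongr
  calc 10 ^ 6 * z ^ n ≤ z * z ^ 39 :=
        mul_le_mul h.hz (pow_le_pow_right₀ h1 hn) (by have := h.z_pos; positivity) h.z_pos.le
    _ = z ^ 40 := by ring

lemma one_div_r_le (h : StepForm R W₁ W₂ z a₁ c₁ a₂ c₂ r) : 1 / r ≤ z ^ 2 * R := by
  have := h.R_pos
  have := h.z_pos
  rw [one_div_le h.r_pos (by positivity)]
  exact h.r_lo

lemma Yr_lo (h : StepForm R W₁ W₂ z a₁ c₁ a₂ c₂ r) : 1 / z ^ 3 ≤ R / z * r := by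
  have := h.R_pos
  have := h.z_pos
  calc 1 / z ^ 3 = R / z * (1 / (z ^ 2 * R)) := by field_simp
    _ ≤ _ := by gcongr; exact h.r_lo

lemma Yr_hi (h : StepForm R W₁ W₂ z a₁ c₁ a₂ c₂ r) : R / z * r ≤ 1 / z := by
  have := h.R_pos
  have := h.z_pos
  calc R / z * r ≤ R / z * (1 / R) := by gcongr; exact h.r_hi
    _ = _ := by field_simp

lemma tau_le (h : StepForm R W₁ W₂ z a₁ c₁ a₂ c₂ r) {τ : ℝ} (hτ : τ ≤ 1 / (8 * z * W₂)) :
    8 * τ ≤ R / z * r := by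
  have := h.z_pos
  have := h.W₂_pos
  refine le_trans ?_ h.Yr_lo
  calc 8 * τ ≤ 8 * (1 / (8 * z * W₂)) := by gcongr
    _ = 1 / (z * W₂) := by field_simp
    _ ≤ 1 / (z * z ^ 2) := by
      gcongr
      have := h.pow_le_W₂ (n := 2) (by norm_num)
      nlinarith [pow_pos h.z_pos 2]
    _ = _ := by congr 1; ring

lemma inv_a₂_le (h : StepForm R W₁ W₂ z a₁ c₁ a₂ c₂ r) {b : ℝ} (hb : 0 ≤ b) :
    b / |a₂| ≤ b * z ^ 5 / W₂ := by
  have := h.z_pos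
  have := h.W₂_pos
  calc b / |a₂| ≤ b / (W₂ / z ^ 5) := by gcongr; exact h.a₂_lo
    _ = _ := by field_simp

lemma slope_le (h : StepForm R W₁ W₂ z a₁ c₁ a₂ c₂ r) {b a : ℝ} (hb : 0 ≤ b) (ha : 0 ≤ a) :
    r * (|a₁| * b + |a₂| * a) ≤ 1 / R * (z * W₁ * b + z * W₂ * a) := by
  have := h.z_pos
  have := h.W₂_pos
  have := h.W₁_pos
  have := h.R_pos
  have := h.r_pos
  gcongr
  · exact h.r_hi
  · exact h.a₁_hi
  · exact h.a₂_hi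

lemma error_le (h : StepForm R W₁ W₂ z a₁ c₁ a₂ c₂ r) {b : ℝ} (hb : 0 ≤ b) (hbY : b ≤ R / z) :
    4 * b / |a₂| + 2 * (r * (|a₁| * b + |a₂| * (R / (2 * z ^ 2)))) ≤ 7 * W₁ * z ^ 4 := by
  have hz := h.z_pos
  have hW₂ := h.W₂_pos
  have hW₁ := h.W₁_pos
  have hR := h.R_pos
  have h1 := h.inv_a₂_le (b := 4 * b) (by positivity)
  have h2 := h.slope_le hb (a := R / (2 * z ^ 2)) (by positivity)
  have h3 : 4 * b * z ^ 5 / W₂ ≤ 4 * W₁ * z ^ 4 := by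
    calc 4 * b * z ^ 5 / W₂ ≤ 4 * (R / z) * z ^ 5 / W₂ := by gcongr
      _ = _ := by rw [h.hR]; field_simp
  have h4 : 1 / R * (z * W₁ * b + z * W₂ * (R / (2 * z ^ 2))) ≤ W₁ + W₂ := by
    calc 1 / R * (z * W₁ * b + z * W₂ * (R / (2 * z ^ 2))) ≤
          1 / R * (z * W₁ * (R / z) + z * W₂ * (R / (2 * z ^ 2))) := by gcongr
      _ = W₁ + W₂ / (2 * z) := by field_simp
      _ ≤ W₁ + W₂ / 1 := by gcongr; linarith [h.hz]
      _ = W₁ + W₂ := by ring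
  have h5 : W₂ ≤ W₁ := by
    have := h.pow_mul_le_W₁ (n := 0) (by norm_num)
    linarith
  have h6 : 4 ≤ z ^ 4 := by
    calc (4 : ℝ) ≤ z := by linarith [h.hz]
      _ ≤ z ^ 4 := le_self_pow₀ (by linarith [h.hz]) (by norm_num)
  nlinarith

lemma error_mul_le (h : StepForm R W₁ W₂ z a₁ c₁ a₂ c₂ r) :
    7 * W₁ * z ^ 4 * z * (15 / r) ≤ R / (2 * z ^ 2) * (R / z) / 192 := by
  have hz := h.z_pos
  have hW₂ := h.W₂_pos
  have hW₁ := h.W₁_pos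
  have hR := h.R_pos
  have h1 := h.one_div_r_le
  have e : 15 / r = 15 * (1 / r) := by ring
  rw [e]
  calc 7 * W₁ * z ^ 4 * z * (15 * (1 / r)) ≤ 7 * W₁ * z ^ 4 * z * (15 * (z ^ 2 * R)) := by gcongr
    _ = (384 * 105 * z ^ 10) * W₁ * R / (384 * z ^ 3) := by field_simp; ring
    _ ≤ W₂ * W₁ * R / (384 * z ^ 3) := by
      gcongr
      have := h.pow_le_W₂ (n := 10) (by norm_num)
      nlinarith [pow_pos h.z_pos 10]
    _ = _ := by rw [h.hR]; field_simp; ring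

section Bad

variable {τ : ℝ} {M : ℕ}

lemma card_bad_le_aux (h : StepForm R W₁ W₂ z a₁ c₁ a₂ c₂ r) (hτ0 : 0 < τ)
    (hτ : τ ≤ 1 / (8 * z * W₂)) (hM : M * τ ≤ R / z / 4)
    (S : Finset (ℕ × (Fin 3 → ℤ))) {C : ℝ}
    (hS : ∀ q ∈ S, q.1 < M ∧
      |planarForm a₂ c₂ q.2 + (R / z / 2 + q.1 * τ) * spatialForm r s θ q.2| ≤ τ ∧
      R / z * r ≤ |planarForm a₂ c₂ q.2| ∧ |spatialForm r s θ q.2| ≤ 1)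
    (hC : ((S.image fun q => (q.2 1, q.2 2)).card : ℝ) ≤ C) :
    (S.card : ℝ) ≤ 15 / r * C := by
  have hR := h.R_pos
  have hz := h.z_pos
  have hr := h.r_pos
  have hY : 0 < R / z := by positivity
  refine (card_le_mul_card_image_real S (fun q => (q.2 1, q.2 2)) (15 / r) ?_).trans (by gcongr)
  rintro ⟨i, n⟩ hin
  obtain ⟨q₀, hq₀, hin⟩ := Finset.mem_image.1 hin
  simp only [Prod.mk.injEq] at hin
  have e : planarForm a₂ c₂ q₀.2 = i * a₂ + n * c₂ := by rw [planarForm, hin.1, hin.2]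
  have h8 := h.tau_le hτ
  refine card_fibre_le_of_large (s := s) (θ := θ) hr hτ0 hY h8 hM _ i n ?_
    (by rw [← e]; exact (hS q₀ hq₀).2.2.1) ?_
  · intro q hq
    obtain ⟨hq, hq'⟩ := Finset.mem_filter.1 hq
    simp only [Prod.mk.injEq] at hq'
    exact ⟨(hS q hq).1, hq'.1, hq'.2, (hS q hq).2.1⟩
  · rw [← e]
    obtain ⟨h1, h2, h3, h4⟩ := hS q₀ hq₀
    have hm : (q₀.1 : ℝ) * τ ≤ R / z / 4 := by
      refine le_trans ?_ hM
      gcongr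
    have hm0 : 0 ≤ (q₀.1 : ℝ) * τ := by positivity
    have hYr : R / z * r ≤ R / z := by
      have : r ≤ 1 := by
        refine h.r_hi.trans ?_
        rw [div_le_one hR, h.hR]
        have h1 := h.pow_le_W₂ (n := 0) (by norm_num)
        have h2 := h.pow_mul_le_W₁ (n := 0) (by norm_num)
        nlinarith
      nlinarith
    rw [abs_le] at h2 h4 ⊢
    constructor <;> nlinarith

lemma abs_planarForm_le {y B U p Y : ℝ} (hU : |U| ≤ B) (hy0 : 0 < y)
    (hy : y ≤ 3 / 4 * Y) (hτ : τ ≤ 1 / 4 * Y * B) (h : |p + y * U| ≤ τ) : |p| ≤ Y * B := by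
  have hB : 0 ≤ B := (abs_nonneg _).trans hU
  have : |p| ≤ |p + y * U| + |y * U| := by
    have := abs_sub (p + y * U) (y * U)
    simpa using this
  rw [abs_mul, abs_of_pos hy0] at this
  have h2 : y * |U| ≤ 3 / 4 * Y * B := by
    have : 0 ≤ 3 / 4 * Y := by linarith
    gcongr
  linarith

lemma sample_le (hm : q < M) (hτ0 : 0 < τ) {Y : ℝ} (hM : M * τ ≤ Y / 4) :
    Y / 2 + q * τ ≤ 3 / 4 * Y := by
  have : (q : ℝ) * τ ≤ M * τ := by gcongr
  linarith

lemma tau_le' (h : StepForm R W₁ W₂ z a₁ c₁ a₂ c₂ r)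
    (hτ : τ ≤ 1 / (8 * z * W₂)) : τ ≤ 1 / 4 * (R / z) * (1 / z) := by
  have h1 := h.tau_le hτ
  have h2 := h.Yr_hi
  have hz := h.z_pos
  have h3 : 1 ≤ R / z := by
    rw [le_div_iff₀ hz, h.hR, one_mul]
    have h1 := h.pow_le_W₂ (n := 1) (by norm_num)
    have h2 := h.pow_mul_le_W₁ (n := 0) (by norm_num)
    have h3 : 1 ≤ W₁ := by linarith [h.hz]
    nlinarith [h.W₂_pos]
  have h5 : 0 < 1 / z := by positivity
  have h4 : 1 * (1 / z) ≤ R / z * (1 / z) := by gcongr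
  linarith

lemma card_bad_spatial (h : StepForm R W₁ W₂ z a₁ c₁ a₂ c₂ r) (hτ0 : 0 < τ)
    (hτ : τ ≤ 1 / (8 * z * W₂)) (hM : M * τ ≤ R / z / 4)
    (S : Finset (ℕ × (Fin 3 → ℤ)))
    (hS : ∀ q ∈ S, q.1 < M ∧
      |planarForm a₂ c₂ q.2 + (R / z / 2 + q.1 * τ) * spatialForm r s θ q.2| ≤ τ ∧
      R / z * r ≤ |planarForm a₂ c₂ q.2| ∧ |spatialForm r s θ q.2| ≤ 1)
    (hS1 : ∀ q ∈ S, |planarForm a₁ c₁ q.2| ≤ R / (2 * z ^ 2))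
    (hbad : ∀ q ∈ S, |spatialForm r s θ q.2| < 1 / z) :
    (S.card : ℝ) ≤ R / (2 * z ^ 2) * (R / z) / 96 := by
  have hR := h.R_pos
  have hz := h.z_pos
  have hr := h.r_pos
  have hW₁ := h.W₁_pos
  have hYr : 0 < R / z * r := by positivity
  have hbox := card_box_le hr h.det h.a₂_ne (a := R / (2 * z ^ 2)) (b := R / z * (1 / z))
    (by positivity) (by positivity) (S.image fun q => (q.2 1, q.2 2)) ?_
  · have h1 := h.card_bad_le_aux hτ0 hτ hM S hS hbox
    refine h1.trans ?_
    have herr := h.error_le (b := R / z * (1 / z)) (by positivity) (by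
      have : 1 / z ≤ 1 := by rw [div_le_one hz]; linarith [h.hz]
      have : 0 < R / z := by positivity
      nlinarith)
    calc _ ≤ 15 / r * (7 * W₁ * z ^ 4 * z +
          8 * (r * (R / (2 * z ^ 2)) * (R / z * (1 / z)))) := by
          gcongr
          refine herr.trans ?_
          have : 0 < 7 * W₁ * z ^ 4 := by positivity
          nlinarith [h.hz]
      _ = 7 * W₁ * z ^ 4 * z * (15 / r) +
          120 / z * (R / (2 * z ^ 2) * (R / z)) := by field_simp; ring
      _ ≤ R / (2 * z ^ 2) * (R / z) / 192 + 1 / 192 * (R / (2 * z ^ 2) * (R / z)) := by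
          gcongr ?_ + ?_ * _
          · exact h.error_mul_le
          · rw [div_le_div_iff₀ hz (by norm_num)]
            linarith [h.hz]
      _ = _ := by ring
  · rintro p hp
    obtain ⟨q, hq, rfl⟩ := Finset.mem_image.1 hp
    obtain ⟨h1, h2, h3, h4⟩ := hS q hq
    refine ⟨?_, hS1 q hq, ?_⟩
    · intro h0
      simp only [Prod.mk_eq_zero] at h0
      rw [planarForm, h0.1, h0.2] at h3
      simp at h3
      linarith
    · exact abs_planarForm_le (hbad q hq).le (by positivity) (sample_le h1 hτ0 hM)
        (h.tau_le' hτ) h2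

lemma card_bad_gcd (h : StepForm R W₁ W₂ z a₁ c₁ a₂ c₂ r) (hτ0 : 0 < τ)
    (hτ : τ ≤ 1 / (8 * z * W₂)) (hM : M * τ ≤ R / z / 4)
    (S : Finset (ℕ × (Fin 3 → ℤ)))
    (hS : ∀ q ∈ S, q.1 < M ∧
      |planarForm a₂ c₂ q.2 + (R / z / 2 + q.1 * τ) * spatialForm r s θ q.2| ≤ τ ∧
      R / z * r ≤ |planarForm a₂ c₂ q.2| ∧ |spatialForm r s θ q.2| ≤ 1)
    (hS1 : ∀ q ∈ S, |planarForm a₁ c₁ q.2| ≤ R / (2 * z ^ 2))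
    (hbad : ∀ q ∈ S, z < Int.gcd (q.2 1) (q.2 2)) :
    (S.card : ℝ) ≤ R / (2 * z ^ 2) * (R / z) / 96 := by
  have hR := h.R_pos
  have hz := h.z_pos
  have hr := h.r_pos
  have hW₁ := h.W₁_pos
  have hW₂ := h.W₂_pos
  have hYr : 0 < R / z * r := by positivity
  have hYpos : 0 < R / z := by positivity
  have herr := h.error_le (b := R / z) (by positivity) le_rfl
  have hW₁R : 7 * W₁ * z ^ 4 ≤ R := by
    rw [h.hR]
    have := h.pow_le_W₂ (n := 4) (by norm_num)
    nlinarith [pow_pos hz 4]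
  have hA : 0 ≤ |a₁| * (R / z) + |a₂| * (R / (2 * z ^ 2)) := by positivity
  have hB : 0 ≤ R / z / |a₂| := by positivity
  have hB' : 4 * (R / z) / |a₂| = 4 * (R / z / |a₂|) := by ring
  have hA' := mul_nonneg hr.le hA
  have hbox := card_box_gcd_le hr h.det h.a₂_ne (a := R / (2 * z ^ 2)) (b := R / z) (z := z)
    (X := R) (by positivity) (by positivity) (by linarith [h.hz])
    (by
      rw [h.hR]
      have h1 := h.pow_le_W₂ (n := 0) (by norm_num)
      have h2 := h.pow_mul_le_W₁ (n := 0) (by norm_num)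
      nlinarith)
    (by linarith) (by linarith)
    (S.image fun q => (q.2 1, q.2 2)) ?_ ?_
  · have h1 := h.card_bad_le_aux hτ0 hτ hM S hS hbox
    refine h1.trans ?_
    calc _ ≤ 15 / r * (7 * W₁ * z ^ 4 * z +
          16 * (r * (R / (2 * z ^ 2)) * (R / z)) / z) := by
          gcongr 15 / r * (?_ + _)
          refine mul_le_mul herr h.hlog ?_ (by positivity)
          have := Real.log_nonneg (x := R) (by
            rw [h.hR]
            have h1 := h.pow_le_W₂ (n := 0) (by norm_num)
            have h2 := h.pow_mul_le_W₁ (n := 0) (by norm_num)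
            nlinarith)
          linarith
      _ = 7 * W₁ * z ^ 4 * z * (15 / r) +
          240 / z * (R / (2 * z ^ 2) * (R / z)) := by field_simp; ring
      _ ≤ R / (2 * z ^ 2) * (R / z) / 192 + 1 / 192 * (R / (2 * z ^ 2) * (R / z)) := by
          gcongr ?_ + ?_ * _
          · exact h.error_mul_le
          · rw [div_le_div_iff₀ hz (by norm_num)]
            linarith [h.hz]
      _ = _ := by ring
  · rintro p hp
    obtain ⟨q, hq, rfl⟩ := Finset.mem_image.1 hp
    obtain ⟨h1, h2, h3, h4⟩ := hS q hq
    refine ⟨?_, hS1 q hq, ?_⟩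
    · intro h0
      simp only [Prod.mk_eq_zero] at h0
      rw [planarForm, h0.1, h0.2] at h3
      simp at h3
      linarith
    · have := abs_planarForm_le h4 (by positivity) (sample_le h1 hτ0 hM)
        ((h.tau_le' hτ).trans (by
          gcongr
          rw [div_le_one hz]
          linarith [h.hz])) h2
      simpa [planarForm] using this
  · rintro p hp
    obtain ⟨q, hq, rfl⟩ := Finset.mem_image.1 hp
    exact hbad q hq

lemma card_bad_small (h : StepForm R W₁ W₂ z a₁ c₁ a₂ c₂ r) (hτ0 : 0 < τ)
    (hτ : τ ≤ 1 / (8 * z * W₂)) (hτ' : 1 / (9 * z * W₂) ≤ τ)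
    (S : Finset (ℕ × (Fin 3 → ℤ)))
    (hS : ∀ q ∈ S, q.1 < M ∧
      |planarForm a₂ c₂ q.2 + (R / z / 2 + q.1 * τ) * spatialForm r s θ q.2| ≤ τ)
    (hS1 : ∀ q ∈ S, |planarForm a₁ c₁ q.2| ≤ R / (2 * z ^ 2))
    (hbad : ∀ q ∈ S, |planarForm a₂ c₂ q.2| < R / z * r) :
    (S.card : ℝ) ≤ M * (R / (2 * z ^ 2) * τ / 12) := by
  classical
  have hR := h.R_pos
  have hz := h.z_pos
  have hr := h.r_pos
  have hW₁ := h.W₁_pos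
  have hW₂ := h.W₂_pos
  have hYr : 0 < R / z * r := by positivity
  have h8 := h.tau_le hτ
  refine (card_le_mul_card_image_real S (fun q => (q.2 1, q.2 2)) M ?_).trans ?_
  · rintro ⟨i, n⟩ hin
    refine card_fibre_le_of_small (a₂ := a₂) (c₂ := c₂) (s := s) (θ := θ) hr hτ0
      (by positivity : 0 < R / z) h8 _ i n ?_
    intro q hq
    obtain ⟨hq, hq'⟩ := Finset.mem_filter.1 hq
    simp only [Prod.mk.injEq] at hq'
    exact ⟨(hS q hq).1, hq'.1, hq'.2, (hS q hq).2⟩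
  gcongr
  set P := S.image fun q => (q.2 1, q.2 2)
  have hbox := card_box_le hr h.det h.a₂_ne (a := R / (2 * z ^ 2)) (b := R / z * r)
    (by positivity) (by positivity) (P.erase 0) ?_
  · have hcard : (P.card : ℝ) ≤ (P.erase 0).card + 1 := by
      exact_mod_cast Nat.sub_le_iff_le_add.1 Finset.pred_card_le_card_erase
    have h1 := h.inv_a₂_le (b := 4 * (R / z * r)) (by positivity)
    have h2 := h.slope_le (b := R / z * r) hYr.le (a := R / (2 * z ^ 2)) (by positivity)
    have hYr1 := h.Yr_hi
    have hz1 : 1 / z ≤ 1 := by rw [div_le_one hz]; linarith [h.hz]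
    have h3 : 4 * (R / z * r) * z ^ 5 / W₂ ≤ 1 := by
      rw [div_le_one hW₂]
      have := h.pow_le_W₂ (n := 5) (by norm_num)
      nlinarith [pow_pos hz 5]
    have h4 : 1 / R * (z * W₁ * (R / z * r) + z * W₂ * (R / (2 * z ^ 2))) ≤ W₂ := by
      calc 1 / R * (z * W₁ * (R / z * r) + z * W₂ * (R / (2 * z ^ 2))) ≤
            1 / R * (z * W₁ * (1 / z) + z * W₂ * (R / (2 * z ^ 2))) := by gcongr
        _ = 1 / W₂ + W₂ / (2 * z) := by rw [h.hR]; field_simp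
        _ ≤ 1 + W₂ / 2 := by
          gcongr
          · rw [div_le_one hW₂]
            have := h.pow_le_W₂ (n := 0) (by norm_num)
            linarith
          · linarith [h.hz]
        _ ≤ W₂ := by
          have := h.pow_le_W₂ (n := 0) (by norm_num)
          linarith
    have h5 : 8 * (r * (R / (2 * z ^ 2)) * (R / z * r)) ≤ 1 := by
      calc 8 * (r * (R / (2 * z ^ 2)) * (R / z * r)) = 4 / z * (R / z * r) ^ 2 := by
            field_simp; ring
        _ ≤ 1 * (1 / z) ^ 2 := by
          gcongr
          rw [div_le_one hz]
          linarith [h.hz]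
        _ ≤ 1 := by rw [one_mul]; exact pow_le_one₀ (by positivity) hz1
    have h6 : 3 * W₂ ≤ R / (2 * z ^ 2) * τ / 12 := by
      calc 3 * W₂ = (648 * z ^ 3 * W₂) / (216 * z ^ 3) := by field_simp; norm_num
        _ ≤ W₁ / (216 * z ^ 3) := by
          gcongr
          have := h.pow_mul_le_W₁ (n := 3) (by norm_num)
          nlinarith [mul_pos (pow_pos hz 3) hW₂]
        _ = R / (2 * z ^ 2) * (1 / (9 * z * W₂)) / 12 := by rw [h.hR]; field_simp; norm_num
        _ ≤ _ := by gcongr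
    have := h.pow_le_W₂ (n := 0) (by norm_num)
    linarith
  · intro p hp
    obtain ⟨hp0, hp⟩ := Finset.mem_erase.1 hp
    obtain ⟨q, hq, rfl⟩ := Finset.mem_image.1 hp
    exact ⟨hp0, hS1 q hq, (hbad q hq).le⟩

end Bad

end StepForm

lemma exists_residue_with_small_values (K n : ℕ) (hK : 0 < K) (f : ℕ → ℝ) (hf : ∀ m, 0 ≤ f m)
    {c : ℝ} (hc : 0 < c) (h : ∑ m ∈ Finset.range (K * n), f m ≤ K * n * c) :
    ∃ s < K, ∃ J ⊆ Finset.range n, (n : ℝ) ≤ 2 * J.card ∧ ∀ j ∈ J, f (s + K * j) ≤ 2 * c := by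
  have hsum : ∑ m ∈ Finset.range (K * n), f m =
      ∑ s ∈ Finset.range K, ∑ j ∈ Finset.range n, f (s + K * j) := by
    rw [Finset.sum_comm]
    clear h
    induction n with
    | zero => simp
    | succ n ih =>
      rw [Finset.sum_range_succ, ← ih, Nat.mul_succ, Finset.sum_range_add]
      simp [add_comm]
  have h1 : ∃ s ∈ Finset.range K, ∑ j ∈ Finset.range n, f (s + K * j) ≤ n * c := by
    apply Finset.exists_le_of_sum_le (by simpa using hK.ne')
    rw [← hsum, Finset.sum_const, Finset.card_range, nsmul_eq_mul]
    linarith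
  obtain ⟨s, hs, hs'⟩ := h1
  refine ⟨s, Finset.mem_range.1 hs, (Finset.range n).filter fun j => f (s + K * j) ≤ 2 * c,
    Finset.filter_subset _ _, ?_, fun j hj => (Finset.mem_filter.1 hj).2⟩
  have h2 : ((Finset.range n).filter fun j => ¬ f (s + K * j) ≤ 2 * c).card * (2 * c) ≤ n * c := by
    refine le_trans ?_ hs'
    rw [← nsmul_eq_mul]
    refine (Finset.card_nsmul_le_sum _ (fun j => f (s + K * j)) _ ?_).trans
      (Finset.sum_le_sum_of_subset_of_nonneg (Finset.filter_subset _ _) fun _ _ _ => hf _)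
    intro j hj
    exact (not_le.1 (Finset.mem_filter.1 hj).2).le
  have h3 := Finset.card_filter_add_card_filter_not (s := Finset.range n)
    (fun j => f (s + K * j) ≤ 2 * c)
  rw [Finset.card_range] at h3
  have h3' : (((Finset.range n).filter fun j => f (s + K * j) ≤ 2 * c).card : ℝ) +
      ((Finset.range n).filter fun j => ¬ f (s + K * j) ≤ 2 * c).card = n := by exact_mod_cast h3
  have h4 : 2 * (((Finset.range n).filter fun j => ¬ f (s + K * j) ≤ 2 * c).card : ℝ) ≤ n := by
    refine le_of_mul_le_mul_right ?_ hc
    linarith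
  linarith

/-- The conditions on the first column of a child in the construction. -/
structure IsChild (Y z Δ a₁ c₁ a₂ c₂ r s θ y : ℝ) (u : Fin 3 → ℤ) : Prop where
  lo : 1 / z ^ 2 ≤ spatialForm r s θ u
  hi : spatialForm r s θ u ≤ 1
  pos₁ : |planarForm a₁ c₁ u| ≤ Y / 2 * spatialForm r s θ u
  pos₂ : |planarForm a₂ c₂ u + y * spatialForm r s θ u| ≤ Δ / 8 * spatialForm r s θ u
  prim : Int.gcd (u 0) (Int.gcd (u 1) (u 2)) = 1
  gcd_pos : 0 < Int.gcd (u 1) (u 2)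
  gcd_le : (Int.gcd (u 1) (u 2) : ℝ) ≤ z

lemma planarForm_smul (a c : ℝ) (m : ℤ) (u : Fin 3 → ℤ) :
    planarForm a c (m • u) = m * planarForm a c u := by
  simp [planarForm]; ring

lemma spatialForm_smul (r s θ : ℝ) (m : ℤ) (u : Fin 3 → ℤ) :
    spatialForm r s θ (m • u) = m * spatialForm r s θ u := by
  simp [spatialForm]; ring

lemma exists_isChild_smul {Y z Δ τ a₁ c₁ a₂ c₂ r s θ y : ℝ} (hz : 1 ≤ z) (hY : 0 ≤ Y)
    (hτ : τ ≤ Δ / (8 * z)) {u : Fin 3 → ℤ} (h1 : |planarForm a₁ c₁ u| ≤ Y / (2 * z))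
    (h2 : |planarForm a₂ c₂ u + y * spatialForm r s θ u| ≤ τ) (h3 : |spatialForm r s θ u| ≤ 1)
    (hU : 1 / z ≤ |spatialForm r s θ u|) (hgcd : (Int.gcd (u 1) (u 2) : ℝ) ≤ z)
    (hne : ¬ (u 1 = 0 ∧ u 2 = 0)) :
    ∃ m : ℤ, ∃ p : Fin 3 → ℤ, u = m • p ∧ m ≠ 0 ∧ |(m : ℝ)| ≤ z ∧
      IsChild Y z Δ a₁ c₁ a₂ c₂ r s θ y p := by
  have hz0 : 0 < z := by linarith
  set g := Int.gcd (u 1) (u 2) with hg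
  have hg0 : 0 < g := Int.gcd_pos_iff.2 (by tauto)
  set d := Int.gcd (u 0) g with hd
  have hd0 : 0 < d := Int.gcd_pos_iff.2 (Or.inr (by exact_mod_cast hg0.ne'))
  have hdg : (d : ℤ) ∣ g := Int.gcd_dvd_right ..
  have hdg' : d ∣ g := by exact_mod_cast hdg
  have hdg'' : (d : ℝ) ≤ z := le_trans (by exact_mod_cast Nat.le_of_dvd hg0 hdg') hgcd
  have hdu : ∀ k, (d : ℤ) ∣ u k := by
    intro k
    fin_cases k
    · exact Int.gcd_dvd_left ..
    · exact hdg.trans (Int.gcd_dvd_left ..)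
    · exact hdg.trans (Int.gcd_dvd_right ..)
  choose q hq using hdu
  have hdpos : (0 : ℤ) < d := by exact_mod_cast hd0
  have hgq : g = d * Int.gcd (q 1) (q 2) := by
    rw [hg, hq 1, hq 2, Int.gcd_mul_left]; simp
  have hdq : Int.gcd (q 0) (Int.gcd (q 1) (q 2)) = 1 := by
    have : d = d * Int.gcd (q 0) (Int.gcd (q 1) (q 2)) := by
      conv_lhs => rw [hd, hq 0, hgq]
      push_cast
      rw [Int.gcd_mul_left]
      simp
    exact Nat.eq_of_mul_eq_mul_left hd0 (by omega)
  have hgq0 : 0 < Int.gcd (q 1) (q 2) := by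
    rcases Nat.eq_zero_or_pos (Int.gcd (q 1) (q 2)) with h | h
    · rw [h, mul_zero] at hgq; omega
    · exact h
  have hU0 : spatialForm r s θ u ≠ 0 := abs_pos.1 (lt_of_lt_of_le (by positivity) hU)
  obtain ⟨e, he, heU⟩ : ∃ e : ℤ, (e = 1 ∨ e = -1) ∧
      (e : ℝ) * spatialForm r s θ u = |spatialForm r s θ u| := by
    rcases lt_or_gt_of_ne hU0 with h | h
    · exact ⟨-1, Or.inr rfl, by rw [abs_of_neg h]; push_cast; ring⟩
    · exact ⟨1, Or.inl rfl, by rw [abs_of_pos h]; push_cast; ring⟩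
  have hee : e * e = 1 := by rcases he with rfl | rfl <;> rfl
  have hee' : (e : ℝ) * e = 1 := by exact_mod_cast hee
  have hea : |(e : ℝ)| = 1 := by rcases he with rfl | rfl <;> simp
  have hen : e.natAbs = 1 := by rcases he with rfl | rfl <;> rfl
  have hup : u = ((d : ℤ) * e) • (e • q) := by
    funext k
    simp only [Pi.smul_apply, smul_eq_mul]
    rw [hq k]
    linear_combination (-(d : ℤ) * q k) * hee
  have hdR : (0 : ℝ) < d := by exact_mod_cast hd0
  have hspat : spatialForm r s θ (e • q) * d = |spatialForm r s θ u| := by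
    rw [← heU]
    conv_rhs => rw [hup, spatialForm_smul]
    push_cast
    linear_combination (-(d : ℝ) * spatialForm r s θ (e • q)) * hee'
  have hplan : ∀ a c, |planarForm a c u| = d * |planarForm a c (e • q)| := by
    intro a c
    conv_lhs => rw [hup, planarForm_smul]
    push_cast
    rw [abs_mul, abs_mul, hea, abs_of_pos hdR, mul_one]
  have hspat0 : 0 < spatialForm r s θ (e • q) := by
    have : 0 < spatialForm r s θ (e • q) * d := by rw [hspat]; exact abs_pos.2 hU0
    exact pos_of_mul_pos_left this hdR.le
  refine ⟨d * e, e • q, hup, ?_, ?_, ?_⟩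
  · rcases he with rfl | rfl <;> simp <;> omega
  · push_cast
    rw [abs_mul, hea, abs_of_pos hdR, mul_one]
    exact hdg''
  have hd1 : (1 : ℝ) ≤ d := by exact_mod_cast hd0
  constructor
  · have h5 : 1 / z ≤ spatialForm r s θ (e • q) * z := by
      rw [← hspat] at hU
      exact hU.trans (by gcongr)
    calc 1 / z ^ 2 = (1 / z) / z := by field_simp
      _ ≤ spatialForm r s θ (e • q) * z / z := by gcongr
      _ = _ := by field_simp
  · rw [← hspat] at h3
    nlinarith
  · have h5 : d * |planarForm a₁ c₁ (e • q)| ≤ d * (Y / 2 * spatialForm r s θ (e • q)) := by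
      rw [← hplan]
      calc _ ≤ _ := h1
        _ = Y / 2 * (1 / z) := by field_simp
        _ ≤ Y / 2 * |spatialForm r s θ u| := by gcongr
        _ = _ := by rw [← hspat]; ring
    exact le_of_mul_le_mul_left h5 hdR
  · have h6 : |planarForm a₂ c₂ u + y * spatialForm r s θ u| =
        d * |planarForm a₂ c₂ (e • q) + y * spatialForm r s θ (e • q)| := by
      conv_lhs => rw [hup, planarForm_smul, spatialForm_smul]
      push_cast
      rw [show (d : ℝ) * e * planarForm a₂ c₂ (e • q) +
        y * (d * e * spatialForm r s θ (e • q)) =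
        d * e * (planarForm a₂ c₂ (e • q) + y * spatialForm r s θ (e • q)) by ring,
        abs_mul, abs_mul, hea, abs_of_pos hdR, mul_one]
    have h5 : d * |planarForm a₂ c₂ (e • q) + y * spatialForm r s θ (e • q)| ≤
        d * (Δ / 8 * spatialForm r s θ (e • q)) := by
      have hΔ : 0 ≤ Δ := by
        have : 0 ≤ Δ / (8 * z) := ((abs_nonneg _).trans h2).trans hτ
        by_contra hcon
        push Not at hcon
        exact absurd this (not_le.2 (div_neg_of_neg_of_pos hcon (by positivity)))
      rw [← h6]
      calc _ ≤ _ := h2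
        _ ≤ _ := hτ
        _ = Δ / 8 * (1 / z) := by field_simp
        _ ≤ Δ / 8 * |spatialForm r s θ u| := by gcongr
        _ = _ := by rw [← hspat]; ring
    exact le_of_mul_le_mul_left h5 hdR
  · simp only [Pi.smul_apply, smul_eq_mul]
    rw [Int.gcd_mul_left, hen, one_mul, Int.gcd, Int.natAbs_mul, hen, one_mul]
    exact hdq
  · simp only [Pi.smul_apply, smul_eq_mul]
    rw [Int.gcd_mul_left, hen, one_mul]
    exact hgq0
  · simp only [Pi.smul_apply, smul_eq_mul]
    rw [Int.gcd_mul_left, hen, one_mul]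
    refine le_trans ?_ hgcd
    rw [hgq]
    exact_mod_cast Nat.le_mul_of_pos_left _ hd0

lemma exists_finset_of_multiples (G : Finset (Fin 3 → ℤ)) (Q : (Fin 3 → ℤ) → Prop) {z : ℝ}
    (hz : 0 ≤ z)
    (h : ∀ u ∈ G, ∃ m : ℤ, ∃ p : Fin 3 → ℤ, u = m • p ∧ m ≠ 0 ∧ |(m : ℝ)| ≤ z ∧ Q p) :
    ∃ H : Finset (Fin 3 → ℤ), (∀ p ∈ H, Q p) ∧ (G.card : ℝ) ≤ 2 * z * H.card := by
  classical
  choose! m p h1 h2 h3 h4 using h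
  refine ⟨G.image p, fun q hq => ?_, card_le_mul_card_image_real _ _ _ fun q _ => ?_⟩
  · obtain ⟨u, hu, rfl⟩ := Finset.mem_image.1 hq
    exact h4 u hu
  · have hinj : Set.InjOn m (G.filter fun u => p u = q : Set (Fin 3 → ℤ)) := by
      intro u hu u' hu' hmm
      rw [Finset.coe_filter] at hu hu'
      rw [h1 u hu.1, h1 u' hu'.1, hmm, hu.2, hu'.2]
    rw [← Finset.card_image_of_injOn hinj]
    refine card_nonzero_int_le _ _ hz fun i hi => ?_
    obtain ⟨u, hu, rfl⟩ := Finset.mem_image.1 hi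
    have := (Finset.mem_filter.1 hu).1
    exact ⟨h2 u this, h3 u this⟩

lemma one_le_abs_natCast_sub {a b : ℕ} (h : a ≠ b) : (1 : ℝ) ≤ |(a : ℝ) - b| := by
  have h1 : (1 : ℤ) ≤ |(a : ℤ) - b| := Int.one_le_abs (sub_ne_zero.2 (by exact_mod_cast h))
  exact_mod_cast h1

namespace StepForm

variable {R W₁ W₂ z a₁ c₁ a₂ c₂ r s θ τ : ℝ}

/-- The lattice points which do not yield admissible children. -/
def Bad (z r s θ : ℝ) (u : Fin 3 → ℤ) : Prop :=
  |spatialForm r s θ u| < 1 / z ∨ z < Int.gcd (u 1) (u 2) ∨ (u 1 = 0 ∧ u 2 = 0)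

open Classical in
lemma sum_card_bad_le (h : StepForm R W₁ W₂ z a₁ c₁ a₂ c₂ r) (hτ0 : 0 < τ)
    (hτ : τ ≤ 1 / (8 * z * W₂)) (hτ' : 1 / (9 * z * W₂) ≤ τ) {M : ℕ} (hM : M * τ ≤ R / z / 4)
    (hM' : R / z / 8 ≤ M * τ) (T : ℕ → Finset (Fin 3 → ℤ))
    (hT : ∀ m < M, ∀ u ∈ T m, |planarForm a₁ c₁ u| ≤ R / (2 * z ^ 2) ∧
      |planarForm a₂ c₂ u + (R / z / 2 + m * τ) * spatialForm r s θ u| ≤ τ ∧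
      |spatialForm r s θ u| ≤ 1) :
    ∑ m ∈ Finset.range M, (((T m).filter (Bad z r s θ)).card : ℝ) ≤
      M * (R / (2 * z ^ 2) * τ / 4) := by
  have hR := h.R_pos
  have hz := h.z_pos
  set S : Finset (ℕ × (Fin 3 → ℤ)) :=
    ((Finset.range M).sigma fun m => (T m).filter (Bad z r s θ)).map
      (Equiv.sigmaEquivProd _ _).toEmbedding with hSdef
  have hcard : ∑ m ∈ Finset.range M, (((T m).filter (Bad z r s θ)).card : ℝ) = S.card := by
    rw [hSdef, Finset.card_map, Finset.card_sigma]
    push_cast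
    rfl
  have hmem : ∀ q ∈ S, q.1 < M ∧ q.2 ∈ T q.1 ∧ Bad z r s θ q.2 := by
    intro q hq
    obtain ⟨⟨m, u⟩, hmu, rfl⟩ := Finset.mem_map.1 hq
    simpa using hmu
  set S₁ := S.filter fun q => |planarForm a₂ c₂ q.2| < R / z * r
  set S₂ := S.filter fun q => R / z * r ≤ |planarForm a₂ c₂ q.2| ∧
    |spatialForm r s θ q.2| < 1 / z
  set S₃ := S.filter fun q => R / z * r ≤ |planarForm a₂ c₂ q.2| ∧
    z < Int.gcd (q.2 1) (q.2 2)
  have hsub : S ⊆ S₁ ∪ (S₂ ∪ S₃) := by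
    intro q hq
    obtain ⟨-, -, hb⟩ := hmem q hq
    simp only [S₁, S₂, S₃, Finset.mem_union, Finset.mem_filter, hq, true_and]
    by_cases hs : |planarForm a₂ c₂ q.2| < R / z * r
    · exact Or.inl hs
    · rw [not_lt] at hs
      rcases hb with hb | hb | hb
      · exact Or.inr (Or.inl ⟨hs, hb⟩)
      · exact Or.inr (Or.inr ⟨hs, hb⟩)
      · rw [planarForm, hb.1, hb.2] at hs
        have : 0 < R / z * r := mul_pos (by positivity) h.r_pos
        simp at hs
        linarith
  have hc : (S.card : ℝ) ≤ S₁.card + (S₂.card + S₃.card) := by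
    exact_mod_cast (Finset.card_le_card hsub).trans ((Finset.card_union_le _ _).trans
      (Nat.add_le_add_left (Finset.card_union_le _ _) _))
  have h1 : (S₁.card : ℝ) ≤ M * (R / (2 * z ^ 2) * τ / 12) := by
    refine h.card_bad_small (s := s) (θ := θ) hτ0 hτ hτ' S₁ (fun q hq => ?_) (fun q hq => ?_)
      fun q hq => (Finset.mem_filter.1 hq).2
    all_goals
      obtain ⟨hm, hq, -⟩ := hmem q (Finset.mem_filter.1 hq).1
      have := hT _ hm _ hq
    · exact ⟨hm, this.2.1⟩
    · exact this.1
  have h2 : (S₂.card : ℝ) ≤ R / (2 * z ^ 2) * (R / z) / 96 := by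
    refine h.card_bad_spatial (s := s) (θ := θ) hτ0 hτ hM S₂ (fun q hq => ?_) (fun q hq => ?_)
      fun q hq => (Finset.mem_filter.1 hq).2.2
    all_goals
      obtain ⟨hq0, hq1⟩ := Finset.mem_filter.1 hq
      obtain ⟨hm, hq, -⟩ := hmem q hq0
      have := hT _ hm _ hq
    · exact ⟨hm, this.2.1, hq1.1, this.2.2⟩
    · exact this.1
  have h3 : (S₃.card : ℝ) ≤ R / (2 * z ^ 2) * (R / z) / 96 := by
    refine h.card_bad_gcd (s := s) (θ := θ) hτ0 hτ hM S₃ (fun q hq => ?_) (fun q hq => ?_)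
      fun q hq => (Finset.mem_filter.1 hq).2.2
    all_goals
      obtain ⟨hq0, hq1⟩ := Finset.mem_filter.1 hq
      obtain ⟨hm, hq, -⟩ := hmem q hq0
      have := hT _ hm _ hq
    · exact ⟨hm, this.2.1, hq1.1, this.2.2⟩
    · exact this.1
  have h4 : R / (2 * z ^ 2) * (R / z) / 96 ≤ M * (R / (2 * z ^ 2) * τ / 12) := by
    calc R / (2 * z ^ 2) * (R / z) / 96 = R / (2 * z ^ 2) * (R / z / 8) / 12 := by ring
      _ ≤ R / (2 * z ^ 2) * (M * τ) / 12 := by gcongr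
      _ = _ := by ring
  rw [hcard]
  linarith

lemma exists_box_points (h : StepForm R W₁ W₂ z a₁ c₁ a₂ c₂ r) (s θ y : ℝ) (hτ0 : 0 < τ) :
    ∃ T : Finset (Fin 3 → ℤ), R / (2 * z ^ 2) * τ ≤ T.card ∧ ∀ u ∈ T,
      |planarForm a₁ c₁ u| ≤ R / (2 * z ^ 2) ∧
      |planarForm a₂ c₂ u + y * spatialForm r s θ u| ≤ τ ∧ |spatialForm r s θ u| ≤ 1 := by
  have hR := h.R_pos
  have hz := h.z_pos
  set M : Matrix (Fin 3) (Fin 3) ℝ :=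
    !![0, a₁, c₁; y * r, a₂ + y * s, c₂ + y * θ; r, s, θ]
  have hM : |M.det| = 1 := by
    rw [← h.det]
    congr 1
    simp [M, Matrix.det_fin_three]
    ring
  obtain ⟨T, hT, hTu⟩ := exists_finset_int_mulVec_abs_le M hM ![R / (2 * z ^ 2), τ, 1] (by
    intro i; fin_cases i <;> simp <;> positivity)
  refine ⟨T, by simpa [Fin.prod_univ_three] using hT, fun u hu => ?_⟩
  have h0 := hTu u hu 0
  have h1 := hTu u hu 1
  have h2 := hTu u hu 2
  simp [M, Matrix.mulVec, dotProduct, Fin.sum_univ_three] at h0 h1 h2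
  refine ⟨?_, ?_, ?_⟩
  · convert h0 using 2
    rw [planarForm]; ring
  · convert h1 using 2
    rw [planarForm, spatialForm]; ring
  · convert h2 using 2
    rw [spatialForm]; ring

set_option maxHeartbeats 400000 in
/-- Existence of many well-distributed children. -/
theorem exists_children (h : StepForm R W₁ W₂ z a₁ c₁ a₂ c₂ r) (s θ : ℝ) {ν N : ℕ}
    (hν : ν ≤ R * W₂ / z ^ 2) (hN : N ≤ W₁ / z ^ 6) :
    ∃ (y : Fin ν → ℝ) (f : Fin ν → Fin N → Fin 3 → ℤ),
      (∀ j, R / z / 2 ≤ y j ∧ y j ≤ 3 / 4 * (R / z)) ∧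
      (∀ j j', j ≠ j' → 1 / W₂ ≤ |y j - y j'|) ∧
      ∀ j, Function.Injective (f j) ∧
        ∀ i, IsChild (R / z) z (1 / W₂) a₁ c₁ a₂ c₂ r s θ (y j) (f j i) := by
  classical
  have hR := h.R_pos
  have hz := h.z_pos
  have hW₁ := h.W₁_pos
  have hW₂ := h.W₂_pos
  have hz6 := h.hz
  set K := ⌈8 * z⌉₊ with hK
  have hK8 : 8 * z ≤ K := Nat.le_ceil _
  have hK9 : (K : ℝ) ≤ 9 * z := (Nat.ceil_lt_add_one (by positivity)).le.trans (by linarith)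
  have hK0 : 0 < K := Nat.ceil_pos.2 (by positivity)
  have hK0' : (0 : ℝ) < K := by exact_mod_cast hK0
  set n := ⌊R / z * W₂ / 4⌋₊ with hn
  have hn1 : (n : ℝ) ≤ R / z * W₂ / 4 := Nat.floor_le (by positivity)
  have hbig : 8 ≤ R / z * W₂ := by
    rw [h.hR]
    have h1 := h.pow_le_W₂ (n := 1) (by norm_num)
    have h2 := h.pow_mul_le_W₁ (n := 0) (by norm_num)
    have : 8 * z ≤ W₁ * W₂ * W₂ := by
      have : 1 ≤ W₁ := by linarith
      have : 1 * 1 ≤ W₁ * W₂ := by gcongr; linarith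
      nlinarith
    rw [div_mul_eq_mul_div, le_div_iff₀ hz]
    exact this
  have hn2 : R / z * W₂ / 8 ≤ n := by
    have := Nat.lt_floor_add_one (R / z * W₂ / 4)
    rw [← hn] at this
    linarith
  set τ := 1 / (K * W₂) with hτdef
  have hτ0 : 0 < τ := by positivity
  have hτ : τ ≤ 1 / (8 * z * W₂) := by rw [hτdef]; gcongr
  have hτ' : 1 / (9 * z * W₂) ≤ τ := by rw [hτdef]; gcongr
  have hMτ : ((K * n : ℕ) : ℝ) * τ = n / W₂ := by rw [hτdef]; push_cast; field_simp
  have hM : ((K * n : ℕ) : ℝ) * τ ≤ R / z / 4 := by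
    rw [hMτ, div_le_iff₀ hW₂]; linarith
  have hM' : R / z / 8 ≤ ((K * n : ℕ) : ℝ) * τ := by
    rw [hMτ, le_div_iff₀ hW₂]; linarith
  choose T hTc hTu using fun m : ℕ => h.exists_box_points s θ (R / z / 2 + m * τ) hτ0
  have hbad := h.sum_card_bad_le hτ0 hτ hτ' hM hM' T (fun m _ => hTu m)
  obtain ⟨σ, hσ, J, hJ, hJc, hJb⟩ := exists_residue_with_small_values K n hK0
    (fun m => (((T m).filter (Bad z r s θ)).card : ℝ)) (fun _ => Nat.cast_nonneg _)
    (c := R / (2 * z ^ 2) * τ / 4) (by positivity) (by push_cast at hbad; exact hbad)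
  have hgood : ∀ j ∈ J, ∃ H : Finset (Fin 3 → ℤ), N ≤ H.card ∧ ∀ u ∈ H,
      IsChild (R / z) z (1 / W₂) a₁ c₁ a₂ c₂ r s θ (R / z / 2 + (σ + K * j : ℕ) * τ) u := by
    intro j hj
    have hG := exists_finset_of_multiples ((T (σ + K * j)).filter fun u => ¬ Bad z r s θ u)
      (IsChild (R / z) z (1 / W₂) a₁ c₁ a₂ c₂ r s θ (R / z / 2 + (σ + K * j : ℕ) * τ)) hz.le ?_
    · obtain ⟨H, hH, hHc⟩ := hG
      refine ⟨H, ?_, hH⟩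
      have h1 := Finset.card_filter_add_card_filter_not (s := T (σ + K * j)) (Bad z r s θ)
      have h1' : (((T (σ + K * j)).filter (Bad z r s θ)).card : ℝ) +
        ((T (σ + K * j)).filter fun u => ¬ Bad z r s θ u).card = (T (σ + K * j)).card := by
        exact_mod_cast h1
      have h2 := hJb j hj
      have h3 := hTc (σ + K * j)
      have h4 : R / (2 * z ^ 2) * τ / 2 ≤ 2 * z * H.card := by linarith
      have h5 : W₁ / z ^ 6 * (2 * z) ≤ R / (2 * z ^ 2) * τ / 2 := by
        calc W₁ / z ^ 6 * (2 * z) = W₁ / (36 * z ^ 3) * (72 / z ^ 2) := by field_simp; ring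
          _ ≤ W₁ / (36 * z ^ 3) * 1 := by
            gcongr
            rw [div_le_one (by positivity)]
            nlinarith
          _ = R / (2 * z ^ 2) * (1 / (9 * z * W₂)) / 2 := by rw [h.hR]; field_simp; norm_num
          _ ≤ _ := by gcongr
      have h6 : (N : ℝ) * (2 * z) ≤ H.card * (2 * z) := by
        have := mul_le_mul_of_nonneg_right hN (by positivity : 0 ≤ 2 * z)
        linarith
      exact_mod_cast le_of_mul_le_mul_right h6 (by positivity)
    · intro u hu
      obtain ⟨hu, hub⟩ := Finset.mem_filter.1 hu
      obtain ⟨h1, h2, h3⟩ := hTu _ u hu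
      rw [Bad, not_or, not_or, not_lt, not_lt] at hub
      refine exists_isChild_smul (τ := τ) (by linarith) (by positivity) ?_ ?_ h2 h3 hub.1 hub.2.1
        hub.2.2
      · refine hτ.trans (le_of_eq ?_)
        field_simp
      · refine h1.trans (le_of_eq ?_)
        field_simp
  choose! H hHc hHu using hgood
  have hνJ : ν ≤ J.card := by
    have : (ν : ℝ) ≤ J.card := by
      refine hν.trans ?_
      have h1 : R * W₂ / z ^ 2 ≤ R / z * W₂ / 16 := by
        rw [div_le_div_iff₀ (by positivity) (by positivity)]
        have : R / z * W₂ * z ^ 2 = R * W₂ * z := by field_simp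
        rw [this]
        have : 0 < R * W₂ := by positivity
        nlinarith
      linarith
    exact_mod_cast this
  obtain ⟨e⟩ : Nonempty (Fin ν ↪ J) :=
    Function.Embedding.nonempty_of_card_le (by simpa using hνJ)
  have hf : ∀ j : Fin ν, Nonempty (Fin N ↪ H (e j)) := fun j =>
    Function.Embedding.nonempty_of_card_le (by simpa using hHc _ (e j).2)
  refine ⟨fun j => R / z / 2 + (σ + K * (e j : ℕ) : ℕ) * τ,
    fun j i => ((hf j).some i : Fin 3 → ℤ), fun j => ⟨?_, ?_⟩, ?_, fun j => ⟨?_, ?_⟩⟩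
  · have : 0 ≤ ((σ + K * (e j : ℕ) : ℕ) : ℝ) * τ := by positivity
    linarith
  · refine sample_le ?_ hτ0 hM
    have h1 := Finset.mem_range.1 (hJ (e j).2)
    calc σ + K * (e j : ℕ) < K + K * (e j : ℕ) := by omega
      _ = K * ((e j : ℕ) + 1) := by ring
      _ ≤ K * n := Nat.mul_le_mul_left _ h1
  · intro j j' hjj
    have hne : (e j : ℕ) ≠ e j' := fun hcon => hjj (e.injective (Subtype.ext hcon))
    have e1 : (R / z / 2 + (σ + K * (e j : ℕ) : ℕ) * τ) -
        (R / z / 2 + (σ + K * (e j' : ℕ) : ℕ) * τ) =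
        (((e j : ℕ) : ℝ) - ((e j' : ℕ) : ℝ)) * (1 / W₂) := by
      rw [hτdef]; push_cast; field_simp; ring
    simp only
    rw [e1, abs_mul, abs_of_pos (by positivity : 0 < 1 / W₂)]
    exact le_mul_of_one_le_left (by positivity) (one_le_abs_natCast_sub hne)
  · intro i i' hii
    exact (hf j).some.injective (Subtype.ext hii)
  · exact fun i => hHu _ (e j).2 _ ((hf j).some i).2

end StepForm

/-- A primitive vector whose last two coordinates do not both vanish is the first column of a
unimodular matrix with a controlled second column. -/
lemma exists_completion (u : Fin 3 → ℤ) (h1 : Int.gcd (u 0) (Int.gcd (u 1) (u 2)) = 1)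
    (h2 : 0 < Int.gcd (u 1) (u 2)) :
    ∃ (C : Matrix (Fin 3) (Fin 3) ℤ) (m : ℤ), C.det = 1 ∧ (∀ k, C k 0 = u k) ∧
      m * C 0 0 - Int.gcd (u 1) (u 2) * C 0 1 = 1 ∧
      m * C 1 0 - Int.gcd (u 1) (u 2) * C 1 1 = 0 ∧
      m * C 2 0 - Int.gcd (u 1) (u 2) * C 2 1 = 0 := by
  set g := Int.gcd (u 1) (u 2) with hg
  obtain ⟨i, hi⟩ : (g : ℤ) ∣ u 1 := Int.gcd_dvd_left ..
  obtain ⟨n, hn⟩ : (g : ℤ) ∣ u 2 := Int.gcd_dvd_right ..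
  have b1 := Int.gcd_eq_gcd_ab (u 0) g
  have b2 := Int.gcd_eq_gcd_ab (u 1) (u 2)
  rw [h1] at b1
  rw [← hg] at b2
  set p := Int.gcdA (u 0) g
  set q := Int.gcdB (u 0) g
  set p' := Int.gcdA (u 1) (u 2)
  set q' := Int.gcdB (u 1) (u 2)
  have hg0 : (g : ℤ) ≠ 0 := by exact_mod_cast h2.ne'
  have b3 : i * p' + n * q' = 1 := by
    apply mul_left_cancel₀ hg0
    rw [hi, hn] at b2
    linear_combination -b2
  push_cast at b1
  refine ⟨!![u 0, -q, 0; u 1, p * i, -q'; u 2, p * n, p'], p, ?_, ?_, ?_, ?_, ?_⟩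
  · rw [Matrix.det_fin_three]
    simp
    rw [hi, hn]
    linear_combination (u 0 * p + g * q) * b3 - b1
  · intro k; fin_cases k <;> simp
  · simp; linear_combination -b1
  · simp; rw [hi]; ring
  · simp; rw [hn]; ring

lemma exists_bezout_three (u : Fin 3 → ℤ) (h1 : Int.gcd (u 0) (Int.gcd (u 1) (u 2)) = 1) :
    ∃ a b c : ℤ, a * u 0 + b * u 1 + c * u 2 = 1 := by
  have b1 := Int.gcd_eq_gcd_ab (u 0) (Int.gcd (u 1) (u 2))
  have b2 := Int.gcd_eq_gcd_ab (u 1) (u 2)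
  rw [h1] at b1
  push_cast at b1
  refine ⟨Int.gcdA (u 0) (Int.gcd (u 1) (u 2)),
    Int.gcdB (u 0) (Int.gcd (u 1) (u 2)) * Int.gcdA (u 1) (u 2),
    Int.gcdB (u 0) (Int.gcd (u 1) (u 2)) * Int.gcdB (u 1) (u 2), ?_⟩
  linear_combination (-Int.gcdB (u 0) (Int.gcd (u 1) (u 2))) * b2 - b1

lemma exists_smul_eq_of_parallel {u u' : Fin 3 → ℤ}
    (h1 : Int.gcd (u 0) (Int.gcd (u 1) (u 2)) = 1)
    (h01 : u 0 * u' 1 = u' 0 * u 1) (h02 : u 0 * u' 2 = u' 0 * u 2)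
    (h12 : u 1 * u' 2 = u' 1 * u 2) : ∃ t : ℤ, u' = t • u := by
  obtain ⟨a, b, c, h⟩ := exists_bezout_three u h1
  refine ⟨a * u' 0 + b * u' 1 + c * u' 2, ?_⟩
  funext k
  simp only [Pi.smul_apply, smul_eq_mul]
  fin_cases k
  · simp only [Fin.zero_eta]
    linear_combination (-u' 0) * h - b * h01 - c * h02
  · simp only [Fin.mk_one]
    linear_combination (-u' 1) * h + a * h01 - c * h12
  · simp only [Fin.reduceFinMk]
    linear_combination (-u' 2) * h + a * h02 + b * h12

lemma IsChild.spatial_pos {Y z Δ a₁ c₁ a₂ c₂ r s θ y : ℝ} {u : Fin 3 → ℤ} (hz : 0 < z)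
    (h : IsChild Y z Δ a₁ c₁ a₂ c₂ r s θ y u) : 0 < spatialForm r s θ u :=
  lt_of_lt_of_le (by positivity) h.lo

namespace StepForm

variable {R W₁ W₂ z a₁ c₁ a₂ c₂ r s θ y : ℝ} {u u' : Fin 3 → ℤ}

lemma Y_ge (h : StepForm R W₁ W₂ z a₁ c₁ a₂ c₂ r) : 1 / W₂ ≤ R / z := by
  have hz := h.z_pos
  have hW₂ := h.W₂_pos
  rw [h.hR, div_le_div_iff₀ hW₂ hz]
  have h1 := h.pow_le_W₂ (n := 1) (by norm_num)
  have h2 := h.pow_mul_le_W₁ (n := 0) (by norm_num)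
  have h3 := h.hz
  have : 1 ≤ W₁ := by linarith
  have : 1 * 1 ≤ W₁ * W₂ := by gcongr; linarith
  nlinarith

lemma planar_bounds (h : StepForm R W₁ W₂ z a₁ c₁ a₂ c₂ r) (hy : R / z / 2 ≤ y)
    (hy' : y ≤ 3 / 4 * (R / z)) (hu : IsChild (R / z) z (1 / W₂) a₁ c₁ a₂ c₂ r s θ y u) :
    R / z / 4 * spatialForm r s θ u ≤ |planarForm a₂ c₂ u| ∧
      |planarForm a₂ c₂ u| ≤ 7 / 8 * (R / z) * spatialForm r s θ u := by
  have h1 := h.Y_ge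
  have h2 := hu.spatial_pos h.z_pos
  have h3 := hu.pos₂
  have h4 : 0 < R / z := div_pos h.R_pos h.z_pos
  set U := spatialForm r s θ u
  set p := planarForm a₂ c₂ u
  have h5 : 1 / W₂ / 8 * U ≤ R / z / 8 * U := by gcongr
  have h6 : R / z / 2 * U ≤ y * U := by gcongr
  have h7 : y * U ≤ 3 / 4 * (R / z) * U := by gcongr
  have h8 : 0 < R / z * U := by positivity
  rw [abs_le] at h3
  constructor
  · rw [le_abs]; right; linarith
  · rw [abs_le]; constructor <;> linarith

/-- Distinct children of the same window are separated. -/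
lemma separation (h : StepForm R W₁ W₂ z a₁ c₁ a₂ c₂ r) (hy : R / z / 2 ≤ y)
    (hy' : y ≤ 3 / 4 * (R / z)) (hu : IsChild (R / z) z (1 / W₂) a₁ c₁ a₂ c₂ r s θ y u)
    (hu' : IsChild (R / z) z (1 / W₂) a₁ c₁ a₂ c₂ r s θ y u') (hne : u ≠ u') :
    1 / z ^ 7 ≤ |planarForm a₁ c₁ u / spatialForm r s θ u -
        planarForm a₁ c₁ u' / spatialForm r s θ u'| ∨
    1 / z ^ 7 ≤ |planarForm a₂ c₂ u / spatialForm r s θ u -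
        planarForm a₂ c₂ u' / spatialForm r s θ u'| := by
  by_contra hcon
  push Not at hcon
  obtain ⟨hd1, hd2⟩ := hcon
  have hz := h.z_pos
  have hR := h.R_pos
  have hr := h.r_pos
  have hz6 := h.hz
  have hU := hu.spatial_pos hz
  have hU' := hu'.spatial_pos hz
  have hUle := hu.hi
  have hUle' := hu'.hi
  have hlo := hu.lo
  have hp1 := hu.pos₁
  obtain ⟨hp2lo, hp2⟩ := h.planar_bounds hy hy' hu
  set U := spatialForm r s θ u with hUdef
  set U' := spatialForm r s θ u' with hUdef'
  set p₁ := planarForm a₁ c₁ u with hp₁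
  set p₁' := planarForm a₁ c₁ u' with hp₁'
  set p₂ := planarForm a₂ c₂ u with hp₂
  set p₂' := planarForm a₂ c₂ u' with hp₂'
  have hz7 : 1 / z ^ 7 ≤ 1 / z := by
    gcongr
    exact le_self_pow₀ (by linarith) (by norm_num)
  have hzpos : 0 < 1 / z ^ 7 := by positivity
  have hYpos : 0 < R / z := by positivity
  have key : u 1 * u' 2 = u' 1 * u 2 := by
    have e1 : r * (p₁ * p₂' - p₂ * p₁') =
        ((u 1 * u' 2 - u' 1 * u 2 : ℤ) : ℝ) * (r * (a₁ * c₂ - a₂ * c₁)) := by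
      simp only [hp₁, hp₂, hp₁', hp₂', planarForm]
      push_cast
      ring
    have e2 : p₁ * p₂' - p₂ * p₁' = U * U' * ((p₂ / U) * (p₁ / U - p₁' / U') -
        (p₁ / U) * (p₂ / U - p₂' / U')) := by
      field_simp
      ring
    have hP1 : |p₁ / U| ≤ R / z / 2 := by
      rw [abs_div, abs_of_pos hU, div_le_iff₀ hU]; exact hp1
    have hP2 : |p₂ / U| ≤ 7 / 8 * (R / z) := by
      rw [abs_div, abs_of_pos hU, div_le_iff₀ hU]; exact hp2
    have e3 : |p₁ * p₂' - p₂ * p₁'| ≤ 1 * 1 * (7 / 8 * (R / z) * (1 / z ^ 7) +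
        R / z / 2 * (1 / z ^ 7)) := by
      rw [e2, abs_mul, abs_mul, abs_of_pos hU, abs_of_pos hU']
      gcongr
      refine (abs_sub _ _).trans ?_
      rw [abs_mul, abs_mul]
      gcongr
    have e4 : r * |p₁ * p₂' - p₂ * p₁'| < 1 := by
      calc r * |p₁ * p₂' - p₂ * p₁'| ≤ 1 / R * (1 * 1 * (7 / 8 * (R / z) * (1 / z) +
            R / z / 2 * (1 / z))) := by
            refine mul_le_mul h.r_hi (e3.trans ?_) (abs_nonneg _) (by positivity)
            gcongr
        _ = 11 / (8 * z ^ 2) := by field_simp; ring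
        _ < 1 := by
          rw [div_lt_one (by positivity)]
          nlinarith
    have e5 : |((u 1 * u' 2 - u' 1 * u 2 : ℤ) : ℝ)| < 1 := by
      rw [← abs_of_pos hr, ← abs_mul, e1, abs_mul, h.det, mul_one] at e4
      exact e4
    rw [← Int.cast_abs] at e5
    have e6 : |u 1 * u' 2 - u' 1 * u 2| < 1 := by exact_mod_cast e5
    exact sub_eq_zero.1 (Int.abs_lt_one_iff.1 e6)
  obtain ⟨i, hi⟩ : (Int.gcd (u 1) (u 2) : ℤ) ∣ u 1 := Int.gcd_dvd_left ..
  obtain ⟨n, hn⟩ : (Int.gcd (u 1) (u 2) : ℤ) ∣ u 2 := Int.gcd_dvd_right ..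
  have b2 := Int.gcd_eq_gcd_ab (u 1) (u 2)
  have hg0 := hu.gcd_pos
  have hgz := hu.gcd_le
  set g := Int.gcd (u 1) (u 2) with hg
  set p := Int.gcdA (u 1) (u 2)
  set q := Int.gcdB (u 1) (u 2)
  have hgZ : (g : ℤ) ≠ 0 := by exact_mod_cast hg0.ne'
  have hgR : (0 : ℝ) < g := by exact_mod_cast hg0
  have b3 : i * p + n * q = 1 := by
    apply mul_left_cancel₀ hgZ
    rw [hi, hn] at b2
    linear_combination -b2
  set m₁ := u 0 * u' 1 - u' 0 * u 1 with hm₁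
  set m₂ := u 0 * u' 2 - u' 0 * u 2 with hm₂
  set k := m₁ * p + m₂ * q with hk
  have hpar : m₁ * n = m₂ * i := by
    apply mul_left_cancel₀ hgZ
    have : m₁ * u 2 = m₂ * u 1 := by rw [hm₁, hm₂]; linear_combination (-u 0) * key
    rw [hi, hn] at this
    linear_combination this
  have hk1 : m₁ = k * i := by rw [hk]; linear_combination (-m₁) * b3 + q * hpar
  have hk2 : m₂ = k * n := by rw [hk]; linear_combination (-m₂) * b3 - p * hpar
  have hk0 : k ≠ 0 := by
    intro hk0
    rw [hk0, zero_mul] at hk1 hk2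
    obtain ⟨t, ht⟩ := exists_smul_eq_of_parallel hu.prim (sub_eq_zero.1 hk1) (sub_eq_zero.1 hk2) key
    have hUt : U' = t * U := by rw [hUdef', ht, spatialForm_smul]
    have ht0 : 0 < t := by
      have : (0 : ℝ) < t := by
        rw [hUt] at hU'
        exact pos_of_mul_pos_left hU' hU.le
      exact_mod_cast this
    have htu : t ∣ 1 := by
      obtain ⟨a, b, c, h⟩ := exists_bezout_three u' hu'.prim
      rw [ht] at h
      simp only [Pi.smul_apply, smul_eq_mul] at h
      exact ⟨a * u 0 + b * u 1 + c * u 2, by linear_combination -h⟩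
    have ht1 : t = 1 := le_antisymm (Int.le_of_dvd one_pos htu) ht0
    rw [ht1, one_smul] at ht
    exact hne ht.symm
  have key' : ((u 1 : ℝ) * u' 2) = u' 1 * u 2 := by exact_mod_cast key
  have e1 : g * (U * p₂' - U' * p₂) = r * k * p₂ := by
    have hk1' : ((u 0 : ℝ) * u' 1 - u' 0 * u 1) = k * i := by exact_mod_cast hk1
    have hk2' : ((u 0 : ℝ) * u' 2 - u' 0 * u 2) = k * n := by exact_mod_cast hk2
    have hi' : (u 1 : ℝ) = g * i := by exact_mod_cast hi
    have hn' : (u 2 : ℝ) = g * n := by exact_mod_cast hn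
    have hp₂eq : p₂ = u 1 * a₂ + u 2 * c₂ := rfl
    have e : U * p₂' - U' * p₂ = r * (k * i * a₂ + k * n * c₂) := by
      rw [← hk1', ← hk2']
      simp only [hUdef, hUdef', hp₂, hp₂', planarForm, spatialForm]
      linear_combination (s * c₂ - θ * a₂) * key'
    rw [e, hp₂eq, hi', hn']
    ring
  have e2 : U * p₂' - U' * p₂ = U * U' * (p₂' / U' - p₂ / U) := by field_simp
  have hk1 : (1 : ℝ) ≤ |(k : ℝ)| := by
    rw [← Int.cast_abs]
    exact_mod_cast Int.one_le_abs hk0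
  have e3 : r * |p₂| ≤ g * |p₂ / U - p₂' / U'| := by
    calc r * |p₂| ≤ r * |(k : ℝ)| * |p₂| := by
          have : r * 1 ≤ r * |(k : ℝ)| := by gcongr
          rw [mul_one] at this
          gcongr
      _ = |g * (U * p₂' - U' * p₂)| := by rw [e1, abs_mul, abs_mul, abs_of_pos hr]
      _ = g * (U * U' * |p₂ / U - p₂' / U'|) := by
          rw [e2, abs_mul, abs_mul, abs_mul, abs_of_pos hgR, abs_of_pos hU, abs_of_pos hU',
            abs_sub_comm]
      _ ≤ g * (1 * 1 * |p₂ / U - p₂' / U'|) := by gcongr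
      _ = _ := by ring
  have e4 : 1 / (4 * z ^ 5) ≤ r * |p₂| := by
    calc 1 / (4 * z ^ 5) = 1 / (z ^ 2 * R) * (R / z / 4 * (1 / z ^ 2)) := by field_simp
      _ ≤ r * (R / z / 4 * U) := by gcongr; exact h.r_lo
      _ ≤ r * |p₂| := by gcongr
  have e5 : g * |p₂ / U - p₂' / U'| < z * (1 / z ^ 7) :=
    mul_lt_mul' hgz hd2 (abs_nonneg _) hz
  have e6 : z * (1 / z ^ 7) ≤ 1 / (4 * z ^ 5) := by
    rw [mul_one_div, div_le_div_iff₀ (by positivity) (by positivity)]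
    nlinarith [pow_pos hz 6]
  linarith

end StepForm

/-- The point `x i` for which the first column of `h(x) g` vanishes in the coordinate `i`. -/
noncomputable def center (g : Matrix (Fin 3) (Fin 3) ℝ) (i : Fin 3) : ℝ := -(g i 0 / g 2 0)

/-- A basis `g` of a unimodular lattice whose first two columns have controlled size after
applying `h(center g)` and rescaling by `(q₁, q₂)`. -/
structure IsAdmissible (q₁ q₂ z : ℝ) (g : Matrix (Fin 3) (Fin 3) ℝ) : Prop where
  det : |g.det| = 1
  lo : q₁ * q₂ / z ^ 2 ≤ g 2 0
  hi : g 2 0 ≤ q₁ * q₂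
  fst_le : |g 0 1 + center g 0 * g 2 1| ≤ z / q₁
  snd_ge : 1 / (z ^ 5 * q₂) ≤ |g 1 1 + center g 1 * g 2 1|
  snd_le : |g 1 1 + center g 1 * g 2 1| ≤ z / q₂

namespace IsAdmissible

variable {q₁ q₂ z W₁ W₂ : ℝ} {g : Matrix (Fin 3) (Fin 3) ℝ}

lemma pos (h : IsAdmissible q₁ q₂ z g) (hq₁ : 0 < q₁) (hq₂ : 0 < q₂) (hz : 0 < z) : 0 < g 2 0 :=
  lt_of_lt_of_le (by positivity) h.lo

lemma mono (h : IsAdmissible q₁ q₂ z g) (hq₁ : 0 < q₁) (hq₂ : 0 < q₂) (hz : 0 < z) {z' : ℝ}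
    (hzz : z ≤ z') : IsAdmissible q₁ q₂ z' g where
  det := h.det
  lo := le_trans (by gcongr) h.lo
  hi := h.hi
  fst_le := h.fst_le.trans (by gcongr)
  snd_ge := le_trans (by gcongr) h.snd_ge
  snd_le := h.snd_le.trans (by gcongr)

lemma stepForm (h : IsAdmissible q₁ q₂ z g) (hq₁ : 0 < q₁) (hq₂ : 0 < q₂) (hz : 10 ^ 6 ≤ z)
    (hlog : 1 + Real.log (W₁ * W₂) ≤ z) (hW₂ : z ^ 40 ≤ W₂) (hW₁ : z ^ 40 * W₂ ≤ W₁) :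
    StepForm (W₁ * W₂) W₁ W₂ z (q₁ * W₁ * (g 0 1 + center g 0 * g 2 1))
      (q₁ * W₁ * (g 0 2 + center g 0 * g 2 2)) (q₂ * W₂ * (g 1 1 + center g 1 * g 2 1))
      (q₂ * W₂ * (g 1 2 + center g 1 * g 2 2)) (g 2 0 / (q₁ * W₁ * (q₂ * W₂))) := by
  have hz0 : 0 < z := by linarith
  have hW₂0 : 0 < W₂ := lt_of_lt_of_le (by positivity) hW₂
  have hW₁0 : 0 < W₁ := lt_of_lt_of_le (by positivity) hW₁
  have hg := h.pos hq₁ hq₂ hz0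
  refine ⟨rfl, hz, hlog, hW₂, hW₁, ?_, ?_, ?_, ?_, ?_, ?_⟩
  · rw [← h.det, Matrix.det_fin_three]
    congr 1
    simp only [center]
    field_simp
    ring
  · rw [le_div_iff₀ (by positivity)]
    refine le_trans (le_of_eq ?_) h.lo
    field_simp
  · rw [div_le_iff₀ (by positivity)]
    refine h.hi.trans (le_of_eq ?_)
    field_simp
  · rw [abs_mul, abs_of_pos (by positivity : 0 < q₁ * W₁)]
    refine (mul_le_mul_of_nonneg_left h.fst_le (by positivity)).trans (le_of_eq ?_)
    field_simp
  · rw [abs_mul, abs_of_pos (by positivity : 0 < q₂ * W₂)]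
    refine le_trans (le_of_eq ?_) (mul_le_mul_of_nonneg_left h.snd_ge (by positivity))
    field_simp
  · rw [abs_mul, abs_of_pos (by positivity : 0 < q₂ * W₂)]
    refine (mul_le_mul_of_nonneg_left h.snd_le (by positivity)).trans (le_of_eq ?_)
    field_simp

/-- The first column of a child determines a new admissible basis. -/
lemma exists_child {Y a₁ c₁ a₂ c₂ r s θ y : ℝ} {u : Fin 3 → ℤ} {q₁' q₂' : ℝ} (hz : 4 ≤ z)
    (hY : 0 < Y) (hYr : Y * r ≤ 1 / z) (hYr' : 1 / z ^ 3 ≤ Y * r)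
    (hq₁' : 0 < q₁') (hq₂' : 0 < q₂') (hdet : |g.det| = 1) (hg : 0 < g 2 0)
    (ha₁ : a₁ = q₁' * (g 0 1 + center g 0 * g 2 1)) (hc₁ : c₁ = q₁' * (g 0 2 + center g 0 * g 2 2))
    (ha₂ : a₂ = q₂' * (g 1 1 + center g 1 * g 2 1)) (hc₂ : c₂ = q₂' * (g 1 2 + center g 1 * g 2 2))
    (hr : r = g 2 0 / (q₁' * q₂')) (hs : s = g 2 1 / (q₁' * q₂')) (hθ : θ = g 2 2 / (q₁' * q₂'))
    {Δ : ℝ} (hu : IsChild Y z Δ a₁ c₁ a₂ c₂ r s θ y u)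
    (hlo : Y / 4 * spatialForm r s θ u ≤ |planarForm a₂ c₂ u|)
    (hhi : |planarForm a₂ c₂ u| ≤ 7 / 8 * Y * spatialForm r s θ u) :
    ∃ C : Matrix (Fin 3) (Fin 3) ℤ, IsAdmissible q₁' q₂' z (g * C.map (Int.cast : ℤ → ℝ)) ∧
      center (g * C.map (Int.cast : ℤ → ℝ)) 0 = center g 0 -
        planarForm a₁ c₁ u / spatialForm r s θ u / (q₁' * (q₁' * q₂')) ∧
      center (g * C.map (Int.cast : ℤ → ℝ)) 1 = center g 1 -
        planarForm a₂ c₂ u / spatialForm r s θ u / (q₂' * (q₁' * q₂')) := by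
  have hz1 : 1 ≤ z := by linarith
  obtain ⟨C, m, hC, hCu, e0, e1, e2⟩ := exists_completion u hu.prim hu.gcd_pos
  set G : ℕ := Int.gcd (u 1) (u 2) with hG
  have hU := hu.spatial_pos (by linarith)
  have hr0 : 0 < r := by rw [hr]; positivity
  set U := spatialForm r s θ u with hUdef
  set P₁ := planarForm a₁ c₁ u with hP₁
  set P₂ := planarForm a₂ c₂ u with hP₂
  set g' := g * C.map (Int.cast : ℤ → ℝ) with hg'
  have hcol : ∀ i j, g' i j = g i 0 * C 0 j + g i 1 * C 1 j + g i 2 * C 2 j := by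
    intro i j
    simp [hg', Matrix.mul_apply, Fin.sum_univ_three]
  have h20 : g' 2 0 = q₁' * q₂' * U := by
    rw [hcol, hUdef, spatialForm, hr, hs, hθ, hCu, hCu, hCu]
    field_simp
  have h00 : g' 0 0 = P₁ / q₁' - center g 0 * (q₁' * q₂' * U) := by
    rw [← h20, hcol, hcol, hP₁, planarForm, ha₁, hc₁, hCu, hCu, hCu, center]
    field_simp
    ring
  have h10 : g' 1 0 = P₂ / q₂' - center g 1 * (q₁' * q₂' * U) := by
    rw [← h20, hcol, hcol, hP₂, planarForm, ha₂, hc₂, hCu, hCu, hCu, center]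
    field_simp
    ring
  have s0 : center g' 0 = center g 0 - P₁ / U / (q₁' * (q₁' * q₂')) := by
    rw [center, h00, h20]
    field_simp
    ring
  have s1 : center g' 1 = center g 1 - P₂ / U / (q₂' * (q₁' * q₂')) := by
    rw [center, h10, h20]
    field_simp
    ring
  have hG0 : (0 : ℝ) < G := by exact_mod_cast hu.gcd_pos
  have hG1 : (1 : ℝ) ≤ G := by exact_mod_cast hu.gcd_pos
  have hGz : (G : ℝ) ≤ z := hu.gcd_le
  have key : ∀ i, (m : ℝ) * g' i 0 - G * g' i 1 = g i 0 := by
    intro i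
    have e0' : (m : ℝ) * C 0 0 - G * C 0 1 = 1 := by exact_mod_cast e0
    have e1' : (m : ℝ) * C 1 0 - G * C 1 1 = 0 := by exact_mod_cast e1
    have e2' : (m : ℝ) * C 2 0 - G * C 2 1 = 0 := by exact_mod_cast e2
    rw [hcol, hcol]
    linear_combination g i 0 * e0' + g i 1 * e1' + g i 2 * e2'
  have hg'0 : 0 < g' 2 0 := by rw [h20]; positivity
  have hnew : ∀ i, G * (g' i 1 + center g' i * g' 2 1) = (center g i - center g' i) * g 2 0 := by
    intro i
    have k1 := key i
    have k2 := key 2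
    have k3 : center g i * g 2 0 = - g i 0 := by rw [center]; field_simp
    have k4 : center g' i * g' 2 0 = - g' i 0 := by rw [center]; field_simp
    linear_combination (-1 : ℝ) * k1 - center g' i * k2 - k3 + m * k4
  have hα : g' 0 1 + center g' 0 * g' 2 1 = P₁ / U * r / (G * q₁') := by
    have := hnew 0
    rw [show center g 0 - center g' 0 = P₁ / U / (q₁' * (q₁' * q₂')) by rw [s0]; ring] at this
    rw [eq_div_iff (by positivity), hr, show ∀ t : ℝ, t * (G * q₁') = q₁' * (G * t) by
      intro t; ring, this]
    field_simp
  have hβ : g' 1 1 + center g' 1 * g' 2 1 = P₂ / U * r / (G * q₂') := by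
    have := hnew 1
    rw [show center g 1 - center g' 1 = P₂ / U / (q₂' * (q₁' * q₂')) by rw [s1]; ring] at this
    rw [eq_div_iff (by positivity), hr, show ∀ t : ℝ, t * (G * q₂') = q₂' * (G * t) by
      intro t; ring, this]
    field_simp
  refine ⟨C, ?_, s0, s1⟩
  change IsAdmissible q₁' q₂' z g'
  refine ⟨?_, ?_, ?_, ?_, ?_, ?_⟩
  · rw [hg', Matrix.det_mul, show (C.map (Int.cast : ℤ → ℝ)).det = 1 from ?_, mul_one, hdet]
    have := (Int.castRingHom ℝ).map_det C
    rw [hC] at this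
    simpa using this.symm
  · rw [h20, ← mul_one_div]
    gcongr
    exact hu.lo
  · rw [h20]
    exact mul_le_of_le_one_right (by positivity) hu.hi
  · rw [hα, abs_div, abs_mul, abs_div, abs_of_pos hU, abs_of_pos hr0,
      abs_of_pos (by positivity : 0 < G * q₁')]
    have h1 : |P₁| / U ≤ Y := (div_le_iff₀ hU).2 (hu.pos₁.trans (by gcongr; linarith))
    calc |P₁| / U * r / (G * q₁') ≤ Y * r / (1 * q₁') := by gcongr
      _ ≤ z / (1 * q₁') := by
          gcongr
          exact hYr.trans ((div_le_one (by linarith)).2 hz1 |>.trans hz1)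
      _ = z / q₁' := by rw [one_mul]
  · rw [hβ, abs_div, abs_mul, abs_div, abs_of_pos hU, abs_of_pos hr0,
      abs_of_pos (by positivity : 0 < G * q₂')]
    have h1 : Y / 4 ≤ |P₂| / U := (le_div_iff₀ hU).2 hlo
    calc 1 / (z ^ 5 * q₂') ≤ 1 / (4 * z ^ 4 * q₂') := by
          refine one_div_le_one_div_of_le (by positivity) ?_
          rw [pow_succ' z 4]
          gcongr
      _ = 1 / z ^ 3 / 4 / (z * q₂') := by field_simp
      _ ≤ Y * r / 4 / (G * q₂') := by gcongr
      _ = Y / 4 * r / (G * q₂') := by ring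
      _ ≤ _ := by gcongr
  · rw [hβ, abs_div, abs_mul, abs_div, abs_of_pos hU, abs_of_pos hr0,
      abs_of_pos (by positivity : 0 < G * q₂')]
    have h1 : |P₂| / U ≤ Y := (div_le_iff₀ hU).2 (hhi.trans (by gcongr; linarith))
    calc |P₂| / U * r / (G * q₂') ≤ Y * r / (1 * q₂') := by gcongr
      _ ≤ z / (1 * q₂') := by
          gcongr
          exact hYr.trans ((div_le_one (by linarith)).2 hz1 |>.trans hz1)
      _ = z / q₂' := by rw [one_mul]

/-- One step of the construction: an admissible basis has many well-separated admissible
descendants. -/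
theorem exists_children (h : IsAdmissible q₁ q₂ z g) (hq₁ : 0 < q₁) (hq₂ : 0 < q₂)
    (hz : 10 ^ 6 ≤ z) (hlog : 1 + Real.log (W₁ * W₂) ≤ z) (hW₂ : z ^ 40 ≤ W₂)
    (hW₁ : z ^ 40 * W₂ ≤ W₁) {ν N : ℕ} (hν : ν ≤ W₁ * W₂ * W₂ / z ^ 2) (hN : N ≤ W₁ / z ^ 6)
    {q₁' q₂' Y : ℝ} (hq₁' : q₁' = q₁ * W₁) (hq₂' : q₂' = q₂ * W₂) (hY : Y = W₁ * W₂ / z) :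
    ∃ C : Fin ν → Fin N → Matrix (Fin 3) (Fin 3) ℤ,
      (∀ j i, IsAdmissible q₁' q₂' z (g * (C j i).map (Int.cast : ℤ → ℝ)) ∧
        |center (g * (C j i).map (Int.cast : ℤ → ℝ)) 0 - center g 0| ≤
          Y / 2 / (q₁' * (q₁' * q₂')) ∧
        |center (g * (C j i).map (Int.cast : ℤ → ℝ)) 1 - center g 1| ≤
          7 / 8 * Y / (q₂' * (q₁' * q₂'))) ∧
      (∀ j j' i i', j ≠ j' → 3 / 4 * (1 / W₂) / (q₂' * (q₁' * q₂')) ≤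
        |center (g * (C j i).map (Int.cast : ℤ → ℝ)) 1 -
          center (g * (C j' i').map (Int.cast : ℤ → ℝ)) 1|) ∧
      ∀ j i i', i ≠ i' →
        1 / z ^ 7 / (q₁' * (q₁' * q₂')) ≤
          |center (g * (C j i).map (Int.cast : ℤ → ℝ)) 0 -
            center (g * (C j i').map (Int.cast : ℤ → ℝ)) 0| ∨
        1 / z ^ 7 / (q₂' * (q₁' * q₂')) ≤
          |center (g * (C j i).map (Int.cast : ℤ → ℝ)) 1 -
            center (g * (C j i').map (Int.cast : ℤ → ℝ)) 1| := by
  have hz0 : 0 < z := by linarith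
  have hS := h.stepForm hq₁ hq₂ hz hlog hW₂ hW₁
  rw [← hq₁', ← hq₂'] at hS
  set s := g 2 1 / (q₁' * q₂') with hs
  set θ := g 2 2 / (q₁' * q₂') with hθ
  set a₁ := q₁' * (g 0 1 + center g 0 * g 2 1) with ha₁
  set c₁ := q₁' * (g 0 2 + center g 0 * g 2 2) with hc₁
  set a₂ := q₂' * (g 1 1 + center g 1 * g 2 1) with ha₂
  set c₂ := q₂' * (g 1 2 + center g 1 * g 2 2) with hc₂
  set r := g 2 0 / (q₁' * q₂') with hr
  have hq₁0 : 0 < q₁' := by rw [hq₁']; exact mul_pos hq₁ hS.W₁_pos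
  have hq₂0 : 0 < q₂' := by rw [hq₂']; exact mul_pos hq₂ hS.W₂_pos
  obtain ⟨y, f, hy, hyy, hf⟩ := hS.exists_children s θ hν hN
  have hYr := hS.Yr_hi
  have hYr' := hS.Yr_lo
  have hYpos : 0 < W₁ * W₂ / z := div_pos hS.R_pos hz0
  have hex := fun j i => exists_child (by linarith) hYpos hYr hYr' hq₁0 hq₂0 h.det
    (h.pos hq₁ hq₂ hz0) ha₁ hc₁ ha₂ hc₂ hr hs hθ ((hf j).2 i)
    (hS.planar_bounds (hy j).1 (hy j).2 ((hf j).2 i)).1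
    (hS.planar_bounds (hy j).1 (hy j).2 ((hf j).2 i)).2
  choose C hC hC0 hC1 using hex
  subst hY
  have hU := fun j i => ((hf j).2 i).spatial_pos hz0
  set D₁ := q₁' * (q₁' * q₂') with hD₁
  set D₂ := q₂' * (q₁' * q₂') with hD₂
  have hD₁0 : 0 < D₁ := by positivity
  have hD₂0 : 0 < D₂ := by positivity
  have hW₂0 := hS.W₂_pos
  refine ⟨C, fun j i => ⟨hC j i, ?_, ?_⟩, fun j j' i i' hj => ?_, fun j i i' hi => ?_⟩
  · rw [hC0, sub_sub_cancel_left, abs_neg, abs_div, abs_div, abs_of_pos hD₁0, abs_of_pos (hU j i)]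
    refine div_le_div_of_nonneg_right ?_ hD₁0.le
    exact (div_le_iff₀ (hU j i)).2 ((hf j).2 i).pos₁
  · rw [hC1, sub_sub_cancel_left, abs_neg, abs_div, abs_div, abs_of_pos hD₂0, abs_of_pos (hU j i)]
    refine div_le_div_of_nonneg_right ?_ hD₂0.le
    refine (div_le_iff₀ (hU j i)).2 ?_
    exact (hS.planar_bounds (hy j).1 (hy j).2 ((hf j).2 i)).2
  · rw [hC1, hC1, sub_sub_sub_cancel_left, ← sub_div, abs_div, abs_of_pos hD₂0]
    gcongr
    have k1 : ∀ j i, |planarForm a₂ c₂ (f j i) / spatialForm r s θ (f j i) + y j| ≤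
        1 / W₂ / 8 := by
      intro j i
      have := ((hf j).2 i).pos₂
      have hU := hU j i
      rw [show planarForm a₂ c₂ (f j i) / spatialForm r s θ (f j i) + y j =
        (planarForm a₂ c₂ (f j i) + y j * spatialForm r s θ (f j i)) /
          spatialForm r s θ (f j i) by field_simp, abs_div, abs_of_pos hU, div_le_iff₀ hU]
      exact this
    have h1 := k1 j i
    have h2 := k1 j' i'
    have h3 := hyy j j' hj
    rw [abs_le] at h1 h2
    rw [le_abs] at h3 ⊢
    rcases h3 with h3 | h3
    · left; linarith
    · right; linarith
  · have hne : f j i ≠ f j i' := fun e => hi ((hf j).1 e)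
    have := hS.separation (hy j).1 (hy j).2 ((hf j).2 i) ((hf j).2 i') hne
    rw [hC0, hC1, hC0, hC1, sub_sub_sub_cancel_left, sub_sub_sub_cancel_left, ← sub_div,
      ← sub_div, abs_div, abs_div, abs_of_pos hD₁0, abs_of_pos hD₂0, abs_sub_comm,
      abs_sub_comm (planarForm a₂ c₂ (f j i') / _)]
    exact this.imp (fun h => by gcongr) fun h => by gcongr

end IsAdmissible

section Cantor

variable {ν N : ℕ → ℕ} [∀ k, NeZero (ν k)] [∀ k, NeZero (N k)]

/-- The uniform product measure on the space of paths. -/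
noncomputable def pathMeasure (ν N : ℕ → ℕ) [∀ k, NeZero (ν k)] [∀ k, NeZero (N k)] :
    Measure (∀ k, Fin (ν k) × Fin (N k)) :=
  Measure.infinitePi fun k => (PMF.uniformOfFintype (Fin (ν k) × Fin (N k))).toMeasure

instance : IsProbabilityMeasure (pathMeasure ν N) := by
  unfold pathMeasure; infer_instance

lemma pathMeasure_cylinder_le {J : ℕ} {T : Set (∀ k, Fin (ν k) × Fin (N k))}
    (hT : ∀ ω ∈ T, ∀ ω' ∈ T, ∀ i < J, ω i = ω' i) :
    pathMeasure ν N T ≤ ∏ i ∈ Finset.range J, ((ν i * N i : ℕ) : ENNReal)⁻¹ := by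
  rcases T.eq_empty_or_nonempty with rfl | ⟨ω, hω⟩
  · simp
  have hsub : T ⊆ Set.pi (Finset.range J) fun i => {ω i} := by
    intro ω' hω' i hi
    exact hT ω' hω' ω hω i (Finset.mem_range.1 hi)
  refine (measure_mono hsub).trans ?_
  rw [pathMeasure, Measure.infinitePi_pi _ fun i _ => measurableSet_singleton _]
  refine le_of_eq (Finset.prod_congr rfl fun i _ => ?_)
  rw [PMF.toMeasure_apply_singleton _ _ (measurableSet_singleton _)]
  simp

lemma pathMeasure_le {k J : ℕ} {T : Set (∀ k, Fin (ν k) × Fin (N k))}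
    (hk : ∀ i < k, ∀ ω ∈ T, ∀ ω' ∈ T, (∀ l < i, ω l = ω' l) → (ω i).1 = (ω' i).1 →
      (ω i).2 = (ω' i).2)
    (hJ : ∀ i < J, ∀ ω ∈ T, ∀ ω' ∈ T, (∀ l < i, ω l = ω' l) → (ω i).1 = (ω' i).1) :
    pathMeasure ν N T ≤ (∏ i ∈ Finset.Ico k J, (N i : ENNReal)) *
      ∏ i ∈ Finset.range J, ((ν i * N i : ℕ) : ENNReal)⁻¹ := by
  have hsub : T ⊆ ⋃ p : ∀ i : Finset.Ico k J, Fin (N i),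
      T ∩ {ω | ∀ i : Finset.Ico k J, (ω i).2 = p i} := by
    intro ω hω
    exact Set.mem_iUnion.2 ⟨fun i => (ω i).2, hω, fun i => rfl⟩
  refine (measure_mono hsub).trans ((measure_iUnion_le _).trans ?_)
  rw [tsum_fintype]
  refine (Finset.sum_le_card_nsmul _ _ (∏ i ∈ Finset.range J, ((ν i * N i : ℕ) : ENNReal)⁻¹)
    fun p _ => pathMeasure_cylinder_le ?_).trans ?_
  · rintro ω ⟨hω, hp⟩ ω' ⟨hω', hp'⟩ i
    induction i using Nat.strong_induction_on with
    | _ i ih =>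
      intro hi
      have ih' : ∀ l < i, ω l = ω' l := fun l hl => ih l hl (hl.trans hi)
      have hfst := hJ i hi ω hω ω' hω' ih'
      refine Prod.ext hfst ?_
      by_cases hik : i < k
      · exact hk i hik ω hω ω' hω' ih' hfst
      · have hmem : i ∈ Finset.Ico k J := Finset.mem_Ico.2 ⟨not_lt.1 hik, hi⟩
        exact (hp ⟨i, hmem⟩).trans (hp' ⟨i, hmem⟩).symm
  · rw [nsmul_eq_mul]
    gcongr
    rw [Finset.card_univ, Fintype.card_pi]
    simp only [Fintype.card_fin]
    rw [Finset.prod_coe_sort (Finset.Ico k J) N, Nat.cast_prod]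

/-- A mass distribution principle for Cantor sets with two scales of separation. -/
theorem le_dimH_range_of_separated {E : Type*} [MetricSpace E] [MeasurableSpace E] [BorelSpace E]
    {g : (∀ k, Fin (ν k) × Fin (N k)) → E} {D ρ : ℕ → ℝ}
    (hD : ∀ k ω ω', (∀ i < k, ω i = ω' i) → (ω k).1 ≠ (ω' k).1 → D k ≤ dist (g ω) (g ω'))
    (hρ : ∀ k ω ω', (∀ i < k, ω i = ω' i) → (ω k).1 = (ω' k).1 → (ω k).2 ≠ (ω' k).2 →
      ρ k ≤ dist (g ω) (g ω'))
    {s : NNReal} {C r₀ : ℝ} (hr₀ : 0 < r₀)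
    (hC : ∀ r, 0 < r → r < r₀ → ∃ k J : ℕ, (∀ i < k, r < ρ i) ∧ (∀ i < J, r < D i) ∧
      (∏ i ∈ Finset.Ico k J, (N i : ℝ)) * ∏ i ∈ Finset.range J, ((ν i * N i : ℕ) : ℝ)⁻¹ ≤
        C * r ^ (s : ℝ)) :
    (s : ENNReal) ≤ dimH (Set.range g) := by
  have hmeas : ∀ A : Set E, Metric.ediam A < ENNReal.ofReal r₀ →
      pathMeasure ν N (g ⁻¹' A) ≤ ENNReal.ofReal C * Metric.ediam A ^ (s : ℝ) := by
    intro A hA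
    have key : ∀ r : ℝ, 0 < r → r < r₀ → Metric.ediam A ≤ ENNReal.ofReal r →
        pathMeasure ν N (g ⁻¹' A) ≤ ENNReal.ofReal C * ENNReal.ofReal r ^ (s : ℝ) := by
      intro r hr hr' hAr
      obtain ⟨k, J, hk, hJ, hle⟩ := hC r hr hr'
      have hdist : ∀ ω ∈ g ⁻¹' A, ∀ ω' ∈ g ⁻¹' A, dist (g ω) (g ω') ≤ r := by
        intro ω hω ω' hω'
        have : edist (g ω) (g ω') ≤ _ := (Metric.edist_le_ediam_of_mem (s := A) hω hω').trans hAr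
        rwa [edist_dist, ENNReal.ofReal_le_ofReal_iff hr.le] at this
      refine (pathMeasure_le (k := k) (J := J) ?_ ?_).trans ?_
      · intro i hi ω hω ω' hω' hag hfst
        by_contra hne
        linarith [hρ i ω ω' hag hfst hne, hdist ω hω ω' hω', hk i hi]
      · intro i hi ω hω ω' hω' hag
        by_contra hne
        linarith [hD i ω ω' hag hne, hdist ω hω ω' hω', hJ i hi]
      · have hC0 : 0 ≤ C := by
          have h1 : 0 < r ^ (s : ℝ) := Real.rpow_pos_of_pos hr _
          have h2 : 0 ≤ C * r ^ (s : ℝ) := le_trans (by positivity) hle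
          exact nonneg_of_mul_nonneg_left h2 h1
        rw [ENNReal.ofReal_rpow_of_nonneg hr.le s.coe_nonneg, ← ENNReal.ofReal_mul hC0]
        refine le_trans (le_of_eq ?_) (ENNReal.ofReal_le_ofReal hle)
        rw [ENNReal.ofReal_mul (by positivity),
          ENNReal.ofReal_prod_of_nonneg (by intros; positivity),
          ENNReal.ofReal_prod_of_nonneg (by intros; positivity)]
        congr 1
        · simp
        · refine Finset.prod_congr rfl fun i _ => ?_
          have : 0 < ν i * N i := Nat.mul_pos (NeZero.pos _) (NeZero.pos _)
          rw [ENNReal.ofReal_inv_of_pos (by exact_mod_cast this), ENNReal.ofReal_natCast]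
    obtain ⟨d, hd0, hd⟩ : ∃ d : ℝ, 0 ≤ d ∧ Metric.ediam A = ENNReal.ofReal d :=
      ⟨(Metric.ediam A).toReal, ENNReal.toReal_nonneg, (ENNReal.ofReal_toReal hA.ne_top).symm⟩
    rw [hd] at hA key ⊢
    have hdr : d < r₀ := (ENNReal.ofReal_lt_ofReal_iff hr₀).1 hA
    have hlim : Filter.Tendsto (fun r : ℝ => ENNReal.ofReal C * ENNReal.ofReal r ^ (s : ℝ))
        (nhdsWithin d (Set.Ioi d)) (nhds (ENNReal.ofReal C * ENNReal.ofReal d ^ (s : ℝ))) := by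
      refine ENNReal.Tendsto.const_mul ?_ (Or.inr ENNReal.ofReal_ne_top)
      exact ((ENNReal.continuous_rpow_const.comp ENNReal.continuous_ofReal).tendsto d).mono_left
        nhdsWithin_le_nhds
    refine ge_of_tendsto hlim ?_
    filter_upwards [Ioo_mem_nhdsGT hdr] with r hr
    exact key r (hd0.trans_lt hr.1) hr.2 (ENNReal.ofReal_le_ofReal hr.1.le)
  have hne : μH[(s : ℝ)] (Set.range g) ≠ 0 := by
    intro h0
    rw [Measure.hausdorffMeasure_apply] at h0
    have h1 := ENNReal.iSup_eq_zero.1 (ENNReal.iSup_eq_zero.1 h0 (ENNReal.ofReal (r₀ / 2)))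
      (ENNReal.ofReal_pos.2 (half_pos hr₀))
    have hpos : 0 < (ENNReal.ofReal C + 1)⁻¹ :=
      ENNReal.inv_pos.2 (ENNReal.add_ne_top.2 ⟨ENNReal.ofReal_ne_top, ENNReal.one_ne_top⟩)
    rw [← h1] at hpos
    simp only [iInf_lt_iff] at hpos
    obtain ⟨t, ht, htr, hlt⟩ := hpos
    have h2 : (1 : ENNReal) ≤ ENNReal.ofReal C *
        ∑' n, ⨆ _ : (t n).Nonempty, Metric.ediam (t n) ^ (s : ℝ) := by
      rw [← measure_univ (μ := pathMeasure ν N), ← ENNReal.tsum_mul_left]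
      have hcov : (Set.univ : Set (∀ k, Fin (ν k) × Fin (N k))) ⊆ ⋃ n, g ⁻¹' t n := by
        intro ω _
        rw [← Set.preimage_iUnion]
        exact ht ⟨ω, rfl⟩
      refine (measure_mono hcov).trans ((measure_iUnion_le _).trans
        (ENNReal.tsum_le_tsum fun n => ?_))
      rcases (t n).eq_empty_or_nonempty with he | hn
      · simp [he]
      · rw [ciSup_pos hn]
        refine hmeas _ ((htr n).trans_lt ?_)
        rw [ENNReal.ofReal_lt_ofReal_iff hr₀]
        exact half_lt_self hr₀
    have h3 : ENNReal.ofReal C * (ENNReal.ofReal C + 1)⁻¹ < 1 := by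
      rw [← div_eq_mul_inv]
      refine ENNReal.div_lt_of_lt_mul' ?_
      rw [mul_one]
      exact ENNReal.lt_add_right ENNReal.ofReal_ne_top one_ne_zero
    exact absurd (h2.trans (mul_le_mul_right hlt.le _)) (not_le.2 h3)
  exact le_dimH_of_hausdorffMeasure_ne_zero hne

end Cantor

lemma exists_abs_sub_le_of_nested {x b : ℕ → ℝ} (h : ∀ k, |x (k + 1) - x k| + b (k + 1) ≤ b k)
    (hb : ∀ k, 0 ≤ b k) : ∃ p, ∀ k, |p - x k| ≤ b k := by
  have hanti : Antitone fun k => Set.Icc (x k - b k) (x k + b k) := by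
    refine antitone_nat_of_succ_le fun k => Set.Icc_subset_Icc ?_ ?_
    · linarith [h k, neg_abs_le (x (k + 1) - x k)]
    · linarith [h k, le_abs_self (x (k + 1) - x k)]
  have := ciSup_mem_iInter_Icc_of_antitone_Icc hanti fun k => by linarith [hb k]
  refine ⟨⨆ n, (x n - b n), fun k => abs_sub_le_iff.2 ?_⟩
  have hk := Set.mem_iInter.1 this k
  exact ⟨by linarith [hk.2], by linarith [hk.1]⟩

/-- The parameters of the construction at all levels. -/
structure Scales (ν N : ℕ → ℕ) (z W₁ W₂ q₁ q₂ : ℕ → ℝ) : Prop where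
  hz : ∀ k, 10 ^ 6 ≤ z k
  z_mono : Monotone z
  W₂_mono : Monotone W₂
  hlog : ∀ k, 1 + Real.log (W₁ k * W₂ k) ≤ z k
  hW₂ : ∀ k, z k ^ 40 ≤ W₂ k
  hW₁ : ∀ k, z k ^ 40 * W₂ k ≤ W₁ k
  hν : ∀ k, (ν k : ℝ) ≤ W₁ k * W₂ k * W₂ k / z k ^ 2
  hN : ∀ k, (N k : ℝ) ≤ W₁ k / z k ^ 6
  q₂_pos : 0 < q₂ 0
  q_le : q₂ 0 ≤ q₁ 0
  q₁_succ : ∀ k, q₁ (k + 1) = q₁ k * W₁ k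
  q₂_succ : ∀ k, q₂ (k + 1) = q₂ k * W₂ k

namespace Scales

variable {ν N : ℕ → ℕ} {z W₁ W₂ q₁ q₂ : ℕ → ℝ}

lemma z_pos (h : Scales ν N z W₁ W₂ q₁ q₂) (k : ℕ) : 0 < z k := by linarith [h.hz k]

lemma one_le_W₂ (h : Scales ν N z W₁ W₂ q₁ q₂) (k : ℕ) : 1 ≤ W₂ k :=
  le_trans (one_le_pow₀ (by linarith [h.hz k])) (h.hW₂ k)

lemma W₂_le (h : Scales ν N z W₁ W₂ q₁ q₂) (k : ℕ) : W₂ k ≤ W₁ k := by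
  refine le_trans (le_mul_of_one_le_left ?_ (one_le_pow₀ ?_)) (h.hW₁ k)
  · linarith [h.one_le_W₂ k]
  · linarith [h.hz k]

lemma q_bounds (h : Scales ν N z W₁ W₂ q₁ q₂) (k : ℕ) : 0 < q₂ k ∧ q₂ k ≤ q₁ k := by
  induction k with
  | zero => exact ⟨h.q₂_pos, h.q_le⟩
  | succ k ih =>
    have := h.one_le_W₂ k
    have := h.W₂_le k
    rw [h.q₁_succ, h.q₂_succ]
    obtain ⟨ih1, ih2⟩ := ih
    exact ⟨by positivity, by gcongr; linarith⟩

lemma q₂_pos' (h : Scales ν N z W₁ W₂ q₁ q₂) (k : ℕ) : 0 < q₂ k := (h.q_bounds k).1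

lemma q₁_pos (h : Scales ν N z W₁ W₂ q₁ q₂) (k : ℕ) : 0 < q₁ k :=
  (h.q_bounds k).1.trans_le (h.q_bounds k).2

/-- The tree of admissible bases. -/
theorem exists_tree (h : Scales ν N z W₁ W₂ q₁ q₂) (B : Matrix (Fin 3) (Fin 3) ℝ)
    (E₀ : Matrix (Fin 3) (Fin 3) ℤ)
    (hE₀ : IsAdmissible (q₁ 0) (q₂ 0) (z 0) (B * E₀.map (Int.cast : ℤ → ℝ))) :
    ∃ E : (∀ k, Fin (ν k) × Fin (N k)) → ℕ → Matrix (Fin 3) (Fin 3) ℤ,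
      ∃ x₁ x₂ : (∀ k, Fin (ν k) × Fin (N k)) → ℕ → ℝ,
      (∀ ω k, x₁ ω k = center (B * (E ω k).map (Int.cast : ℤ → ℝ)) 0) ∧
      (∀ ω k, x₂ ω k = center (B * (E ω k).map (Int.cast : ℤ → ℝ)) 1) ∧
      (∀ ω, E ω 0 = E₀) ∧
      (∀ ω k, IsAdmissible (q₁ k) (q₂ k) (z k) (B * (E ω k).map (Int.cast : ℤ → ℝ))) ∧
      (∀ ω k, |x₁ ω (k + 1) - x₁ ω k| ≤
        W₁ k * W₂ k / z k / 2 / (q₁ (k + 1) * (q₁ (k + 1) * q₂ (k + 1)))) ∧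
      (∀ ω k, |x₂ ω (k + 1) - x₂ ω k| ≤
        7 / 8 * (W₁ k * W₂ k / z k) / (q₂ (k + 1) * (q₁ (k + 1) * q₂ (k + 1)))) ∧
      (∀ ω ω' k, (∀ i < k, ω i = ω' i) → (ω k).1 ≠ (ω' k).1 →
        3 / 4 * (1 / W₂ k) / (q₂ (k + 1) * (q₁ (k + 1) * q₂ (k + 1))) ≤
          |x₂ ω (k + 1) - x₂ ω' (k + 1)|) ∧
      (∀ ω ω' k, (∀ i < k, ω i = ω' i) → (ω k).1 = (ω' k).1 → (ω k).2 ≠ (ω' k).2 →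
        1 / z k ^ 7 / (q₁ (k + 1) * (q₁ (k + 1) * q₂ (k + 1))) ≤
          |x₁ ω (k + 1) - x₁ ω' (k + 1)| ∨
        1 / z k ^ 7 / (q₂ (k + 1) * (q₁ (k + 1) * q₂ (k + 1))) ≤
          |x₂ ω (k + 1) - x₂ ω' (k + 1)|) := by
  have hex := fun k (g : Matrix (Fin 3) (Fin 3) ℝ)
    (hg : IsAdmissible (q₁ k) (q₂ k) (z k) g) =>
    hg.exists_children (h.q₁_pos k) (h.q₂_pos' k) (h.hz k) (h.hlog k) (h.hW₂ k) (h.hW₁ k)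
      (h.hν k) (h.hN k) (h.q₁_succ k) (h.q₂_succ k) rfl
  choose! C hC hwin hsib using hex
  let E : (∀ k, Fin (ν k) × Fin (N k)) → ℕ → Matrix (Fin 3) (Fin 3) ℤ := fun ω k =>
    Nat.rec E₀ (fun k M => M * C k (B * M.map (Int.cast : ℤ → ℝ)) (ω k).1 (ω k).2) k
  have hE0 : ∀ ω, E ω 0 = E₀ := fun ω => rfl
  have hEs : ∀ ω k, E ω (k + 1) =
    E ω k * C k (B * (E ω k).map (Int.cast : ℤ → ℝ)) (ω k).1 (ω k).2 := fun ω k => rfl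
  have hmul : ∀ M M' : Matrix (Fin 3) (Fin 3) ℤ, B * (M * M').map (Int.cast : ℤ → ℝ) =
      B * M.map (Int.cast : ℤ → ℝ) * M'.map (Int.cast : ℤ → ℝ) := by
    intro M M'
    rw [Matrix.mul_assoc]
    congr 1
    exact Matrix.map_mul (f := Int.castRingHom ℝ)
  have hpre : ∀ ω ω' k, (∀ i < k, ω i = ω' i) → E ω k = E ω' k := by
    intro ω ω' k hk
    induction k with
    | zero => rfl
    | succ k ih => rw [hEs, hEs, ih fun i hi => hk i (by omega), hk k (by omega)]
  have hadm : ∀ ω k, IsAdmissible (q₁ k) (q₂ k) (z k) (B * (E ω k).map (Int.cast : ℤ → ℝ)) := by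
    intro ω k
    induction k with
    | zero => exact hE₀
    | succ k ih =>
      rw [hEs, hmul]
      exact ((hC k _ ih _ _).1).mono (h.q₁_pos _) (h.q₂_pos' _) (h.z_pos k)
        (h.z_mono (Nat.le_succ k))
  refine ⟨E, _, _, fun _ _ => rfl, fun _ _ => rfl, hE0, hadm, ?_, ?_, ?_, ?_⟩
  · intro ω k
    rw [hEs, hmul]
    exact (hC k _ (hadm ω k) _ _).2.1
  · intro ω k
    rw [hEs, hmul]
    exact (hC k _ (hadm ω k) _ _).2.2
  · intro ω ω' k hag hne
    rw [hEs, hmul, hEs, hmul, hpre ω ω' k hag]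
    exact hwin k _ (hadm ω' k) _ _ _ _ hne
  · intro ω ω' k hag he hne
    rw [hEs, hmul, hEs, hmul, hpre ω ω' k hag, he]
    exact hsib k _ (hadm ω' k) _ _ _ hne

end Scales

lemma abs_sub_ge_of_close {a a' x x' d e f : ℝ} (h : d ≤ |x - x'|) (hx : |a - x| ≤ e)
    (hx' : |a' - x'| ≤ e) (hf : f + 2 * e ≤ d) : f ≤ |a - a'| := by
  rw [abs_le] at hx hx'
  rw [le_abs] at h ⊢
  rcases h with h | h
  · left; linarith
  · right; linarith

namespace Scales

variable {ν N : ℕ → ℕ} {z W₁ W₂ q₁ q₂ : ℕ → ℝ}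

/-- The set of limit points of the tree of admissible bases. -/
theorem exists_limit_map (h : Scales ν N z W₁ W₂ q₁ q₂) (B : Matrix (Fin 3) (Fin 3) ℝ)
    (E₀ : Matrix (Fin 3) (Fin 3) ℤ)
    (hE₀ : IsAdmissible (q₁ 0) (q₂ 0) (z 0) (B * E₀.map (Int.cast : ℤ → ℝ))) :
    ∃ p : (∀ k, Fin (ν k) × Fin (N k)) → EuclideanSpace ℝ (Fin 2),
      (∀ ω, |p ω 0 - center (B * E₀.map (Int.cast : ℤ → ℝ)) 0| ≤
          W₁ 0 * W₂ 0 / z 0 / (q₁ 1 * (q₁ 1 * q₂ 1)) ∧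
        |p ω 1 - center (B * E₀.map (Int.cast : ℤ → ℝ)) 1| ≤
          W₁ 0 * W₂ 0 / z 0 / (q₂ 1 * (q₁ 1 * q₂ 1))) ∧
      (∀ ω k, ∃ c : Fin 3 → ℤ, c ≠ 0 ∧
        |(B.mulVec fun i => (c i : ℝ)) 2| ≤ q₁ k * q₂ k ∧
        |(B.mulVec fun i => (c i : ℝ)) 0 + p ω 0 * (B.mulVec fun i => (c i : ℝ)) 2| ≤
          1 / (z k * q₁ (k + 1)) ∧
        |(B.mulVec fun i => (c i : ℝ)) 1 + p ω 1 * (B.mulVec fun i => (c i : ℝ)) 2| ≤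
          1 / (z k * q₂ (k + 1))) ∧
      (∀ k ω ω', (∀ i < k, ω i = ω' i) → (ω k).1 ≠ (ω' k).1 →
        1 / 2 * (1 / W₂ k) / (q₂ (k + 1) * (q₁ (k + 1) * q₂ (k + 1))) ≤ dist (p ω) (p ω')) ∧
      (∀ k ω ω', (∀ i < k, ω i = ω' i) → (ω k).1 = (ω' k).1 → (ω k).2 ≠ (ω' k).2 →
        1 / 2 * (1 / z k ^ 7) / (q₁ (k + 1) * (q₁ (k + 1) * q₂ (k + 1))) ≤
          dist (p ω) (p ω')) := by
  obtain ⟨E, x₁, x₂, hx₁, hx₂, hE0, hadm, hs₁, hs₂, hwin, hsib⟩ := h.exists_tree B E₀ hE₀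
  set b₁ : ℕ → ℝ := fun k => W₁ k * W₂ k / z k / (q₁ (k + 1) * (q₁ (k + 1) * q₂ (k + 1))) with hb₁
  set b₂ : ℕ → ℝ := fun k => W₁ k * W₂ k / z k / (q₂ (k + 1) * (q₁ (k + 1) * q₂ (k + 1))) with hb₂
  have hz := h.z_pos
  have hz6 := h.hz
  have hW₂ : ∀ k, 0 < W₂ k := fun k => by linarith [h.one_le_W₂ k]
  have hW₁ : ∀ k, 0 < W₁ k := fun k => by linarith [h.one_le_W₂ k, h.W₂_le k]
  have hq₁ := h.q₁_pos
  have hq₂ := h.q₂_pos'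
  have hb₁0 : ∀ k, 0 ≤ b₁ k := fun k => by
    have := hz k; have := hW₁ k; have := hW₂ k; have := hq₁ (k + 1); have := hq₂ (k + 1)
    simp only [hb₁]; positivity
  have hb₂0 : ∀ k, 0 ≤ b₂ k := fun k => by
    have := hz k; have := hW₁ k; have := hW₂ k; have := hq₁ (k + 1); have := hq₂ (k + 1)
    simp only [hb₂]; positivity
  have hb₁s : ∀ k, b₁ (k + 1) = 1 / (z (k + 1) * W₁ (k + 1)) /
      (q₁ (k + 1) * (q₁ (k + 1) * q₂ (k + 1))) := by
    intro k
    have := (hz (k + 1)).ne'; have := (hW₁ (k + 1)).ne'; have := (hW₂ (k + 1)).ne'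
    have := (hq₁ (k + 1)).ne'; have := (hq₂ (k + 1)).ne'
    simp only [hb₁, h.q₁_succ (k + 1), h.q₂_succ (k + 1)]
    field_simp
  have hb₂s : ∀ k, b₂ (k + 1) = 1 / (z (k + 1) * W₂ (k + 1)) /
      (q₂ (k + 1) * (q₁ (k + 1) * q₂ (k + 1))) := by
    intro k
    have := (hz (k + 1)).ne'; have := (hW₁ (k + 1)).ne'; have := (hW₂ (k + 1)).ne'
    have := (hq₁ (k + 1)).ne'; have := (hq₂ (k + 1)).ne'
    simp only [hb₂, h.q₁_succ (k + 1), h.q₂_succ (k + 1)]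
    field_simp
  have hY : ∀ k, 1 ≤ W₁ k * W₂ k / z k := by
    intro k
    rw [le_div_iff₀ (hz k), one_mul]
    have h1 : z k ≤ z k ^ 40 := le_self_pow₀ (by linarith [hz6 k]) (by norm_num)
    calc z k ≤ W₂ k := h1.trans (h.hW₂ k)
      _ ≤ W₁ k * W₂ k :=
        le_mul_of_one_le_left (hW₂ k).le ((h.one_le_W₂ k).trans (h.W₂_le k))
  have hsmall : ∀ k W, 1 ≤ W → 1 / (z (k + 1) * W) ≤ 1 / 8 * (W₁ k * W₂ k / z k) := by
    intro k W hW
    have h1 : 1 / (z (k + 1) * W) ≤ 1 / (8 * 1) := by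
      apply one_div_le_one_div_of_le (by norm_num)
      have := hz6 (k + 1)
      gcongr
      linarith
    linarith [hY k]
  have hn₁ : ∀ ω k, |x₁ ω (k + 1) - x₁ ω k| + b₁ (k + 1) ≤ b₁ k := by
    intro ω k
    have h2 := hsmall k (W₁ (k + 1)) ((h.one_le_W₂ _).trans (h.W₂_le _))
    have h3 := hY k
    have := hq₁ (k + 1); have := hq₂ (k + 1)
    rw [hb₁s]
    refine (add_le_add_left (hs₁ ω k) _).trans ?_
    rw [← add_div]
    simp only [hb₁]
    gcongr
    linarith
  have hn₂ : ∀ ω k, |x₂ ω (k + 1) - x₂ ω k| + b₂ (k + 1) ≤ b₂ k := by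
    intro ω k
    have h2 := hsmall k (W₂ (k + 1)) (h.one_le_W₂ _)
    have := hq₁ (k + 1); have := hq₂ (k + 1)
    rw [hb₂s]
    refine (add_le_add_left (hs₂ ω k) _).trans ?_
    rw [← add_div]
    simp only [hb₂]
    gcongr
    linarith
  choose p₁ hp₁ using fun ω => exists_abs_sub_le_of_nested (hn₁ ω) hb₁0
  choose p₂ hp₂ using fun ω => exists_abs_sub_le_of_nested (hn₂ ω) hb₂0
  have hdist : ∀ (u v : EuclideanSpace ℝ (Fin 2)) i, |u i - v i| ≤ dist u v := by
    intro u v i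
    rw [dist_eq_norm, ← Real.norm_eq_abs]
    exact PiLp.norm_apply_le (u - v) i
  have hcol : ∀ ω k i, (B * (E ω k).map (Int.cast : ℤ → ℝ)) i 0 =
      (B.mulVec fun j => (E ω k j 0 : ℝ)) i := fun ω k i => rfl
  have hkey : ∀ (b q : ℕ → ℝ) k (g : Matrix (Fin 3) (Fin 3) ℝ) (i : Fin 3) (t : ℝ),
      (∀ k, 0 < q k) → b k = W₁ k * W₂ k / z k / (q (k + 1) * (q₁ (k + 1) * q₂ (k + 1))) →
      0 < g 2 0 → g 2 0 ≤ q₁ k * q₂ k → |t - center g i| ≤ b k →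
      |g i 0 + t * g 2 0| ≤ 1 / (z k * q (k + 1)) := by
    intro b q k g i t hq hb hg hg' ht
    have := (hz k).ne'; have := (hW₁ k).ne'; have := (hW₂ k).ne'
    have := (hq (k + 1)).ne'; have := (hq₁ k).ne'; have := (hq₂ k).ne'
    have e : g i 0 + t * g 2 0 = (t - center g i) * g 2 0 := by
      rw [center]; field_simp; ring
    rw [e, abs_mul, abs_of_pos hg]
    refine (mul_le_mul ht hg' hg.le ((abs_nonneg _).trans ht)).trans (le_of_eq ?_)
    rw [hb, h.q₁_succ, h.q₂_succ]
    field_simp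
  refine ⟨fun ω => !₂[p₁ ω, p₂ ω], ?_, ?_, ?_, ?_⟩
  · intro ω
    have h1 := hp₁ ω 0
    have h2 := hp₂ ω 0
    rw [hx₁, hE0] at h1
    rw [hx₂, hE0] at h2
    exact ⟨h1, h2⟩
  · intro ω k
    have hpos := (hadm ω k).pos (hq₁ k) (hq₂ k) (hz k)
    have h1 := hp₁ ω k
    have h2 := hp₂ ω k
    rw [hx₁] at h1
    rw [hx₂] at h2
    refine ⟨fun j => E ω k j 0, ?_, ?_, ?_, ?_⟩
    · intro h0
      have h0' : (fun j => (E ω k j 0 : ℝ)) = 0 := by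
        funext j
        simpa using congrFun h0 j
      rw [hcol, h0', Matrix.mulVec_zero] at hpos
      exact lt_irrefl _ hpos
    · rw [← hcol, abs_of_pos hpos]
      exact (hadm ω k).hi
    · rw [← hcol, ← hcol]
      exact hkey b₁ q₁ k _ 0 (p₁ ω) hq₁ rfl hpos (hadm ω k).hi h1
    · rw [← hcol, ← hcol]
      exact hkey b₂ q₂ k _ 1 (p₂ ω) hq₂ rfl hpos (hadm ω k).hi h2
  · intro k ω ω' hag hne
    have h1 := hwin ω ω' k hag hne
    have h2 := hp₂ ω (k + 1)
    have h3 := hp₂ ω' (k + 1)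
    have h4 := hdist !₂[p₁ ω, p₂ ω] !₂[p₁ ω', p₂ ω'] 1
    refine le_trans ?_ h4
    have hD : 0 < q₂ (k + 1) * (q₁ (k + 1) * q₂ (k + 1)) := by
      have := hq₁ (k + 1); have := hq₂ (k + 1); positivity
    have h5 : b₂ (k + 1) ≤ 1 / 8 * (1 / W₂ k) / (q₂ (k + 1) * (q₁ (k + 1) * q₂ (k + 1))) := by
      rw [hb₂s, ← one_div_mul_one_div]
      gcongr
      · exact div_nonneg zero_le_one (hW₂ _).le
      · linarith [hz6 (k + 1)]
      · exact hW₂ k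
      · exact h.W₂_mono (Nat.le_succ k)
    exact abs_sub_ge_of_close h1 (h2.trans h5) (h3.trans h5) (by ring_nf; rfl)
  · intro k ω ω' hag he hne
    have hz7 : ∀ W, z (k + 1) ^ 40 ≤ W → 1 / (z (k + 1) * W) ≤ 1 / 8 * (1 / z k ^ 7) := by
      intro W hW
      have h1 : z k ^ 7 ≤ W := by
        refine le_trans ?_ hW
        refine (pow_le_pow_left₀ (hz k).le (h.z_mono (Nat.le_succ k)) 7).trans ?_
        exact pow_le_pow_right₀ (by linarith [hz6 (k + 1)]) (by norm_num)
      rw [one_div_mul_one_div]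
      have := hz k
      apply one_div_le_one_div_of_le (by positivity)
      exact mul_le_mul (by linarith [hz6 (k + 1)]) h1 (by positivity) (hz _).le
    have hqle := (h.q_bounds (k + 1)).2
    have := hq₁ (k + 1)
    have := hq₂ (k + 1)
    have := hz k
    rcases hsib ω ω' k hag he hne with h1 | h1
    · have h4 := hdist !₂[p₁ ω, p₂ ω] !₂[p₁ ω', p₂ ω'] 0
      refine le_trans ?_ h4
      have h5 : b₁ (k + 1) ≤ 1 / 8 * (1 / z k ^ 7) / (q₁ (k + 1) * (q₁ (k + 1) * q₂ (k + 1))) := by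
        rw [hb₁s]
        gcongr
        exact hz7 _ ((h.hW₂ _).trans (h.W₂_le _))
      exact abs_sub_ge_of_close h1 ((hp₁ ω (k + 1)).trans h5) ((hp₁ ω' (k + 1)).trans h5)
        (by
          have : 0 ≤ 1 / z k ^ 7 / (q₁ (k + 1) * (q₁ (k + 1) * q₂ (k + 1))) := by positivity
          rw [mul_div_assoc, mul_div_assoc]
          linarith)
    · have h4 := hdist !₂[p₁ ω, p₂ ω] !₂[p₁ ω', p₂ ω'] 1
      refine le_trans ?_ h4
      have h5 : b₂ (k + 1) ≤ 1 / 8 * (1 / z k ^ 7) / (q₂ (k + 1) * (q₁ (k + 1) * q₂ (k + 1))) := by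
        rw [hb₂s]
        gcongr
        exact hz7 _ (h.hW₂ _)
      refine le_trans (b := 1 / 2 * (1 / z k ^ 7) / (q₂ (k + 1) * (q₁ (k + 1) * q₂ (k + 1)))) ?_ ?_
      · gcongr
      · exact abs_sub_ge_of_close h1 ((hp₂ ω (k + 1)).trans h5) ((hp₂ ω' (k + 1)).trans h5)
          (by
            have : 0 ≤ 1 / z k ^ 7 / (q₂ (k + 1) * (q₁ (k + 1) * q₂ (k + 1))) := by positivity
            rw [mul_div_assoc, mul_div_assoc]
            linarith)

end Scales

lemma flow_mulVec (w₁ w₂ t : ℝ) (x : EuclideanSpace ℝ (Fin 2)) (B : Matrix (Fin 3) (Fin 3) ℝ)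
    (u : Fin 3 → ℝ) : (aMat w₁ w₂ t * hMat x * B).mulVec u =
      ![Real.exp (w₁ * t) * (B.mulVec u 0 + x 0 * B.mulVec u 2),
        Real.exp (w₂ * t) * (B.mulVec u 1 + x 1 * B.mulVec u 2),
        Real.exp (-t) * B.mulVec u 2] := by
  rw [← Matrix.mulVec_mulVec, ← Matrix.mulVec_mulVec]
  set v := B.mulVec u
  funext i
  rw [aMat, Matrix.mulVec_diagonal]
  fin_cases i <;> simp [hMat, Matrix.mulVec, dotProduct, Fin.sum_univ_three]

/-- Good simultaneous approximations at all scales give a divergent trajectory. -/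
theorem divergent_of_approximations {w₁ w₂ : ℝ} (hw₁ : 0 ≤ w₁) (hw₁' : w₁ ≤ 1) (hw₂ : 0 ≤ w₂)
    (hw₂' : w₂ ≤ 1) {Q z : ℕ → ℝ} (hQ : ∀ k, 1 ≤ Q k)
    (hQlim : Filter.Tendsto Q Filter.atTop Filter.atTop) (hz : ∀ k, 1 ≤ z k)
    (hzlim : Filter.Tendsto z Filter.atTop Filter.atTop) (hz2 : ∀ k, z (k + 1) ≤ 2 * z k)
    (B : Matrix (Fin 3) (Fin 3) ℝ) (x : EuclideanSpace ℝ (Fin 2))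
    (hx : ∀ k, ∃ c : Fin 3 → ℤ, c ≠ 0 ∧
        |(B.mulVec fun i => (c i : ℝ)) 2| ≤ Q k ∧
        |(B.mulVec fun i => (c i : ℝ)) 0 + x 0 * (B.mulVec fun i => (c i : ℝ)) 2| ≤
          1 / (z k * Q (k + 1) ^ w₁) ∧
        |(B.mulVec fun i => (c i : ℝ)) 1 + x 1 * (B.mulVec fun i => (c i : ℝ)) 2| ≤
          1 / (z k * Q (k + 1) ^ w₂)) (δ : ℝ) (hδ : 0 < δ) :
    ∃ T : ℝ, 0 ≤ T ∧ ∀ t : ℝ, T ≤ t → ∃ c : Fin 3 → ℤ, c ≠ 0 ∧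
      ‖(WithLp.equiv 2 (Fin 3 → ℝ)).symm
        ((aMat w₁ w₂ t * hMat x * B).mulVec (fun i => (c i : ℝ)))‖ < δ := by
  obtain ⟨K, hK⟩ := Filter.eventually_atTop.1 (hzlim.eventually_gt_atTop (12 / δ ^ 2))
  have hs : ∀ k, 1 ≤ √(z k) := fun k => Real.one_le_sqrt.2 (hz k)
  have hlim : Filter.Tendsto (fun k => Q k * √(z k)) Filter.atTop Filter.atTop :=
    Filter.tendsto_atTop_mono (fun k => le_mul_of_one_le_right (by linarith [hQ k]) (hs k)) hQlim
  refine ⟨Real.log (Q K * √(z K)), Real.log_nonneg ?_, fun t ht => ?_⟩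
  · exact one_le_mul_of_one_le_of_one_le (hQ K) (hs K)
  have hQ0 : ∀ k, 0 < Q k := fun k => by linarith [hQ k]
  have hz0 : ∀ k, 0 < z k := fun k => by linarith [hz k]
  have hs0 : ∀ k, 0 < √(z k) := fun k => by linarith [hs k]
  have hex : ∃ n, Real.exp t < Q (K + n) * √(z (K + n)) := by
    obtain ⟨n, hn⟩ := ((hlim.comp (Filter.tendsto_add_atTop_nat K)).eventually_gt_atTop
      (Real.exp t)).exists
    exact ⟨n, by simpa [add_comm] using hn⟩
  obtain ⟨k, hkK, hlo, hhi⟩ : ∃ k ≥ K, Q k * √(z k) ≤ Real.exp t ∧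
      Real.exp t ≤ Q (k + 1) * √(z (k + 1)) := by
    classical
    have hn0 : Nat.find hex ≠ 0 := by
      intro h0
      have := Nat.find_spec hex
      rw [h0] at this
      have h2 := (Real.log_le_iff_le_exp (mul_pos (hQ0 K) (hs0 K))).1 ht
      simp only [add_zero] at this
      linarith
    obtain ⟨m, hm⟩ := Nat.exists_eq_succ_of_ne_zero hn0
    refine ⟨K + m, by omega, ?_, ?_⟩
    · exact not_lt.1 (Nat.find_min hex (by omega : m < Nat.find hex))
    · have := Nat.find_spec hex
      rw [hm] at this
      exact this.le
  obtain ⟨c, hc, h2, h0, h1⟩ := hx k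
  refine ⟨c, hc, ?_⟩
  have hsz : √(z (k + 1)) / z k ≤ 2 / √(z k) := by
    rw [div_le_div_iff₀ (hz0 k) (hs0 k), ← Real.sqrt_mul (hz0 _).le]
    refine Real.sqrt_le_iff.2 ⟨by linarith [hz0 k], ?_⟩
    nlinarith [hz2 k, hz0 k]
  have hcoord : ∀ w, 0 ≤ w → w ≤ 1 → ∀ y, |y| ≤ 1 / (z k * Q (k + 1) ^ w) →
      |Real.exp (w * t) * y| ≤ 2 / √(z k) := by
    intro w hw hw' y hy
    rw [abs_mul, abs_of_pos (Real.exp_pos _), mul_comm w, Real.exp_mul]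
    have hQw : 0 < Q (k + 1) ^ w := Real.rpow_pos_of_pos (hQ0 _) _
    have := hz0 k
    have hQs := Real.rpow_nonneg (mul_nonneg (hQ0 (k + 1)).le (hs0 (k + 1)).le) w
    calc Real.exp t ^ w * |y| ≤ (Q (k + 1) * √(z (k + 1))) ^ w * (1 / (z k * Q (k + 1) ^ w)) := by
          gcongr
      _ = √(z (k + 1)) ^ w / z k := by
          rw [Real.mul_rpow (hQ0 _).le (hs0 _).le]
          field_simp
      _ ≤ √(z (k + 1)) / z k := by
          gcongr
          exact Real.rpow_le_self_of_one_le (hs _) hw'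
      _ ≤ _ := hsz
  have e0 := hcoord w₁ hw₁ hw₁' _ h0
  have e1 := hcoord w₂ hw₂ hw₂' _ h1
  have e2 : |Real.exp (-t) * (B.mulVec fun i => (c i : ℝ)) 2| ≤ 2 / √(z k) := by
    rw [abs_mul, abs_of_pos (Real.exp_pos _), Real.exp_neg, inv_mul_le_iff₀ (Real.exp_pos _)]
    refine h2.trans ?_
    have := hs0 k
    calc Q k ≤ Q k * √(z k) * (2 / √(z k)) := by
          rw [mul_assoc, mul_div_cancel₀ _ this.ne']
          linarith [hQ0 k]
      _ ≤ _ := by gcongr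
  rw [flow_mulVec]
  have hsq : ∀ y, |y| ≤ 2 / √(z k) → y ^ 2 ≤ 4 / z k := by
    intro y hy
    rw [← sq_abs]
    refine (pow_le_pow_left₀ (abs_nonneg y) hy 2).trans (le_of_eq ?_)
    rw [div_pow, Real.sq_sqrt (hz0 k).le]
    norm_num
  have h12 : 12 / z k < δ ^ 2 := by
    rw [div_lt_comm₀ (hz0 k) (by positivity)]
    exact hK k hkK
  rw [EuclideanSpace.norm_eq, Real.sqrt_lt' hδ]
  simp only [Fin.sum_univ_three, Real.norm_eq_abs, sq_abs]
  have f0 := hsq _ e0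
  have f1 := hsq _ e1
  have f2 := hsq _ e2
  have : 12 / z k = 4 / z k + 4 / z k + 4 / z k := by ring
  refine lt_of_le_of_lt (add_le_add (add_le_add ?_ ?_) ?_) (this ▸ h12)
  · exact f0
  · exact f1
  · exact f2

/-- Every nonempty open cone contains a primitive integer vector with nonzero middle entry. -/
theorem exists_primitive_mem_of_isOpen_cone {T : Set (Fin 3 → ℝ)} (hT : IsOpen T)
    (hne : T.Nonempty) (hcone : ∀ u, ∀ r : ℝ, 0 < r → u ∈ T → r • u ∈ T) :
    ∃ c : Fin 3 → ℤ, Int.gcd (c 0) (Int.gcd (c 1) (c 2)) = 1 ∧ 0 < Int.gcd (c 1) (c 2) ∧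
      (fun i => (c i : ℝ)) ∈ T := by
  have hd : Dense (Set.univ.pi fun _ : Fin 3 => Set.range ((↑) : ℚ → ℝ) \ {0}) :=
    dense_pi _ fun i _ => Rat.denseRange_cast.sdiff_singleton 0
  obtain ⟨u, hu, huT⟩ := hd.exists_mem_open hT hne
  choose q hq using fun i => (hu i (Set.mem_univ i)).1
  have hq0 : ∀ i, q i ≠ 0 := by
    intro i h0
    apply (hu i (Set.mem_univ i)).2
    rw [Set.mem_singleton_iff, ← hq i, h0, Rat.cast_zero]
  set M : ℕ := ∏ i, (q i).den with hM
  have hMpos : 0 < M := Finset.prod_pos fun i _ => (q i).den_pos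
  have hdvd : ∀ i, ∃ a : ℤ, (a : ℚ) = M * q i := by
    intro i
    obtain ⟨b, hb⟩ : (q i).den ∣ M := Finset.dvd_prod_of_mem _ (Finset.mem_univ i)
    refine ⟨b * (q i).num, ?_⟩
    rw [hb]
    push_cast
    rw [mul_comm ((q i).den : ℚ), mul_assoc, mul_comm ((q i).den : ℚ), Rat.mul_den_eq_num]
  choose a ha using hdvd
  have ha0 : ∀ i, a i ≠ 0 := by
    intro i h0
    have := ha i
    rw [h0, Int.cast_zero, eq_comm, mul_eq_zero] at this
    exact this.elim (by exact_mod_cast hMpos.ne') (hq0 i)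
  set G := Int.gcd (a 0) (Int.gcd (a 1) (a 2)) with hG
  have hGpos : 0 < G := Int.gcd_pos_of_ne_zero_left _ (ha0 0)
  have hGd : ∀ i, (G : ℤ) ∣ a i := by
    intro i
    have h12 : (G : ℤ) ∣ (Int.gcd (a 1) (a 2) : ℤ) := Int.gcd_dvd_right _ _
    fin_cases i
    · exact Int.gcd_dvd_left _ _
    · exact h12.trans (Int.gcd_dvd_left _ _)
    · exact h12.trans (Int.gcd_dvd_right _ _)
  choose c hc using hGd
  have hc0 : ∀ i, c i ≠ 0 := fun i h0 => ha0 i (by rw [hc i, h0, mul_zero])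
  refine ⟨c, ?_, Int.gcd_pos_of_ne_zero_left _ (hc0 1), ?_⟩
  · have h1 : Int.gcd (a 1) (a 2) = G * Int.gcd (c 1) (c 2) := by
      rw [hc 1, hc 2, Int.gcd_mul_left, Int.natAbs_natCast]
    have h2 : G = G * Int.gcd (c 0) (Int.gcd (c 1) (c 2)) := by
      conv_lhs => rw [hG, h1, hc 0, Nat.cast_mul, Int.gcd_mul_left, Int.natAbs_natCast]
    exact (Nat.mul_eq_left hGpos.ne').1 h2.symm
  · have hGr : (0 : ℝ) < G := by exact_mod_cast hGpos
    have hMr : (0 : ℝ) < M := by exact_mod_cast hMpos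
    convert hcone u (M / G) (div_pos hMr hGr) huT using 1
    funext i
    have h1 : (a i : ℝ) = M * q i := by exact_mod_cast ha i
    have h2 : (a i : ℝ) = G * c i := by exact_mod_cast hc i
    have h3 := mul_div_cancel_left₀ (c i : ℝ) hGr.ne'
    rw [Pi.smul_apply, smul_eq_mul, ← hq i, div_mul_eq_mul_div, ← h1, h2, h3]

/-- Every lattice has a basis whose first vector points into a prescribed open set and whose
second vector is in general position. -/
theorem exists_basis_center_mem {B : Matrix (Fin 3) (Fin 3) ℝ} (hB : |B.det| = 1)
    {U : Set (EuclideanSpace ℝ (Fin 2))} (hU : IsOpen U) (hne : U.Nonempty) :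
    ∃ (E : Matrix (Fin 3) (Fin 3) ℤ) (g : Matrix (Fin 3) (Fin 3) ℝ),
      g = B * E.map (Int.cast : ℤ → ℝ) ∧ |g.det| = 1 ∧ 0 < g 2 0 ∧
      !₂[center g 0, center g 1] ∈ U ∧ g 1 1 + center g 1 * g 2 1 ≠ 0 := by
  have hdet : B.det ≠ 0 := fun h => by simp [h] at hB
  set T : Set (Fin 3 → ℝ) := {u | 0 < B.mulVec u 2 ∧
    !₂[-(B.mulVec u 0 / B.mulVec u 2), -(B.mulVec u 1 / B.mulVec u 2)] ∈ U} with hT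
  have hcont : Continuous fun u : Fin 3 → ℝ => B.mulVec u := by fun_prop
  have hci : ∀ i, Continuous fun u : Fin 3 → ℝ => B.mulVec u i := fun i =>
    (continuous_apply i).comp hcont
  have hTopen : IsOpen T := by
    rw [isOpen_iff_mem_nhds]
    rintro u ⟨hu, huU⟩
    refine Filter.inter_mem ((isOpen_lt continuous_const (hci 2)).mem_nhds hu) ?_
    refine ContinuousAt.preimage_mem_nhds (f := fun u : Fin 3 → ℝ =>
      !₂[-(B.mulVec u 0 / B.mulVec u 2), -(B.mulVec u 1 / B.mulVec u 2)]) ?_ (hU.mem_nhds huU)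
    refine (PiLp.continuous_toLp 2 _).continuousAt.comp (continuousAt_pi.2 fun i => ?_)
    have h := fun i => ((hci i).continuousAt.div (hci 2).continuousAt hu.ne').neg (x := u)
    fin_cases i
    · exact h 0
    · exact h 1
  have hTne : T.Nonempty := by
    obtain ⟨x, hx⟩ := hne
    refine ⟨B⁻¹.mulVec ![-(x 0), -(x 1), 1], ?_⟩
    have : B.mulVec (B⁻¹.mulVec ![-(x 0), -(x 1), 1]) = ![-(x 0), -(x 1), 1] := by
      rw [Matrix.mulVec_mulVec, Matrix.mul_nonsing_inv _ (isUnit_iff_ne_zero.2 hdet),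
        Matrix.one_mulVec]
    rw [hT, Set.mem_ofPred_eq, this]
    refine ⟨by simp, ?_⟩
    convert hx using 1
    ext i
    fin_cases i <;> simp
  obtain ⟨c, hc1, hc2, hcT⟩ := exists_primitive_mem_of_isOpen_cone hTopen hTne (by
    rintro u r hr ⟨hu, huU⟩
    rw [hT, Set.mem_ofPred_eq, Matrix.mulVec_smul]
    simp only [Pi.smul_apply, smul_eq_mul]
    rw [mul_div_mul_left _ _ hr.ne', mul_div_mul_left _ _ hr.ne']
    exact ⟨mul_pos hr hu, huU⟩)
  obtain ⟨C, -, hC, hCc, -⟩ := exists_completion c hc1 hc2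
  have hcol : ∀ E : Matrix (Fin 3) (Fin 3) ℤ, (∀ k, E k 0 = c k) → ∀ i,
      (B * E.map (Int.cast : ℤ → ℝ)) i 0 = B.mulVec (fun i => (c i : ℝ)) i := by
    intro E hE i
    simp [Matrix.mul_apply, Matrix.mulVec, dotProduct, hE]
  have hmain : ∀ E : Matrix (Fin 3) (Fin 3) ℤ, (∀ k, E k 0 = c k) → |E.det| = 1 →
      |(B * E.map (Int.cast : ℤ → ℝ)).det| = 1 ∧ 0 < (B * E.map (Int.cast : ℤ → ℝ)) 2 0 ∧
      !₂[center (B * E.map (Int.cast : ℤ → ℝ)) 0, center (B * E.map (Int.cast : ℤ → ℝ)) 1] ∈ U := by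
    intro E hE hEd
    refine ⟨?_, ?_, ?_⟩
    · have : (E.map (Int.cast : ℤ → ℝ)).det = (E.det : ℝ) :=
        ((Int.castRingHom ℝ).map_det E).symm
      rw [Matrix.det_mul, abs_mul, hB, this, one_mul]
      exact_mod_cast hEd
    · rw [hcol E hE]
      exact hcT.1
    · rw [center, center, hcol E hE, hcol E hE, hcol E hE]
      exact hcT.2
  obtain ⟨h1, h2, h3⟩ := hmain C hCc (by rw [hC, abs_one])
  set g := B * C.map (Int.cast : ℤ → ℝ) with hg
  by_cases hβ : g 1 1 + center g 1 * g 2 1 = 0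
  · set C' := C.submatrix id (Equiv.swap (1 : Fin 3) 2) with hC'
    have hC'c : ∀ k, C' k 0 = c k := fun k => by
      rw [hC', Matrix.submatrix_apply, id, Equiv.swap_apply_of_ne_of_ne (by decide) (by decide),
        hCc]
    obtain ⟨h1', h2', h3'⟩ := hmain C' hC'c (by
      rw [hC', Matrix.det_permute', hC, Equiv.Perm.sign_swap (by decide)]
      simp)
    refine ⟨C', _, rfl, h1', h2', h3', ?_⟩
    have e0 : ∀ i, (B * C'.map (Int.cast : ℤ → ℝ)) i 0 = g i 0 := fun i => by
      rw [hcol C' hC'c, hg, hcol C hCc]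
    have e1 : ∀ i, (B * C'.map (Int.cast : ℤ → ℝ)) i 1 = g i 2 := fun i => by
      simp [hg, hC', Matrix.mul_apply]
    rw [e1, e1, center, e0, e0]
    rw [center] at hβ
    intro h0
    have hz : g.det = 0 := by
      have hne := h2.ne'
      have f0 : g 1 0 = g 1 0 / g 2 0 * g 2 0 := by field_simp
      have f1 : g 1 1 = g 1 0 / g 2 0 * g 2 1 := by linarith
      have f2 : g 1 2 = g 1 0 / g 2 0 * g 2 2 := by linarith
      rw [Matrix.det_fin_three, f1, f2]
      field_simp
      ring
    rw [hz, abs_zero] at h1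
    exact zero_ne_one h1
  · exact ⟨C, g, hg, h1, h2, h3, hβ⟩

/-- A basis in general position is admissible for all large values of the slack parameter. -/
theorem exists_forall_isAdmissible {g : Matrix (Fin 3) (Fin 3) ℝ} (hdet : |g.det| = 1)
    (hpos : 0 < g 2 0) (hβ : g 1 1 + center g 1 * g 2 1 ≠ 0) {q₁ q₂ : ℝ} (hq₁ : 0 < q₁)
    (hq₂ : 0 < q₂) (hq : g 2 0 ≤ q₁ * q₂) : ∃ Z : ℝ, ∀ z, Z ≤ z → IsAdmissible q₁ q₂ z g := by
  set a := |g 0 1 + center g 0 * g 2 1|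
  set b := |g 1 1 + center g 1 * g 2 1|
  have hb : 0 < b := abs_pos.2 hβ
  refine ⟨1 + q₁ * q₂ / g 2 0 + a * q₁ + b * q₂ + 1 / (b * q₂), fun z hz => ?_⟩
  have ha : 0 ≤ a := abs_nonneg _
  have p1 : 0 ≤ q₁ * q₂ / g 2 0 := by positivity
  have p2 : 0 ≤ a * q₁ := by positivity
  have p3 : 0 ≤ b * q₂ := by positivity
  have p4 : 0 ≤ 1 / (b * q₂) := by positivity
  have hz1 : 1 ≤ z := by linarith
  have hz0 : 0 < z := by linarith
  refine ⟨hdet, ?_, hq, ?_, ?_, ?_⟩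
  · rw [div_le_iff₀ (by positivity), ← div_le_iff₀' hpos]
    have := le_self_pow₀ hz1 two_ne_zero
    linarith
  · rw [le_div_iff₀ hq₁]
    linarith
  · rw [div_le_comm₀ (by positivity) hb]
    have := le_self_pow₀ hz1 (by norm_num : 5 ≠ 0)
    rw [← div_le_iff₀ hq₂, div_div]
    linarith
  · rw [le_div_iff₀ hq₂]
    linarith

/-- Covering estimate for the range of scales of a two-step tree whose separations and branching
numbers are controlled by powers of `Q k`. -/
theorem exists_cover_bound {ν N : ℕ → ℕ} {D ρ Q : ℕ → ℝ} {a b α β c K L s : ℝ}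
    (hN : ∀ k, 0 < N k) (hQ : ∀ k, 1 ≤ Q k) (hD : Filter.Tendsto D Filter.atTop (nhds 0))
    (hρ : Filter.Tendsto ρ Filter.atTop (nhds 0)) (hα : 0 < α) (hαβ : α ≤ β) (ha : 0 ≤ a)
    (hb : 0 ≤ b) (hc : 0 < c) (hDQ : ∀ k, c * Q k ^ (-α) ≤ D k)
    (hρQ : ∀ k, c * Q k ^ (-β) ≤ ρ k)
    (hν : ∀ k, ∏ i ∈ Finset.range k, (ν i : ℝ)⁻¹ ≤ K * Q k ^ (-a))
    (hN' : ∀ k, ∏ i ∈ Finset.range k, (N i : ℝ)⁻¹ ≤ L * Q k ^ (-b))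
    (hs : s ≤ a / α + b / β) : ∃ C : ℝ, ∀ r, 0 < r → r < c → ∃ k J : ℕ, (∀ i < k, r < ρ i) ∧
      (∀ i < J, r < D i) ∧ (∏ i ∈ Finset.Ico k J, (N i : ℝ)) *
        ∏ i ∈ Finset.range J, ((ν i * N i : ℕ) : ℝ)⁻¹ ≤ C * r ^ s := by
  have hQ0 : ∀ k, 0 < Q k := fun k => by linarith [hQ k]
  have hK : 0 ≤ K := by
    have := hν 0
    rw [Finset.prod_range_zero] at this
    exact (pos_of_mul_pos_left (by linarith) (Real.rpow_pos_of_pos (hQ0 0) _).le).le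
  have hL : 0 ≤ L := by
    have := hN' 0
    rw [Finset.prod_range_zero] at this
    exact (pos_of_mul_pos_left (by linarith) (Real.rpow_pos_of_pos (hQ0 0) _).le).le
  refine ⟨K * L * (1 / c) ^ s, fun r hr hrc => ?_⟩
  have hβ : 0 < β := hα.trans_le hαβ
  have exD : ∃ J, D J ≤ r := (hD.eventually_le_const hr).exists
  have exρ : ∃ k, ρ k ≤ r := (hρ.eventually_le_const hr).exists
  classical
  set J := Nat.find exD with hJ
  set k := Nat.find exρ with hk
  have hrc0 : 0 < r / c := div_pos hr hc
  have hJr : Q J ^ (-α) ≤ r / c := by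
    rw [le_div_iff₀' hc]
    exact (hDQ J).trans (Nat.find_spec exD)
  have hkr : Q k ^ (-β) ≤ r / c := by
    rw [le_div_iff₀' hc]
    exact (hρQ k).trans (Nat.find_spec exρ)
  have hmr : Q (min k J) ^ (-β) ≤ r / c := by
    rcases min_choice k J with h | h <;> rw [h]
    · exact hkr
    · exact (Real.rpow_le_rpow_of_exponent_le (hQ J) (neg_le_neg hαβ)).trans hJr
  have hconv : ∀ x p q : ℝ, 1 ≤ x → 0 < p → 0 ≤ q → x ^ (-p) ≤ r / c →
      x ^ (-q) ≤ (r / c) ^ (q / p) := by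
    intro x p q hx hp hq h
    calc x ^ (-q) = (x ^ (-p)) ^ (q / p) := by
          rw [← Real.rpow_mul (by linarith)]
          congr 1
          field_simp
      _ ≤ _ := Real.rpow_le_rpow (Real.rpow_nonneg (by linarith) _) h (by positivity)
  refine ⟨min k J, J, fun i hi => ?_, fun i hi => ?_, ?_⟩
  · exact not_le.1 (Nat.find_min exρ (hi.trans_le (min_le_left _ _)))
  · exact not_le.1 (Nat.find_min exD hi)
  have hsplit : (∏ i ∈ Finset.Ico (min k J) J, (N i : ℝ)) *
      ∏ i ∈ Finset.range J, ((ν i * N i : ℕ) : ℝ)⁻¹ =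
      (∏ i ∈ Finset.range J, (ν i : ℝ)⁻¹) * ∏ i ∈ Finset.range (min k J), (N i : ℝ)⁻¹ := by
    simp only [Nat.cast_mul, mul_inv]
    rw [Finset.prod_mul_distrib,
      ← Finset.prod_range_mul_prod_Ico (fun i => (N i : ℝ)⁻¹) (min_le_right k J)]
    have : (∏ i ∈ Finset.Ico (min k J) J, (N i : ℝ)) * ∏ i ∈ Finset.Ico (min k J) J, (N i : ℝ)⁻¹
        = 1 := by
      rw [← Finset.prod_mul_distrib]
      exact Finset.prod_eq_one fun i _ => mul_inv_cancel₀ (by exact_mod_cast (hN i).ne')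
    linear_combination (∏ i ∈ Finset.range J, (ν i : ℝ)⁻¹) *
      (∏ i ∈ Finset.range (min k J), (N i : ℝ)⁻¹) * this
  rw [hsplit]
  calc _ ≤ K * (r / c) ^ (a / α) * (L * (r / c) ^ (b / β)) := by
        refine mul_le_mul ((hν J).trans ?_) ((hN' _).trans ?_)
          (Finset.prod_nonneg fun i _ => by positivity) (by positivity)
        · exact mul_le_mul_of_nonneg_left (hconv _ _ _ (hQ J) hα ha hJr) hK
        · exact mul_le_mul_of_nonneg_left (hconv _ _ _ (hQ _) hβ hb hmr) hL
    _ = K * L * (r / c) ^ (a / α + b / β) := by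
        rw [Real.rpow_add hrc0]
        ring
    _ ≤ K * L * (r / c) ^ s := mul_le_mul_of_nonneg_left
        (Real.rpow_le_rpow_of_exponent_ge hrc0 ((div_le_one hc).2 hrc.le) hs) (by positivity)
    _ = _ := by
        rw [← one_div_mul_eq_div, Real.mul_rpow (by positivity) hr.le]
        ring

/-- The growth ratios `R₀ * 2 ^ k`. -/
def ratio (R : ℝ) (k : ℕ) : ℝ := R * 2 ^ k

/-- The denominators with growth ratios `ratio R`. -/
def denom (Q R : ℝ) (k : ℕ) : ℝ := Q * ∏ i ∈ Finset.range k, ratio R i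

section Parameters

variable {Q R : ℝ}

lemma denom_succ (Q R : ℝ) (k : ℕ) : denom Q R (k + 1) = denom Q R k * ratio R k := by
  rw [denom, denom, Finset.prod_range_succ, mul_assoc]

lemma le_ratio (hR : 0 ≤ R) (k : ℕ) : R ≤ ratio R k :=
  le_mul_of_one_le_right hR (one_le_pow₀ one_le_two)

lemma ratio_mono (hR : 0 ≤ R) : Monotone (ratio R) := fun _ _ h =>
  mul_le_mul_of_nonneg_left (pow_le_pow_right₀ one_le_two h) hR

lemma pow_le_denom (hQ : 1 ≤ Q) (hR : 0 ≤ R) (k : ℕ) : R ^ k ≤ denom Q R k := by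
  have h : R ^ k ≤ ∏ i ∈ Finset.range k, ratio R i := by
    simpa using Finset.prod_le_prod (s := Finset.range k) (f := fun _ => R) (fun _ _ => hR)
      fun i _ => le_ratio hR i
  exact h.trans (le_mul_of_one_le_left ((pow_nonneg hR k).trans h) hQ)

lemma one_le_denom (hQ : 1 ≤ Q) (hR : 1 ≤ R) (k : ℕ) : 1 ≤ denom Q R k :=
  (one_le_pow₀ hR).trans (pow_le_denom hQ (by linarith) k)

lemma tendsto_denom (hQ : 1 ≤ Q) (hR : 1 < R) :
    Filter.Tendsto (denom Q R) Filter.atTop Filter.atTop :=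
  Filter.tendsto_atTop_mono (pow_le_denom hQ (by linarith)) (tendsto_pow_atTop_atTop_of_one_lt hR)

lemma ratio_le_mul_denom_rpow {δ : ℝ} (hQ : 1 ≤ Q) (hR : 0 ≤ R) (hδ : 0 ≤ δ) (h2 : 2 ≤ R ^ δ)
    (k : ℕ) : ratio R k ≤ R * denom Q R k ^ δ := by
  refine mul_le_mul_of_nonneg_left ?_ hR
  calc (2 : ℝ) ^ k ≤ (R ^ δ) ^ k := pow_le_pow_left₀ (by norm_num) h2 k
    _ = (R ^ k) ^ δ := by
        rw [← Real.rpow_natCast, ← Real.rpow_natCast, ← Real.rpow_mul hR, ← Real.rpow_mul hR,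
          mul_comm]
    _ ≤ _ := Real.rpow_le_rpow (pow_nonneg hR k) (pow_le_denom hQ hR k) hδ

lemma prod_inv_le_denom_rpow {n : ℕ → ℕ} {a : ℝ} (hQ : 0 < Q) (hR : 0 < R)
    (hn : ∀ k, ratio R k ^ a ≤ n k) (k : ℕ) :
    ∏ i ∈ Finset.range k, (n i : ℝ)⁻¹ ≤ Q ^ a * denom Q R k ^ (-a) := by
  have hr : ∀ i, 0 < ratio R i := fun i => hR.trans_le (le_ratio hR.le i)
  calc ∏ i ∈ Finset.range k, (n i : ℝ)⁻¹ ≤ ∏ i ∈ Finset.range k, ratio R i ^ (-a) := by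
        refine Finset.prod_le_prod (fun i _ => by positivity) fun i _ => ?_
        rw [Real.rpow_neg (hr i).le]
        exact inv_anti₀ (Real.rpow_pos_of_pos (hr i) _) (hn i)
    _ = (∏ i ∈ Finset.range k, ratio R i) ^ (-a) :=
        Real.finsetProd_rpow _ _ (fun i _ => (hr i).le) _
    _ = _ := by
        rw [denom, Real.mul_rpow hQ.le (Finset.prod_nonneg fun i _ => (hr i).le), ← mul_assoc,
          ← Real.rpow_add hQ, add_neg_cancel, Real.rpow_zero, one_mul]

lemma rpow_sub_le_floor {x y δ : ℝ} (hx : 0 < x) (h : 2 ≤ x ^ δ) (hy : x ^ δ ≤ x ^ y) :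
    x ^ (y - δ) ≤ (⌊x ^ y⌋₊ : ℝ) := by
  have h1 := Nat.lt_floor_add_one (x ^ y)
  have h2 : x ^ (y - δ) ≤ x ^ y / 2 := by
    rw [Real.rpow_sub hx]
    gcongr
  linarith

end Parameters

section Parameters

variable {w₁ w₂ δ Q R : ℝ}

theorem scales_rpow (hsum : w₁ + w₂ = 1) (hδ : 0 < δ) (hδ₂ : 40 * δ ≤ w₂)
    (hδ₁ : 40 * δ ≤ w₁ - w₂) (hQ : 1 ≤ Q) (hR : 1 ≤ R) (hz : 10 ^ 6 ≤ R ^ δ)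
    (hlog : ∀ x, R ≤ x → 1 + Real.log x ≤ x ^ δ) :
    Scales (fun k => ⌊ratio R k ^ (1 + w₂ - 2 * δ)⌋₊) (fun k => ⌊ratio R k ^ (w₁ - 6 * δ)⌋₊)
      (fun k => ratio R k ^ δ) (fun k => ratio R k ^ w₁) (fun k => ratio R k ^ w₂)
      (fun k => denom Q R k ^ w₁) (fun k => denom Q R k ^ w₂) := by
  have hR0 : 0 ≤ R := by linarith
  have hle := le_ratio hR0
  have h0 : ∀ k, 0 < ratio R k := fun k => by linarith [hle k]
  have h1 : ∀ k, 1 ≤ ratio R k := fun k => by linarith [hle k]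
  have hQ0 : ∀ k, 0 < denom Q R k := fun k => by linarith [one_le_denom hQ hR k]
  have hpow : ∀ k (n : ℕ), (ratio R k ^ δ) ^ n = ratio R k ^ (δ * n) := fun k n => by
    rw [Real.rpow_mul (h0 k).le, Real.rpow_natCast]
  constructor
  · exact fun k => hz.trans (Real.rpow_le_rpow hR0 (hle k) hδ.le)
  · exact fun i j h => Real.rpow_le_rpow (h0 i).le (ratio_mono hR0 h) hδ.le
  · exact fun i j h => Real.rpow_le_rpow (h0 i).le (ratio_mono hR0 h) (by linarith)
  · intro k
    rw [← Real.rpow_add (h0 k), hsum, Real.rpow_one]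
    exact hlog _ (hle k)
  · intro k
    rw [hpow]
    exact Real.rpow_le_rpow_of_exponent_le (h1 k) (by push_cast; linarith)
  · intro k
    rw [hpow, ← Real.rpow_add (h0 k)]
    exact Real.rpow_le_rpow_of_exponent_le (h1 k) (by push_cast; linarith)
  · intro k
    refine (Nat.floor_le (Real.rpow_nonneg (h0 k).le _)).trans (le_of_eq ?_)
    rw [hpow, ← Real.rpow_add (h0 k), ← Real.rpow_add (h0 k), ← Real.rpow_sub (h0 k), hsum]
    push_cast
    rw [mul_comm δ]
  · intro k
    refine (Nat.floor_le (Real.rpow_nonneg (h0 k).le _)).trans (le_of_eq ?_)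
    rw [hpow, ← Real.rpow_sub (h0 k)]
    push_cast
    rw [mul_comm δ]
  · exact Real.rpow_pos_of_pos (hQ0 0) _
  · exact Real.rpow_le_rpow_of_exponent_le (one_le_denom hQ hR 0) (by linarith)
  · intro k
    rw [denom_succ, Real.mul_rpow (hQ0 k).le (h0 k).le]
  · intro k
    rw [denom_succ, Real.mul_rpow (hQ0 k).le (h0 k).le]

lemma rpow_mul_rpow_of_add_eq_one {x : ℝ} (hx : 0 < x) (hsum : w₁ + w₂ = 1) :
    x ^ w₁ * x ^ w₂ = x := by
  rw [← Real.rpow_add hx, hsum, Real.rpow_one]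

/-- The separations in the tree of bases decay at most like powers of the denominators. -/
lemma mul_denom_rpow_le_separation {u e A : ℝ} (hδ : 0 ≤ δ) (hQ : 1 ≤ Q) (hR : 1 ≤ R)
    (h2 : 2 ≤ R ^ δ) (hu : 0 ≤ u) (he : 0 ≤ e) (hA : 1 + u + e ≤ A) (k : ℕ) :
    1 / 2 * R ^ (-A) * denom Q R k ^ (-(1 + u + A * δ)) ≤
      1 / 2 * (1 / ratio R k ^ e) / (denom Q R (k + 1) ^ u * denom Q R (k + 1)) := by
  have hR0 : 0 < R := by linarith
  have h0 : 0 < ratio R k := hR0.trans_le (le_ratio hR0.le k)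
  have hQ0 : 0 < denom Q R k := by linarith [one_le_denom hQ hR k]
  have h1 : 1 ≤ ratio R k := hR.trans (le_ratio hR0.le k)
  have hAr : ratio R k ^ (1 + u + e) ≤ R ^ A * denom Q R k ^ (A * δ) := by
    calc ratio R k ^ (1 + u + e) ≤ ratio R k ^ A := Real.rpow_le_rpow_of_exponent_le h1 hA
      _ ≤ (R * denom Q R k ^ δ) ^ A := Real.rpow_le_rpow h0.le
          (ratio_le_mul_denom_rpow hQ hR0.le hδ h2 k) (by linarith)
      _ = _ := by
          rw [Real.mul_rpow hR0.le (by positivity), ← Real.rpow_mul hQ0.le, mul_comm δ]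
  have e1 : 1 / 2 * (1 / ratio R k ^ e) / (denom Q R (k + 1) ^ u * denom Q R (k + 1)) =
      1 / 2 * ((ratio R k ^ (1 + u + e))⁻¹ * (denom Q R k ^ (1 + u))⁻¹) := by
    rw [denom_succ, Real.mul_rpow hQ0.le h0.le, Real.rpow_add h0, Real.rpow_add h0,
      Real.rpow_add hQ0, Real.rpow_one, Real.rpow_one]
    field_simp
  have e2 : 1 / 2 * R ^ (-A) * denom Q R k ^ (-(1 + u + A * δ)) =
      1 / 2 * ((R ^ A * denom Q R k ^ (A * δ))⁻¹ * (denom Q R k ^ (1 + u))⁻¹) := by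
    rw [Real.rpow_neg hR0.le, Real.rpow_neg hQ0.le, Real.rpow_add hQ0]
    field_simp
  rw [e1, e2]
  gcongr

lemma tendsto_separation {u e : ℝ} (hQ : 1 ≤ Q) (hR : 1 < R) (hu : 0 ≤ u) (he : 0 ≤ e) :
    Filter.Tendsto (fun k => 1 / 2 * (1 / ratio R k ^ e) /
      (denom Q R (k + 1) ^ u * denom Q R (k + 1))) Filter.atTop (nhds 0) := by
  have hlim : Filter.Tendsto (fun k => (denom Q R (k + 1))⁻¹) Filter.atTop (nhds 0) :=
    ((tendsto_denom hQ hR).comp (Filter.tendsto_add_atTop_nat 1)).inv_tendsto_atTop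
  have h0 : ∀ k, 0 < ratio R k := fun k => by linarith [le_ratio (by linarith : 0 ≤ R) k]
  have hQ0 : ∀ k, 0 < denom Q R k := fun k => by linarith [one_le_denom hQ hR.le k]
  refine squeeze_zero (fun k => ?_) (fun k => ?_) hlim
  · have := h0 k
    have := hQ0 (k + 1)
    positivity
  · have h1 : 1 ≤ ratio R k ^ e :=
      Real.one_le_rpow (by linarith [le_ratio (by linarith : 0 ≤ R) k]) he
    have h2 : 1 ≤ denom Q R (k + 1) ^ u := Real.one_le_rpow (one_le_denom hQ hR.le _) hu
    rw [← one_div]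
    have h3 : 1 / ratio R k ^ e ≤ 1 := (div_le_one (by linarith)).2 h1
    refine div_le_div₀ zero_le_one (by linarith) (hQ0 _) (le_mul_of_one_le_left (hQ0 _).le h2)

/-- The covering estimate for the parameters of `scales_rpow`. -/
theorem exists_cover_bound_rpow {s : ℝ} (hsum : w₁ + w₂ = 1) (hδ : 0 < δ) (hδ₂ : 40 * δ ≤ w₂)
    (hδ₁ : 40 * δ ≤ w₁ - w₂) (hQ : 1 ≤ Q) (hR : 1 < R) (h2 : 2 ≤ R ^ δ)
    (hs : s ≤ (1 + w₂ - 3 * δ) / (1 + w₂ + 9 * δ) + (w₁ - 7 * δ) / (1 + w₁ + 9 * δ)) :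
    ∃ r₀ C : ℝ, 0 < r₀ ∧ ∀ r, 0 < r → r < r₀ → ∃ k J : ℕ,
      (∀ i < k, r < 1 / 2 * (1 / (ratio R i ^ δ) ^ 7) /
        (denom Q R (i + 1) ^ w₁ * (denom Q R (i + 1) ^ w₁ * denom Q R (i + 1) ^ w₂))) ∧
      (∀ i < J, r < 1 / 2 * (1 / ratio R i ^ w₂) /
        (denom Q R (i + 1) ^ w₂ * (denom Q R (i + 1) ^ w₁ * denom Q R (i + 1) ^ w₂))) ∧
      (∏ i ∈ Finset.Ico k J, (⌊ratio R i ^ (w₁ - 6 * δ)⌋₊ : ℝ)) *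
        ∏ i ∈ Finset.range J,
          ((⌊ratio R i ^ (1 + w₂ - 2 * δ)⌋₊ * ⌊ratio R i ^ (w₁ - 6 * δ)⌋₊ : ℕ) : ℝ)⁻¹ ≤
        C * r ^ s := by
  have hR0 : 0 < R := by linarith
  have h0 : ∀ k, 0 < ratio R k := fun k => by linarith [le_ratio hR0.le k]
  have h1 : ∀ k, 1 ≤ ratio R k := fun k => by linarith [le_ratio hR0.le k]
  have hQ0 : ∀ k, 0 < denom Q R k := fun k => by linarith [one_le_denom hQ hR.le k]
  have hz : ∀ k, 2 ≤ ratio R k ^ δ := fun k =>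
    h2.trans (Real.rpow_le_rpow hR0.le (le_ratio hR0.le k) hδ.le)
  have hfl : ∀ y, 2 * δ ≤ y → ∀ k, ratio R k ^ (y - δ) ≤ (⌊ratio R k ^ y⌋₊ : ℝ) := fun y hy k =>
    rpow_sub_le_floor (h0 k) (hz k) (Real.rpow_le_rpow_of_exponent_le (h1 k) (by linarith))
  have hNpos : ∀ k, 0 < ⌊ratio R k ^ (w₁ - 6 * δ)⌋₊ := fun k =>
    Nat.floor_pos.2 (Real.one_le_rpow (h1 k) (by linarith))
  have hpow : ∀ k, (ratio R k ^ δ) ^ 7 = ratio R k ^ (7 * δ) := fun k => by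
    rw [mul_comm, Real.rpow_mul (h0 k).le, ← Real.rpow_natCast]
    norm_num
  have hν := prod_inv_le_denom_rpow (a := 1 + w₂ - 3 * δ) (by linarith : 0 < Q) hR0 fun k =>
    (by ring : 1 + w₂ - 2 * δ - δ = 1 + w₂ - 3 * δ) ▸ hfl (1 + w₂ - 2 * δ) (by linarith) k
  have hN := prod_inv_le_denom_rpow (a := w₁ - 7 * δ) (by linarith : 0 < Q) hR0 fun k =>
    (by ring : w₁ - 6 * δ - δ = w₁ - 7 * δ) ▸ hfl (w₁ - 6 * δ) (by linarith) k
  obtain ⟨C, hC⟩ := exists_cover_bound (α := 1 + w₂ + 9 * δ) (β := 1 + w₁ + 9 * δ)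
    (c := 1 / 2 * R ^ (-(9 : ℝ))) hNpos (one_le_denom hQ hR.le)
    (tendsto_separation (u := w₂) (e := w₂) hQ hR (by linarith) (by linarith))
    (tendsto_separation (u := w₁) (e := 7 * δ) hQ hR (by linarith) (by linarith))
    (by linarith) (by linarith) (by linarith) (by linarith) (by positivity)
    (mul_denom_rpow_le_separation hδ.le hQ hR.le h2 (by linarith) (by linarith) (by linarith))
    (mul_denom_rpow_le_separation hδ.le hQ hR.le h2 (by linarith) (by linarith) (by linarith))
    hν hN hs
  refine ⟨1 / 2 * R ^ (-(9 : ℝ)), C, by positivity, fun r hr hrc => ?_⟩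
  simp only [rpow_mul_rpow_of_add_eq_one (hQ0 _) hsum, hpow]
  exact hC r hr hrc

/-- The parameters can be chosen such that the covering exponent is close to its supremum. -/
lemma exists_slack {s : ℝ} (hw₂ : 0 < w₂) (hw : w₂ < w₁) (hs : s < 2 - 1 / (1 + w₁)) :
    ∃ δ : ℝ, 0 < δ ∧ δ ≤ 1 ∧ 40 * δ ≤ w₂ ∧ 40 * δ ≤ w₁ - w₂ ∧
      s ≤ (1 + w₂ - 3 * δ) / (1 + w₂ + 9 * δ) + (w₁ - 7 * δ) / (1 + w₁ + 9 * δ) := by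
  have hlim : Filter.Tendsto (fun δ : ℝ => (1 + w₂ - 3 * δ) / (1 + w₂ + 9 * δ) +
      (w₁ - 7 * δ) / (1 + w₁ + 9 * δ)) (nhdsWithin 0 (Set.Ioi 0)) (nhds (2 - 1 / (1 + w₁))) := by
    have : ContinuousAt (fun δ : ℝ => (1 + w₂ - 3 * δ) / (1 + w₂ + 9 * δ) +
        (w₁ - 7 * δ) / (1 + w₁ + 9 * δ)) 0 := by
      refine ContinuousAt.add (ContinuousAt.div (by fun_prop) (by fun_prop) ?_)
        (ContinuousAt.div (by fun_prop) (by fun_prop) ?_) <;> linarith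
    convert this.tendsto.mono_left nhdsWithin_le_nhds using 2
    have : 1 + w₁ ≠ 0 := by linarith
    have : 1 + w₂ ≠ 0 := by linarith
    simp only [mul_zero, sub_zero, add_zero]
    field_simp
    ring
  have hsmall : ∀ c : ℝ, 0 < c → ∀ᶠ δ in nhdsWithin (0 : ℝ) (Set.Ioi 0), δ < c := fun c hc =>
    nhdsWithin_le_nhds (gt_mem_nhds hc)
  obtain ⟨δ, h1, h2, h3, h4, h5⟩ := ((hlim.eventually_const_lt hs).and
    ((hsmall 1 one_pos).and ((hsmall (w₂ / 40) (by linarith)).and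
    ((hsmall ((w₁ - w₂) / 40) (by linarith)).and self_mem_nhdsWithin)))).exists
  exact ⟨δ, h5, h2.le, by linarith, by linarith, h1.le⟩

end Parameters

lemma eventually_scale_conditions {δ : ℝ} (hδ : 0 < δ) (Z : ℝ) :
    ∀ᶠ R : ℝ in Filter.atTop, 1 < R ∧ Z ≤ R ^ δ ∧ ∀ x, R ≤ x → 1 + Real.log x ≤ x ^ δ := by
  have h1 : ∀ᶠ x : ℝ in Filter.atTop, 1 + Real.log x ≤ x ^ δ := by
    filter_upwards [(isLittleO_log_rpow_atTop hδ).bound (by norm_num : (0 : ℝ) < 1 / 2),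
      (tendsto_rpow_atTop hδ).eventually_ge_atTop 2, Filter.eventually_gt_atTop 0] with x hx h2 h0
    rw [Real.norm_eq_abs, Real.norm_of_nonneg (Real.rpow_nonneg h0.le _)] at hx
    linarith [le_abs_self (Real.log x)]
  filter_upwards [Filter.eventually_gt_atTop 1, (tendsto_rpow_atTop hδ).eventually_ge_atTop Z,
    Filter.eventually_forall_ge_atTop.2 h1] with R hR hZ hlog
  exact ⟨hR, hZ, hlog⟩

lemma ratio_succ (R : ℝ) (k : ℕ) : ratio R (k + 1) = 2 * ratio R k := by
  rw [ratio, ratio, pow_succ]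
  ring

lemma tendsto_ratio {R : ℝ} (hR : 0 < R) : Filter.Tendsto (ratio R) Filter.atTop Filter.atTop :=
  (tendsto_pow_atTop_atTop_of_one_lt one_lt_two).const_mul_atTop hR

lemma mem_ball_of_abs_sub_lt {x y : EuclideanSpace ℝ (Fin 2)} {ε : ℝ} (hε : 0 < ε)
    (h0 : |x 0 - y 0| ≤ ε / 2) (h1 : |x 1 - y 1| ≤ ε / 2) : x ∈ Metric.ball y ε := by
  rw [Metric.mem_ball, EuclideanSpace.dist_eq, Real.sqrt_lt' hε, Fin.sum_univ_two, Real.dist_eq,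
    Real.dist_eq]
  have e0 := pow_le_pow_left₀ (abs_nonneg _) h0 2
  have e1 := pow_le_pow_left₀ (abs_nonneg _) h1 2
  nlinarith

/-- For a weight `w = (w₁, w₂)` with `w₁ > w₂ > 0`, `w₁ + w₂ = 1`, any unimodular
lattice `Λ = Bℤ³` in `ℝ³` (given by a matrix `B` with `|det B| = 1`) and any nonempty
open set `U ⊆ ℝ²`, the set of `x ∈ U` such that the trajectory `{aₜ h(x) Λ : t ≥ 0}`
is divergent (in the Mahler compactness criterion form) has Hausdorff dimension at
least `2 - 1/(1+w₁)`. -/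
theorem dimH_divergent_slice (w₁ w₂ : ℝ) (hw₂ : 0 < w₂) (hw : w₂ < w₁)
    (hsum : w₁ + w₂ = 1) (B : Matrix (Fin 3) (Fin 3) ℝ) (hB : |B.det| = 1)
    (U : Set (EuclideanSpace ℝ (Fin 2))) (hUopen : IsOpen U) (hUne : U.Nonempty) :
    ENNReal.ofReal (2 - 1 / (1 + w₁)) ≤
      dimH {x ∈ U | ∀ δ : ℝ, 0 < δ → ∃ T : ℝ, 0 ≤ T ∧ ∀ t : ℝ, T ≤ t →
        ∃ c : Fin 3 → ℤ, c ≠ 0 ∧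
          ‖(WithLp.equiv 2 (Fin 3 → ℝ)).symm
            ((aMat w₁ w₂ t * hMat x * B).mulVec (fun i => (c i : ℝ)))‖ < δ} := by
  refine ENNReal.le_of_forall_nnreal_lt fun s hs => ?_
  obtain ⟨δ, hδ, hδ1, hδ₂, hδ₁, hsδ⟩ := exists_slack hw₂ hw
    ((ENNReal.lt_ofReal_iff_toReal_lt ENNReal.coe_ne_top).1 hs)
  rw [ENNReal.coe_toReal] at hsδ
  obtain ⟨E, g, hg, hdet, hpos, hgU, hβ⟩ := exists_basis_center_mem hB hUopen hUne
  obtain ⟨ε, hε, hεU⟩ := Metric.isOpen_iff.1 hUopen _ hgU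
  set Q := max (g 2 0) 1 with hQdef
  have hQ : 1 ≤ Q := le_max_right _ _
  have hQ0 : 0 < Q := by linarith
  obtain ⟨Z, hZ⟩ := exists_forall_isAdmissible hdet hpos hβ (Real.rpow_pos_of_pos hQ0 w₁)
    (Real.rpow_pos_of_pos hQ0 w₂) (by
      rw [rpow_mul_rpow_of_add_eq_one hQ0 hsum]
      exact le_max_left _ _)
  obtain ⟨R, hR, hRz, hlog⟩ :=
    (eventually_scale_conditions hδ (max (10 ^ 6) (max Z (2 / ε)))).exists
  have hR6 : 10 ^ 6 ≤ R ^ δ := (le_max_left _ _).trans hRz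
  have hRZ : Z ≤ R ^ δ := (le_max_left _ _).trans ((le_max_right _ _).trans hRz)
  have hRε : 2 / ε ≤ R ^ δ := (le_max_right _ _).trans ((le_max_right _ _).trans hRz)
  have hR0 : 0 < R := by linarith
  have hr0 : ∀ k, 0 < ratio R k := fun k => by linarith [le_ratio hR0.le k]
  have hr1 : ∀ k, 1 ≤ ratio R k := fun k => by linarith [le_ratio hR0.le k]
  have hd1 := one_le_denom hQ hR.le
  have hd0 : ∀ k, 0 < denom Q R k := fun k => by linarith [hd1 k]
  have hratio0 : ratio R 0 = R := by simp [ratio]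
  have hdenom0 : denom Q R 0 = Q := by simp [denom]
  have hscales := scales_rpow hsum hδ hδ₂ hδ₁ hQ hR.le hR6 hlog
  obtain ⟨p, hpU, hpdiv, hpD, hpρ⟩ := hscales.exists_limit_map B E (by
    rw [← hg]
    simp only [hratio0, hdenom0]
    exact hZ _ hRZ)
  rw [← hg] at hpU
  have : ∀ k, NeZero ⌊ratio R k ^ (1 + w₂ - 2 * δ)⌋₊ := fun k =>
    ⟨(Nat.floor_pos.2 (Real.one_le_rpow (hr1 k) (by linarith))).ne'⟩
  have : ∀ k, NeZero ⌊ratio R k ^ (w₁ - 6 * δ)⌋₊ := fun k =>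
    ⟨(Nat.floor_pos.2 (Real.one_le_rpow (hr1 k) (by linarith))).ne'⟩
  obtain ⟨r₀, C, hr₀, hC⟩ := exists_cover_bound_rpow hsum hδ hδ₂ hδ₁ hQ hR (by linarith) hsδ
  refine (le_dimH_range_of_separated hpD hpρ hr₀ hC).trans (dimH_mono ?_)
  have hsmall : ∀ w : ℝ, 0 ≤ w → ratio R 0 ^ w₁ * ratio R 0 ^ w₂ / ratio R 0 ^ δ /
      (denom Q R 1 ^ w * (denom Q R 1 ^ w₁ * denom Q R 1 ^ w₂)) ≤ ε / 2 := by
    intro w hw0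
    rw [rpow_mul_rpow_of_add_eq_one (hr0 0) hsum, rpow_mul_rpow_of_add_eq_one (hd0 1) hsum,
      denom_succ, hratio0, hdenom0, div_div, div_le_iff₀ (by positivity)]
    rw [div_le_iff₀ hε] at hRε
    have h1 : 1 ≤ (Q * R) ^ w := Real.one_le_rpow (one_le_mul_of_one_le_of_one_le hQ hR.le) hw0
    have h2 : R ≤ (Q * R) ^ w * (Q * R) :=
      (le_mul_of_one_le_left hR0.le hQ).trans (le_mul_of_one_le_left (by positivity) h1)
    calc R ≤ 1 * ((Q * R) ^ w * (Q * R)) := by rwa [one_mul]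
      _ ≤ ε / 2 * R ^ δ * ((Q * R) ^ w * (Q * R)) := by
          refine mul_le_mul_of_nonneg_right (by linarith) (by linarith)
      _ = _ := by ring
  rintro _ ⟨ω, rfl⟩
  refine ⟨hεU (mem_ball_of_abs_sub_lt hε ?_ ?_), ?_⟩
  · exact (hpU ω).1.trans (hsmall w₁ (by linarith))
  · exact (hpU ω).2.trans (hsmall w₂ hw₂.le)
  · refine divergent_of_approximations (by linarith) (by linarith) hw₂.le (by linarith) hd1
      (tendsto_denom hQ hR) (fun k => Real.one_le_rpow (hr1 k) hδ.le)
      ((tendsto_rpow_atTop hδ).comp (tendsto_ratio hR0)) (fun k => ?_) B (p ω) fun k => ?_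
    · rw [ratio_succ, Real.mul_rpow zero_le_two (hr0 k).le]
      exact mul_le_mul_of_nonneg_right (Real.rpow_le_self_of_one_le one_le_two hδ1)
        (Real.rpow_nonneg (hr0 k).le _)
    · have := hpdiv ω k
      rwa [rpow_mul_rpow_of_add_eq_one (hd0 k) hsum] at this
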